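/- Let 5/2 < α < 4 and s > 5/4 - α/2. Then there exist b > 1/2 and a constant C > 0 (depending on α, s, b) such that for all Schwartz functions u, v on ℝ³ = ℝ_t × ℝ²_{x,y}, ‖∂_x(uv)‖_{X^{s,b-1}} ≤ C ‖u‖_{X^{s,b}} ‖v‖_{X^{s,b}}. -/

import Mathlib

open MeasureTheory
open scoped ENNReal

/-- Dispersion relation `ω_α(ξ,η) = |ξ|^α ξ + η²/ξ`. -/
noncomputable def omegaDisp (α ξ η : ℝ) : ℝ := |ξ| ^ α * ξ + η ^ 2 / ξ

/-- Space-time Fourier transform on `ℝ³ = ℝ_t × ℝ²_{x,y}`. -/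
noncomputable def FT3 (u : ℝ × ℝ × ℝ → ℂ) (p : ℝ × ℝ × ℝ) : ℂ :=
  ∫ q : ℝ × ℝ × ℝ, Complex.exp (-Complex.I *
    ((q.1 * p.1 + q.2.1 * p.2.1 + q.2.2 * p.2.2 : ℝ) : ℂ)) * u q

/-- Fourier restriction norm
`‖u‖_{X^{s,b}} = ‖(1+|ξ|²)^{s/2} (1+|τ-ω_α(ξ,η)|²)^{b/2} û(τ,ξ,η)‖_{L²}`. -/
noncomputable def Xnorm (α s b : ℝ) (u : ℝ × ℝ × ℝ → ℂ) : ℝ≥0∞ :=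
  eLpNorm (fun p : ℝ × ℝ × ℝ =>
    (((1 + p.2.1 ^ 2) ^ (s / 2) *
        (1 + |p.1 - omegaDisp α p.2.1 p.2.2| ^ 2) ^ (b / 2) : ℝ) : ℂ) * FT3 u p) 2 volume

/-- `∂_x(uv)` on `ℝ³ = ℝ_t × ℝ_x × ℝ_y` (the `x` variable is the second coordinate). -/
noncomputable def dxProd (u v : ℝ × ℝ × ℝ → ℂ) (p : ℝ × ℝ × ℝ) : ℂ :=
  fderiv ℝ (fun q => u q * v q) p ((0 : ℝ), (1 : ℝ), (0 : ℝ))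


open MeasureTheory Set
open scoped ENNReal

namespace KP

/-- the bracket -/
noncomputable def jb (x : ℝ) : ℝ := 1 + |x|

lemma jb_one_le (x : ℝ) : 1 ≤ jb x := by unfold jb; linarith [abs_nonneg x]
lemma jb_pos (x : ℝ) : 0 < jb x := lt_of_lt_of_le one_pos (jb_one_le x)
lemma jb_abs_le (x : ℝ) : |x| ≤ jb x := by unfold jb; linarith
@[fun_prop] lemma jb_meas : Measurable jb := by unfold jb; fun_prop

lemma ofReal_le_mul_of {x y c : ℝ} (hc : 0 ≤ c) (h : x ≤ c * y) :
    ENNReal.ofReal x ≤ ENNReal.ofReal c * ENNReal.ofReal y := by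
  rw [← ENNReal.ofReal_mul hc]; exact ENNReal.ofReal_le_ofReal h

/-- `I1` base: finiteness -/
lemma base_fin (γ : ℝ) (hγ : 1 < γ) :
    ∫⁻ x : ℝ, ENNReal.ofReal ((1 + |x|) ^ (-γ)) < ∞ := by
  have h := integrable_one_add_norm (E := ℝ) (μ := volume) (r := γ) (by simpa using hγ)
  have := h.lintegral_lt_top
  simpa using this

lemma scale_lint (f : ℝ → ℝ≥0∞) (hf : Measurable f) (a l : ℝ) (hl : 0 < l) :
    ∫⁻ x : ℝ, f (l * (x - a)) = ENNReal.ofReal (1 / l) * ∫⁻ x : ℝ, f x := by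
  have h1 : ∫⁻ x : ℝ, f (l * (x - a)) = ∫⁻ x : ℝ, f (l * x) :=
    lintegral_sub_right_eq_self (fun x => f (l * x)) a
  rw [h1]
  have h2 := Real.map_volume_mul_left (a := l) hl.ne'
  have h3 : ∫⁻ x : ℝ, f (l * x) = ∫⁻ y, f y ∂(Measure.map (fun x => l * x) volume) := by
    rw [lintegral_map hf (by fun_prop)]
  rw [h3, h2, lintegral_smul_measure, abs_of_pos (by positivity), one_div, smul_eq_mul]

lemma I1 (γ : ℝ) (hγ : 1 < γ) : ∃ C : ℝ, 0 < C ∧ ∀ a l : ℝ, 0 < l →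
    ∫⁻ x : ℝ, ENNReal.ofReal ((1 + l * |x - a|) ^ (-γ)) ≤ ENNReal.ofReal (C / l) := by
  have hfin := base_fin γ hγ
  refine ⟨(∫⁻ x : ℝ, ENNReal.ofReal ((1 + |x|) ^ (-γ))).toReal + 1, by positivity, ?_⟩
  intro a l hl
  have := scale_lint (fun x => ENNReal.ofReal ((1 + |x|) ^ (-γ))) (by fun_prop) a l hl
  simp only [abs_mul, abs_of_pos hl] at this
  have e0 : ∀ X : ℝ, X / l = (1 / l) * X := fun X => by ring
  rw [this, e0 (_ + 1), ENNReal.ofReal_mul (by positivity)]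
  gcongr
  rw [← ENNReal.ofReal_toReal hfin.ne]
  apply ENNReal.ofReal_le_ofReal
  rw [ENNReal.toReal_ofReal ENNReal.toReal_nonneg]
  linarith

lemma rpow_neg_anti {x y g : ℝ} (hx : 0 < x) (hxy : x ≤ y) (hg : 0 ≤ g) : y ^ (-g) ≤ x ^ (-g) :=
  Real.rpow_le_rpow_of_nonpos hx hxy (by linarith)

lemma quad_pt (c y e : ℝ) (he : 0 ≤ e) : 
    (1 + |c - y ^ 2|) ^ (-e) ≤ (1 + (y - √c) ^ 2) ^ (-e) + (1 + (y + √c) ^ 2) ^ (-e) := by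
  have key : (y - √c) ^ 2 ≤ |c - y ^ 2| ∨ (y + √c) ^ 2 ≤ |c - y ^ 2| := by
    rcases le_total c 0 with hc | hc
    · left
      rw [Real.sqrt_eq_zero_of_nonpos hc]
      rw [abs_of_nonpos (by nlinarith [sq_nonneg y])]; nlinarith
    · have hs := Real.sq_sqrt hc
      have hs0 := Real.sqrt_nonneg c
      set d := √c with hd
      rw [← hs]
      rcases le_total 0 y with hy | hy
      · left
        rcases le_total d y with h | h
        · rw [abs_of_nonpos (by nlinarith)]; nlinarith
        · rw [abs_of_nonneg (by nlinarith)]; nlinarith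
      · right
        rcases le_total d (-y) with h | h
        · rw [abs_of_nonpos (by nlinarith)]; nlinarith
        · rw [abs_of_nonneg (by nlinarith)]; nlinarith
  rcases key with h | h
  · have := rpow_neg_anti (x := 1 + (y - √c) ^ 2) (y := 1 + |c - y ^ 2|) (g := e) (by positivity) (by linarith) he
    have h2 : 0 ≤ (1 + (y + √c) ^ 2) ^ (-e) := by positivity
    linarith
  · have := rpow_neg_anti (x := 1 + (y + √c) ^ 2) (y := 1 + |c - y ^ 2|) (g := e) (by positivity) (by linarith) he
    have h2 : 0 ≤ (1 + (y - √c) ^ 2) ^ (-e) := by positivity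
    linarith

lemma sqb (y e : ℝ) (he : 0 ≤ e) : (1 + y ^ 2) ^ (-e) ≤ 2 ^ e * (1 + |y|) ^ (-(2 * e)) := by
  have h1 : (1 + |y|) ^ 2 ≤ 2 * (1 + y ^ 2) := by
    have := sq_abs y
    nlinarith [sq_nonneg (|y| - 1)]
  have h2 : (1 + |y|) ^ (-(2 * e)) = ((1 + |y|) ^ 2) ^ (-e) := by
    rw [← Real.rpow_natCast, ← Real.rpow_mul (by positivity)]; congr 1; push_cast; ring
  rw [h2]
  have h3 := rpow_neg_anti (x := (1 + |y|) ^ 2) (g := e) (by positivity) h1 he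
  rw [Real.mul_rpow (by norm_num) (by positivity), Real.rpow_neg (by norm_num : (0:ℝ) ≤ 2)] at h3
  have h4 : (0:ℝ) < 2 ^ e := by positivity
  calc (1 + y ^ 2) ^ (-e) = 2 ^ e * ((2 ^ e)⁻¹ * (1 + y ^ 2) ^ (-e)) := by field_simp
    _ ≤ _ := by gcongr

lemma I2 (e : ℝ) (he : 1 / 2 < e) : ∃ C : ℝ, 0 < C ∧ ∀ c a k : ℝ, 0 < k →
    ∫⁻ x : ℝ, ENNReal.ofReal ((1 + |c - k * (x - a) ^ 2|) ^ (-e)) ≤ ENNReal.ofReal (C / √k) := by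
  obtain ⟨C, hC, h⟩ := I1 (2 * e) (by linarith)
  refine ⟨2 ^ e * (C + C), by positivity, ?_⟩
  intro c a k hk
  have hs : 0 < √k := Real.sqrt_pos.2 hk
  have hpt : ∀ x : ℝ, ENNReal.ofReal ((1 + |c - k * (x - a) ^ 2|) ^ (-e)) ≤
      ENNReal.ofReal (2 ^ e) * (ENNReal.ofReal ((1 + √k * |x - (a + √c / √k)|) ^ (-(2 * e)))
       + ENNReal.ofReal ((1 + √k * |x - (a - √c / √k)|) ^ (-(2 * e)))) := by
    intro x
    rw [← ENNReal.ofReal_add (by positivity) (by positivity)]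
    apply ofReal_le_mul_of (by positivity)
    have h0 : k * (x - a) ^ 2 = (√k * (x - a)) ^ 2 := by rw [mul_pow, Real.sq_sqrt hk.le]
    rw [h0]
    refine (quad_pt c _ e (by linarith)).trans ?_
    have h1 := sqb (√k * (x - a) - √c) e (by linarith)
    have h2 := sqb (√k * (x - a) + √c) e (by linarith)
    have e1 : |√k * (x - a) - √c| = √k * |x - (a + √c / √k)| := by
      rw [← abs_of_pos hs, ← abs_mul, abs_of_pos hs]; congr 1; field_simp; ring
    have e2 : |√k * (x - a) + √c| = √k * |x - (a - √c / √k)| := by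
      rw [← abs_of_pos hs, ← abs_mul, abs_of_pos hs]; congr 1; field_simp; ring
    rw [e1] at h1; rw [e2] at h2
    linarith
  refine (lintegral_mono hpt).trans ?_
  rw [lintegral_const_mul _ (by fun_prop), lintegral_add_left (by fun_prop)]
  have e3 : 2 ^ e * (C + C) / √k = 2 ^ e * (C / √k + C / √k) := by ring
  rw [e3, ENNReal.ofReal_mul (by positivity), ENNReal.ofReal_add (by positivity) (by positivity)]
  gcongr
  · exact h _ _ hs
  · exact h _ _ hs

lemma I3 (γ : ℝ) (hγ : 1 < γ) : ∃ C : ℝ, 0 < C ∧ ∀ c a k d : ℝ, 0 < k → 0 < d →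
    ∫⁻ x in {x : ℝ | d ≤ |x - a|}, ENNReal.ofReal ((1 + |c - k * (x - a) ^ 2|) ^ (-γ))
      ≤ ENNReal.ofReal (C / (k * d)) := by
  obtain ⟨C, hC, h⟩ := I1 γ hγ
  refine ⟨C + C, by positivity, ?_⟩
  intro c a k d hk hd
  have hkd : 0 < k * d := by positivity
  have hpt : ∀ x ∈ {x : ℝ | d ≤ |x - a|}, ENNReal.ofReal ((1 + |c - k * (x - a) ^ 2|) ^ (-γ)) ≤
      (ENNReal.ofReal ((1 + k * d * |x - (a + √(c / k))|) ^ (-γ))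
       + ENNReal.ofReal ((1 + k * d * |x - (a - √(c / k))|) ^ (-γ))) := by
    intro x hx
    simp only [mem_ofPred_eq] at hx
    rw [← ENNReal.ofReal_add (by positivity) (by positivity)]
    apply ENNReal.ofReal_le_ofReal
    set q := √(c / k) with hq
    have hq0 : 0 ≤ q := Real.sqrt_nonneg _
    set y := x - a with hy
    have e1 : x - (a + q) = y - q := by rw [hy]; ring
    have e2 : x - (a - q) = y + q := by rw [hy]; ring
    rw [e1, e2]
    have key : k * d * |y - q| ≤ |c - k * y ^ 2| ∨ k * d * |y + q| ≤ |c - k * y ^ 2| := by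
      rcases le_total c 0 with hc | hc
      · left
        have : q = 0 := Real.sqrt_eq_zero_of_nonpos (div_nonpos_of_nonpos_of_nonneg hc hk.le)
        rw [this, sub_zero, abs_of_nonpos (a := c - k * y ^ 2) (by nlinarith [mul_nonneg hk.le (sq_nonneg y)])]
        have : d * |y| ≤ y ^ 2 := by rw [← sq_abs]; nlinarith [abs_nonneg y]
        nlinarith
      · have hs : q ^ 2 = c / k := Real.sq_sqrt (by positivity)
        have hc' : c = k * q ^ 2 := by rw [hs]; field_simp
        have e3 : |c - k * y ^ 2| = k * (|y - q| * |y + q|) := by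
          rw [← abs_mul, hc', ← abs_of_pos hk, ← abs_mul, abs_of_pos hk, abs_sub_comm]; congr 1; ring
        rw [e3]
        rcases le_total 0 y with h0 | h0
        · left
          have : d ≤ |y + q| := by rw [abs_of_nonneg (by positivity)]; rw [abs_of_nonneg h0] at hx; linarith
          have := mul_le_mul_of_nonneg_left this (abs_nonneg (y - q))
          nlinarith
        · right
          have : d ≤ |y - q| := by rw [abs_of_nonpos (by linarith)]; rw [abs_of_nonpos h0] at hx; linarith
          have := mul_le_mul_of_nonneg_right this (abs_nonneg (y + q))
          nlinarith
    have p1 : 0 ≤ (1 + k * d * |y - q|) ^ (-γ) := by positivity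
    have p2 : 0 ≤ (1 + k * d * |y + q|) ^ (-γ) := by positivity
    rcases key with h | h
    · have := rpow_neg_anti (x := 1 + k * d * |y - q|) (y := 1 + |c - k * y ^ 2|) (g := γ) (by positivity) (by linarith) (by linarith)
      linarith
    · have := rpow_neg_anti (x := 1 + k * d * |y + q|) (y := 1 + |c - k * y ^ 2|) (g := γ) (by positivity) (by linarith) (by linarith)
      linarith
  have hm : MeasurableSet {x : ℝ | d ≤ |x - a|} := measurableSet_le (by fun_prop) (by fun_prop)
  refine (setLIntegral_mono (by fun_prop) hpt).trans ?_
  refine (setLIntegral_le_lintegral _ _).trans ?_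
  rw [lintegral_add_left (by fun_prop), add_div, ENNReal.ofReal_add (by positivity) (by positivity)]
  gcongr
  · exact h _ _ hkd
  · exact h _ _ hkd

lemma I4 (γ : ℝ) (hγ : 1 < γ) : ∃ C : ℝ, 0 < C ∧ ∀ (S : Set ℝ) (g : ℝ → ℝ) (l : ℝ), 0 < l → 
    (∀ x ∈ S, ∀ y ∈ S, l * |x - y| ≤ |g x - g y|) → ∀ c : ℝ,
    ∫⁻ x in S, ENNReal.ofReal ((1 + |g x - c|) ^ (-γ)) ≤ ENNReal.ofReal (C / l) := by
  obtain ⟨C, hC, h⟩ := I1 γ hγ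
  refine ⟨3 ^ γ * C, by positivity, ?_⟩
  intro S g l hl hg c
  rcases S.eq_empty_or_nonempty with hS | hS
  · simp [hS]
  obtain ⟨x0, hx0, hmin⟩ : ∃ x0 ∈ S, ∀ x ∈ S, |g x0 - c| ≤ |g x - c| + 1 := by
    have hne : ((fun x => |g x - c|) '' S).Nonempty := hS.image _
    obtain ⟨_, ⟨x0, hx0, rfl⟩, hlt⟩ := Real.lt_sInf_add_pos hne one_pos
    refine ⟨x0, hx0, fun x hx => ?_⟩
    have : sInf ((fun x => |g x - c|) '' S) ≤ |g x - c| :=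
      csInf_le ⟨0, by rintro _ ⟨z, _, rfl⟩; exact abs_nonneg _⟩ ⟨x, hx, rfl⟩
    simp only at hlt
    linarith
  have hpt : ∀ x ∈ S, ENNReal.ofReal ((1 + |g x - c|) ^ (-γ)) ≤
      ENNReal.ofReal (3 ^ γ) * ENNReal.ofReal ((1 + l * |x - x0|) ^ (-γ)) := by
    intro x hx
    apply ofReal_le_mul_of (by positivity)
    have h1 := hg x hx x0 hx0
    have h2 := hmin x hx
    have h3 : |g x - g x0| ≤ |g x - c| + |g x0 - c| := by
      have := abs_sub (g x - c) (g x0 - c); simpa using this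
    have h4 : 1 + l * |x - x0| ≤ 3 * (1 + |g x - c|) := by linarith [abs_nonneg (g x - c)]
    have h5 := rpow_neg_anti (x := 1 + l * |x - x0|) (g := γ) (by positivity) h4 (by linarith)
    rw [Real.mul_rpow (by norm_num) (by positivity), Real.rpow_neg (by norm_num : (0:ℝ) ≤ 3)] at h5
    calc (1 + |g x - c|) ^ (-γ) = 3 ^ γ * ((3 ^ γ)⁻¹ * (1 + |g x - c|) ^ (-γ)) := by field_simp
      _ ≤ _ := by gcongr
  refine (setLIntegral_mono (by fun_prop) hpt).trans ?_
  refine (setLIntegral_le_lintegral _ _).trans ?_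
  rw [lintegral_const_mul _ (by fun_prop), mul_div_assoc, ENNReal.ofReal_mul (by positivity)]
  gcongr
  exact h _ _ hl

/-- integral of `x^(t-1)` on `(0,R]`. -/
lemma I6 (t R : ℝ) (ht : 0 < t) (hR : 0 < R) :
    ∫⁻ x in Ioc (0:ℝ) R, ENNReal.ofReal (x ^ (t - 1)) = ENNReal.ofReal (R ^ t / t) := by
  have h1 : IntervalIntegrable (fun x : ℝ => x ^ (t - 1)) volume 0 R :=
    intervalIntegral.intervalIntegrable_rpow' (by linarith)
  rw [← ofReal_integral_eq_lintegral_ofReal ((intervalIntegrable_iff_integrableOn_Ioc_of_le hR.le).1 h1)]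
  · rw [← intervalIntegral.integral_of_le hR.le, integral_rpow (Or.inl (by linarith))]
    simp [Real.zero_rpow ht.ne']
  · filter_upwards [ae_restrict_mem measurableSet_Ioc] with x hx
    exact Real.rpow_nonneg hx.1.le _

/-- two-sided version -/
lemma I6' (t R a : ℝ) (ht : 0 < t) (hR : 0 < R) :
    ∫⁻ x in {x : ℝ | |x - a| ≤ R}, ENNReal.ofReal (|x - a| ^ (t - 1)) ≤ ENNReal.ofReal (2 * R ^ t / t) := by
  have hms : MeasurableSet {x : ℝ | |x| ≤ R} := measurableSet_le (by fun_prop) (by fun_prop)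
  have hms' : MeasurableSet {x : ℝ | |x - a| ≤ R} := measurableSet_le (by fun_prop) (by fun_prop)
  have e1 : ∫⁻ x in {x : ℝ | |x - a| ≤ R}, ENNReal.ofReal (|x - a| ^ (t - 1))
      = ∫⁻ x in {x : ℝ | |x| ≤ R}, ENNReal.ofReal (|x| ^ (t - 1)) := by
    rw [← lintegral_indicator hms, ← lintegral_indicator hms']
    exact lintegral_sub_right_eq_self (fun x => indicator {x : ℝ | |x| ≤ R} (fun x => ENNReal.ofReal (|x| ^ (t - 1))) x) a
  rw [e1]
  have hsub : {x : ℝ | |x| ≤ R} ⊆ Ioc 0 R ∪ (Icc (-R) 0) := by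
    intro x hx
    simp only [mem_ofPred_eq, abs_le] at hx
    rcases le_or_gt x 0 with h | h
    · right; exact ⟨hx.1, h⟩
    · left; exact ⟨h, hx.2⟩
  refine (lintegral_mono_set hsub).trans ?_
  refine (lintegral_union_le _ _ _).trans ?_
  have e2 : ∫⁻ x in Icc (-R) 0, ENNReal.ofReal (|x| ^ (t - 1)) = ∫⁻ x in Ioc 0 R, ENNReal.ofReal (x ^ (t - 1)) := by
    rw [← lintegral_indicator measurableSet_Icc]
    rw [← lintegral_neg_eq_self, ← setLIntegral_congr (Ico_ae_eq_Ioc (μ := volume) (a := (0:ℝ)) (b := R)),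
      setLIntegral_congr (Ico_ae_eq_Icc (μ := volume) (a := (0:ℝ)) (b := R)), ← lintegral_indicator measurableSet_Icc]
    apply lintegral_congr
    intro x
    by_cases hx : x ∈ Icc 0 R
    · rw [indicator_of_mem hx, indicator_of_mem (show -x ∈ Icc (-R) 0 from ⟨by linarith [hx.2], by linarith [hx.1]⟩), abs_neg, abs_of_nonneg hx.1]
    · rw [indicator_of_notMem hx, indicator_of_notMem]
      intro h; exact hx ⟨by linarith [h.2], by linarith [h.1]⟩
  have e3 : ∫⁻ x in Ioc 0 R, ENNReal.ofReal (|x| ^ (t - 1)) = ∫⁻ x in Ioc 0 R, ENNReal.ofReal (x ^ (t - 1)) := by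
    apply setLIntegral_congr_fun measurableSet_Ioc
    intro x hx
    simp only [abs_of_pos hx.1]
  rw [e2, e3, I6 t R ht hR, ← ENNReal.ofReal_add (by positivity) (by positivity)]
  apply ENNReal.ofReal_le_ofReal
  apply le_of_eq; ring

end KP


namespace KP

lemma jb_add_le {x y a : ℝ} (h : x + y = a) (hxy : jb x ≤ jb y) : jb a ≤ 2 * jb y := by
  unfold jb at *
  have := abs_add_le x y
  rw [h] at this; linarith

lemma jb_neg (x : ℝ) : jb (-x) = jb x := by simp [jb]

lemma jb_half {x y a e : ℝ} (h : x + y = a) (hxy : jb x ≤ jb y) (he : 0 ≤ e) :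
    jb y ^ (-e) ≤ 2 ^ e * jb a ^ (-e) := by
  have h1 := jb_add_le h hxy
  have h5 := rpow_neg_anti (x := jb a) (g := e) (jb_pos a) h1 he
  rw [Real.mul_rpow (by norm_num) (jb_pos y).le, Real.rpow_neg (by norm_num : (0:ℝ) ≤ 2)] at h5
  calc jb y ^ (-e) = 2 ^ e * ((2 ^ e)⁻¹ * jb y ^ (-e)) := by field_simp
    _ ≤ _ := by gcongr

lemma cv_half {x y a g e : ℝ} (h : x + y = a) (he : 0 ≤ e) (heg : e ≤ g) (hxy : jb x ≤ jb y) :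
    jb x ^ (-g) * jb y ^ (-g) ≤ 2 ^ e * jb a ^ (-e) * jb x ^ (-(2 * g - e)) := by
  have hx := jb_pos x
  have hy := jb_pos y
  have e1 : jb y ^ (-g) = jb y ^ (-e) * jb y ^ (-(g - e)) := by
    rw [← Real.rpow_add hy]; congr 1; ring
  have e2 : jb x ^ (-(2 * g - e)) = jb x ^ (-g) * jb x ^ (-(g - e)) := by
    rw [← Real.rpow_add hx]; congr 1; ring
  rw [e1, e2]
  have h1 := jb_half h hxy he
  have h2 := rpow_neg_anti (g := g - e) hx hxy (by linarith)
  calc jb x ^ (-g) * (jb y ^ (-e) * jb y ^ (-(g - e)))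
      ≤ jb x ^ (-g) * ((2 ^ e * jb a ^ (-e)) * jb x ^ (-(g - e))) := by
        have := Real.rpow_nonneg hx.le (-g)
        have := Real.rpow_nonneg (jb_pos a).le (-e)
        have := Real.rpow_nonneg hy.le (-(g-e))
        gcongr
    _ = _ := by ring

lemma cv_pt {x y a g e : ℝ} (h : x + y = a) (he : 0 ≤ e) (heg : e ≤ g) :
    jb x ^ (-g) * jb y ^ (-g) ≤
      2 ^ e * jb a ^ (-e) * (jb x ^ (-(2 * g - e)) + jb y ^ (-(2 * g - e))) := by
  have hx := jb_pos x
  have hy := jb_pos y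
  have ha := jb_pos a
  have p1 : 0 ≤ 2 ^ e * jb a ^ (-e) * jb x ^ (-(2 * g - e)) := by positivity
  have p2 : 0 ≤ 2 ^ e * jb a ^ (-e) * jb y ^ (-(2 * g - e)) := by positivity
  rw [mul_add]
  rcases le_total (jb x) (jb y) with hxy | hxy
  · have := cv_half h he heg hxy; linarith
  · have := cv_half (x := y) (y := x) (by linarith : y + x = a) he heg hxy
    linarith [mul_comm (jb x ^ (-g)) (jb y ^ (-g))]

lemma cv2_half {x y a g h L : ℝ} (hs : x + y = a) (hh : 0 ≤ h) (hhg : h ≤ g) (hL : 0 < L)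
    (hxy : jb x ≤ jb y) (hy' : L ≤ |x| ∨ L ≤ |y|) :
    jb x ^ (-g) * jb y ^ (-g) ≤ 2 ^ (g - h) * L ^ (-h) * jb a ^ (-(g - h)) * jb x ^ (-g) := by
  have hx := jb_pos x
  have hy := jb_pos y
  have hLy : L ≤ jb y := by
    rcases hy' with h1 | h1
    · exact (h1.trans (jb_abs_le x)).trans hxy
    · exact h1.trans (jb_abs_le y)
  have e1 : jb y ^ (-g) = jb y ^ (-h) * jb y ^ (-(g - h)) := by
    rw [← Real.rpow_add hy]; congr 1; ring
  rw [e1]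
  have h1 := jb_half (e := g - h) hs hxy (by linarith)
  have h2 := rpow_neg_anti (g := h) hL hLy hh
  calc jb x ^ (-g) * (jb y ^ (-h) * jb y ^ (-(g - h)))
      ≤ jb x ^ (-g) * (L ^ (-h) * (2 ^ (g - h) * jb a ^ (-(g - h)))) := by
        have := Real.rpow_nonneg hx.le (-g)
        gcongr
    _ = _ := by ring

lemma cv2_pt {x y a g h L : ℝ} (hs : x + y = a) (hh : 0 ≤ h) (hhg : h ≤ g) (hL : 0 < L)
    (hy' : L ≤ |x| ∨ L ≤ |y|) :
    jb x ^ (-g) * jb y ^ (-g) ≤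
      2 ^ (g - h) * L ^ (-h) * jb a ^ (-(g - h)) * (jb x ^ (-g) + jb y ^ (-g)) := by
  have hx := jb_pos x
  have hy := jb_pos y
  have ha := jb_pos a
  have p1 : 0 ≤ 2 ^ (g - h) * L ^ (-h) * jb a ^ (-(g - h)) * jb x ^ (-g) := by positivity
  have p2 : 0 ≤ 2 ^ (g - h) * L ^ (-h) * jb a ^ (-(g - h)) * jb y ^ (-g) := by positivity
  rw [mul_add]
  rcases le_total (jb x) (jb y) with hxy | hxy
  · have := cv2_half hs hh hhg hL hxy hy'; linarith
  · have := cv2_half (x := y) (y := x) (by linarith : y + x = a) hh hhg hL hxy hy'.symm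
    linarith [mul_comm (jb x ^ (-g)) (jb y ^ (-g))]

lemma jb_int (g : ℝ) (hg : 1 < g) : ∃ C : ℝ, 0 < C ∧ ∀ A : ℝ,
    ∫⁻ t : ℝ, ENNReal.ofReal (jb (t - A) ^ (-g)) ≤ ENNReal.ofReal C ∧
    ∫⁻ t : ℝ, ENNReal.ofReal (jb (A - t) ^ (-g)) ≤ ENNReal.ofReal C := by
  obtain ⟨C, hC, h⟩ := I1 g hg
  refine ⟨C, hC, fun A => ?_⟩
  have := h A 1 one_pos
  simp only [one_mul, div_one] at this
  refine ⟨this, ?_⟩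
  have e : ∀ t, jb (A - t) = jb (t - A) := fun t => by rw [← jb_neg]; congr 1; ring
  simp only [e]; exact this

lemma cv_int (g e : ℝ) (he : 0 ≤ e) (heg : e ≤ g) (hg : 1 < 2 * g - e) :
    ∃ C : ℝ, 0 < C ∧ ∀ A B : ℝ, ∫⁻ t : ℝ, ENNReal.ofReal (jb (t - A) ^ (-g) * jb (B - t) ^ (-g))
      ≤ ENNReal.ofReal (C * jb (B - A) ^ (-e)) := by
  obtain ⟨C, hC, h⟩ := jb_int (2 * g - e) hg
  refine ⟨2 ^ e * (C + C), by positivity, fun A B => ?_⟩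
  have hp := Real.rpow_nonneg (jb_pos (B - A)).le (-e)
  have hpt : ∀ t : ℝ, ENNReal.ofReal (jb (t - A) ^ (-g) * jb (B - t) ^ (-g)) ≤
      ENNReal.ofReal (2 ^ e * jb (B - A) ^ (-e)) *
        (ENNReal.ofReal (jb (t - A) ^ (-(2 * g - e))) + ENNReal.ofReal (jb (B - t) ^ (-(2 * g - e)))) := by
    intro t
    have q1 := Real.rpow_nonneg (jb_pos (t - A)).le (-(2 * g - e))
    have q2 := Real.rpow_nonneg (jb_pos (B - t)).le (-(2 * g - e))
    rw [← ENNReal.ofReal_add q1 q2]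
    exact ofReal_le_mul_of (by positivity) (cv_pt (by ring) he heg)
  refine (lintegral_mono hpt).trans ?_
  rw [lintegral_const_mul _ (by fun_prop), lintegral_add_left (by fun_prop)]
  have e3 : 2 ^ e * (C + C) * jb (B - A) ^ (-e) = 2 ^ e * jb (B - A) ^ (-e) * (C + C) := by ring
  rw [e3, ENNReal.ofReal_mul (p := 2 ^ e * jb (B - A) ^ (-e)) (by positivity), ENNReal.ofReal_add hC.le hC.le]
  gcongr
  · exact (h A).1
  · exact (h B).2

lemma cv2_int (g h : ℝ) (hh : 0 ≤ h) (hhg : h ≤ g) (hg : 1 < g) :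
    ∃ C : ℝ, 0 < C ∧ ∀ A B L : ℝ, 0 < L →
      ∫⁻ t in {t : ℝ | L ≤ |t - A| ∨ L ≤ |B - t|}, ENNReal.ofReal (jb (t - A) ^ (-g) * jb (B - t) ^ (-g))
      ≤ ENNReal.ofReal (C * (L ^ (-h) * jb (B - A) ^ (-(g - h)))) := by
  obtain ⟨C, hC, hI⟩ := jb_int g hg
  refine ⟨2 ^ (g - h) * (C + C), by positivity, fun A B L hL => ?_⟩
  have hp := Real.rpow_nonneg (jb_pos (B - A)).le (-(g - h))
  have hpt : ∀ t ∈ {t : ℝ | L ≤ |t - A| ∨ L ≤ |B - t|}, ENNReal.ofReal (jb (t - A) ^ (-g) * jb (B - t) ^ (-g)) ≤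
      ENNReal.ofReal (2 ^ (g - h) * L ^ (-h) * jb (B - A) ^ (-(g - h))) *
        (ENNReal.ofReal (jb (t - A) ^ (-g)) + ENNReal.ofReal (jb (B - t) ^ (-g))) := by
    intro t ht
    have q1 := Real.rpow_nonneg (jb_pos (t - A)).le (-g)
    have q2 := Real.rpow_nonneg (jb_pos (B - t)).le (-g)
    rw [← ENNReal.ofReal_add q1 q2]
    exact ofReal_le_mul_of (by positivity) (cv2_pt (by ring) hh hhg hL ht)
  refine (setLIntegral_mono (by fun_prop) hpt).trans ?_
  refine (setLIntegral_le_lintegral _ _).trans ?_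
  rw [lintegral_const_mul _ (by fun_prop), lintegral_add_left (by fun_prop)]
  have e3 : 2 ^ (g - h) * (C + C) * (L ^ (-h) * jb (B - A) ^ (-(g - h)))
      = 2 ^ (g - h) * L ^ (-h) * jb (B - A) ^ (-(g - h)) * (C + C) := by ring
  rw [e3, ENNReal.ofReal_mul (p := 2 ^ (g - h) * L ^ (-h) * jb (B - A) ^ (-(g - h))) (by positivity), ENNReal.ofReal_add hC.le hC.le]
  gcongr
  · exact (hI A).1
  · exact (hI B).2

/-! ### abstract Cauchy-Schwarz / Schur / Loomis-Whitney lemmas -/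

lemma cs {X : Type*} [MeasurableSpace X] (m : Measure X) (f g : X → ℝ≥0∞)
    (hf : AEMeasurable f m) (hg : AEMeasurable g m) :
    ∫⁻ x, f x * g x ∂m ≤ (∫⁻ x, f x ^ 2 ∂m) ^ (1 / 2 : ℝ) * (∫⁻ x, g x ^ 2 ∂m) ^ (1 / 2 : ℝ) := by
  have := ENNReal.lintegral_mul_le_Lp_mul_Lq m (Real.HolderConjugate.two_two) hf hg
  simpa using this

abbrev E3 := ℝ × ℝ × ℝ

instance instHaar2 : (volume : Measure (ℝ × ℝ)).IsAddHaarMeasure :=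
  inferInstanceAs ((volume : Measure ℝ).prod (volume : Measure ℝ)).IsAddHaarMeasure

instance instHaar3 : (volume : Measure (ℝ × ℝ × ℝ)).IsAddHaarMeasure :=
  inferInstanceAs ((volume : Measure ℝ).prod (volume : Measure (ℝ × ℝ))).IsAddHaarMeasure

/-- the `L²` norm -/
noncomputable def nrm (F : E3 → ℝ≥0∞) : ℝ≥0∞ := (∫⁻ p, F p ^ 2) ^ (1 / 2 : ℝ)

/-- the trilinear form -/
noncomputable def Tf (k : E3 × E3 → ℝ≥0∞) (G F1 F2 : E3 → ℝ≥0∞) : ℝ≥0∞ :=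
  ∫⁻ p1, ∫⁻ p2, G (p1 + p2) * F1 p1 * F2 p2 * k (p1, p2)

lemma half_mul (a b : ℝ≥0∞) : (a * b) ^ (1 / 2 : ℝ) = a ^ (1 / 2 : ℝ) * b ^ (1 / 2 : ℝ) :=
  ENNReal.mul_rpow_of_nonneg _ _ (by norm_num)

lemma half_sq (a : ℝ≥0∞) : (a ^ (1 / 2 : ℝ)) ^ 2 = a := by
  rw [← ENNReal.rpow_natCast, ← ENNReal.rpow_mul]; norm_num

lemma sq_half (a : ℝ≥0∞) : (a ^ 2) ^ (1 / 2 : ℝ) = a := by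
  rw [← ENNReal.rpow_natCast, ← ENNReal.rpow_mul]; norm_num

lemma le_half {a b : ℝ≥0∞} (h : a ^ 2 ≤ b) : a ≤ b ^ (1 / 2 : ℝ) := by
  rw [← sq_half a]; exact ENNReal.rpow_le_rpow h (by norm_num)

lemma schur (f : E3 → ℝ≥0∞) (h k : E3 × E3 → ℝ≥0∞) (hf : Measurable f) (hh : Measurable h)
    (hk : Measurable k) (C : ℝ≥0∞) (hC : ∀ x, ∫⁻ y, k (x, y) ^ 2 ≤ C) :
    ∫⁻ x, f x * ∫⁻ y, h (x, y) * k (x, y) ≤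
      C ^ (1 / 2 : ℝ) * (nrm f * (∫⁻ x, ∫⁻ y, h (x, y) ^ 2) ^ (1 / 2 : ℝ)) := by
  have h1 : ∀ x, f x * ∫⁻ y, h (x, y) * k (x, y) ≤
      C ^ (1 / 2 : ℝ) * (f x * (∫⁻ y, h (x, y) ^ 2) ^ (1 / 2 : ℝ)) := by
    intro x
    have := cs volume (fun y => h (x, y)) (fun y => k (x, y)) (by fun_prop) (by fun_prop)
    have h2 := ENNReal.rpow_le_rpow (hC x) (by norm_num : (0:ℝ) ≤ 1 / 2)
    calc f x * ∫⁻ y, h (x, y) * k (x, y)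
        ≤ f x * ((∫⁻ y, h (x, y) ^ 2) ^ (1 / 2 : ℝ) * C ^ (1 / 2 : ℝ)) := by
          gcongr; exact this.trans (by gcongr)
      _ = _ := by ring
  have hm : Measurable fun x => ∫⁻ y, h (x, y) ^ 2 :=
    Measurable.lintegral_prod_right' (f := fun z => h z ^ 2) (by fun_prop)
  refine (lintegral_mono h1).trans ?_
  rw [lintegral_const_mul _ (by fun_prop)]
  gcongr
  refine (cs volume f _ (by fun_prop) (by fun_prop)).trans ?_
  simp only [half_sq]
  rfl

lemma Tf_eq (k : E3 × E3 → ℝ≥0∞) (G F1 F2 : E3 → ℝ≥0∞) (hk : Measurable k)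
    (hG : Measurable G) (h1 : Measurable F1) (h2 : Measurable F2) :
    Tf k G F1 F2 = ∫⁻ p, G p * ∫⁻ p1, F1 p1 * F2 (p - p1) * k (p1, p - p1) := by
  unfold Tf
  have e1 : ∀ p1, ∫⁻ p2, G (p1 + p2) * F1 p1 * F2 p2 * k (p1, p2)
      = ∫⁻ p, G p * (F1 p1 * F2 (p - p1) * k (p1, p - p1)) := by
    intro p1
    rw [← lintegral_sub_right_eq_self _ p1]
    apply lintegral_congr; intro p
    rw [add_sub_cancel]; ring
  simp only [e1]
  rw [lintegral_lintegral_swap (by fun_prop)]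
  apply lintegral_congr; intro p
  rw [lintegral_const_mul _ (by fun_prop)]

lemma conv_sq (F1 F2 : E3 → ℝ≥0∞) (h1 : Measurable F1) (h2 : Measurable F2) :
    (∫⁻ p, ∫⁻ p1, (F1 p1 * F2 (p - p1)) ^ 2) ^ (1 / 2 : ℝ) = nrm F1 * nrm F2 := by
  rw [lintegral_lintegral_swap (by fun_prop)]
  have : ∀ y : E3, ∫⁻ x, (F1 y * F2 (x - y)) ^ 2 = F1 y ^ 2 * ∫⁻ x, F2 x ^ 2 := by
    intro y
    rw [← lintegral_sub_right_eq_self (fun x => F2 x ^ 2) y, ← lintegral_const_mul _ (by fun_prop)]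
    simp only [mul_pow]
  simp only [this]
  rw [lintegral_mul_const _ (by fun_prop), half_mul]; rfl

lemma fixP (k : E3 × E3 → ℝ≥0∞) (G F1 F2 : E3 → ℝ≥0∞) (hk : Measurable k)
    (hG : Measurable G) (h1 : Measurable F1) (h2 : Measurable F2) (C : ℝ≥0∞)
    (hC : ∀ p, ∫⁻ p1, k (p1, p - p1) ^ 2 ≤ C) :
    Tf k G F1 F2 ≤ C ^ (1 / 2 : ℝ) * (nrm G * nrm F1 * nrm F2) := by
  rw [Tf_eq k G F1 F2 hk hG h1 h2]
  have := schur G (fun z => F1 z.2 * F2 (z.1 - z.2)) (fun z => k (z.2, z.1 - z.2)) hG (by fun_prop)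
    (by fun_prop) C hC
  rw [conv_sq F1 F2 h1 h2] at this
  rw [mul_assoc (nrm G)]; exact this

lemma fixP1 (k : E3 × E3 → ℝ≥0∞) (G F1 F2 : E3 → ℝ≥0∞) (hk : Measurable k)
    (hG : Measurable G) (h1 : Measurable F1) (h2 : Measurable F2) (C : ℝ≥0∞)
    (hC : ∀ p1, ∫⁻ p2, k (p1, p2) ^ 2 ≤ C) :
    Tf k G F1 F2 ≤ C ^ (1 / 2 : ℝ) * (nrm G * nrm F1 * nrm F2) := by
  have := schur F1 (fun z => G (z.1 + z.2) * F2 z.2) k h1 (by fun_prop) hk C hC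
  have e1 : (∫⁻ p : E3, ∫⁻ p1 : E3, (G (p + p1) * F2 p1) ^ 2) ^ (1 / 2 : ℝ) = nrm G * nrm F2 := by
    rw [lintegral_lintegral_swap (by fun_prop)]
    have : ∀ y : E3, ∫⁻ x, (G (x + y) * F2 y) ^ 2 = (∫⁻ x, G x ^ 2) * F2 y ^ 2 := by
      intro y
      rw [← lintegral_add_right_eq_self (fun x => G x ^ 2) y, ← lintegral_mul_const _ (by fun_prop)]
      simp only [mul_pow]
    simp only [this]
    rw [lintegral_const_mul _ (by fun_prop), half_mul]; rfl
  simp only [e1] at this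
  refine le_trans (le_of_eq ?_) (this.trans (le_of_eq (by ring)))
  unfold Tf
  apply lintegral_congr; intro p1
  rw [← lintegral_const_mul _ (by fun_prop)]
  apply lintegral_congr; intro p2
  ring

lemma fixLW (k A B : E3 × E3 → ℝ≥0∞) (G F1 F2 : E3 → ℝ≥0∞) (hk : Measurable k)
    (hA : Measurable A) (hB : Measurable B)
    (hG : Measurable G) (h1 : Measurable F1) (h2 : Measurable F2) (C : ℝ≥0∞)
    (hkAB : ∀ z, k z ^ 2 ≤ A z * B z)
    (hC : ∀ p1 p2, ∫⁻ p, A (p1, p - p1) * B (p - p2, p2) ≤ C) :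
    Tf k G F1 F2 ≤ C ^ (1 / 2 : ℝ) * (nrm G * nrm F1 * nrm F2) := by
  rw [Tf_eq k G F1 F2 hk hG h1 h2]
  set U : E3 → ℝ≥0∞ := fun p => ∫⁻ p1, F1 p1 ^ 2 * A (p1, p - p1) with hU
  set V : E3 → ℝ≥0∞ := fun p => ∫⁻ p2, F2 p2 ^ 2 * B (p - p2, p2) with hV
  have hUm : Measurable U :=
    Measurable.lintegral_prod_right' (f := fun z : E3 × E3 => F1 z.2 ^ 2 * A (z.2, z.1 - z.2)) (by fun_prop)
  have hVm : Measurable V :=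
    Measurable.lintegral_prod_right' (f := fun z : E3 × E3 => F2 z.2 ^ 2 * B (z.1 - z.2, z.2)) (by fun_prop)
  have hpt : ∀ p, ∫⁻ p1, F1 p1 * F2 (p - p1) * k (p1, p - p1) ≤ (U p * V p) ^ (1 / 2 : ℝ) := by
    intro p
    have e : V p = ∫⁻ p1, F2 (p - p1) ^ 2 * B (p1, p - p1) := by
      rw [hV]; simp only
      rw [← lintegral_sub_left_eq_self _ p]
      apply lintegral_congr; intro x; rw [sub_sub_cancel]
    rw [half_mul, e]
    calc ∫⁻ p1, F1 p1 * F2 (p - p1) * k (p1, p - p1)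
        ≤ ∫⁻ p1, (F1 p1 * A (p1, p - p1) ^ (1 / 2 : ℝ)) * (F2 (p - p1) * B (p1, p - p1) ^ (1 / 2 : ℝ)) := by
          apply lintegral_mono; intro p1
          have := le_half (hkAB (p1, p - p1))
          rw [half_mul] at this
          calc F1 p1 * F2 (p - p1) * k (p1, p - p1)
              ≤ F1 p1 * F2 (p - p1) * (A (p1, p - p1) ^ (1 / 2 : ℝ) * B (p1, p - p1) ^ (1 / 2 : ℝ)) := by gcongr
            _ = _ := by ring
      _ ≤ _ := by
          refine (cs volume _ _ (by fun_prop) (by fun_prop)).trans (le_of_eq ?_)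
          simp only [mul_pow, half_sq, hU]
  calc ∫⁻ p, G p * ∫⁻ p1, F1 p1 * F2 (p - p1) * k (p1, p - p1)
      ≤ ∫⁻ p, G p * (U p * V p) ^ (1 / 2 : ℝ) := by
        apply lintegral_mono; intro p; exact mul_le_mul_right (hpt p) _
    _ ≤ nrm G * (∫⁻ p, U p * V p) ^ (1 / 2 : ℝ) := by
        refine (cs volume _ _ (by fun_prop) (by fun_prop)).trans (le_of_eq ?_)
        simp only [half_sq]; rfl
    _ ≤ nrm G * (C * ((∫⁻ p, F1 p ^ 2) * ∫⁻ p, F2 p ^ 2)) ^ (1 / 2 : ℝ) := by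
        gcongr
        have e1 : ∀ p, U p * V p = ∫⁻ p1, ∫⁻ p2, (F1 p1 ^ 2 * F2 p2 ^ 2) * (A (p1, p - p1) * B (p - p2, p2)) := by
          intro p
          rw [hU]; simp only
          rw [← lintegral_mul_const _ (by fun_prop)]
          apply lintegral_congr; intro p1
          rw [hV]; simp only
          rw [← lintegral_const_mul _ (by fun_prop)]
          apply lintegral_congr; intro p2; ring
        simp only [e1]
        have mm : Measurable fun w : (E3 × E3) × E3 => (F1 w.1.2 ^ 2 * F2 w.2 ^ 2) * (A (w.1.2, w.1.1 - w.1.2) * B (w.1.1 - w.2, w.2)) := by fun_prop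
        rw [lintegral_lintegral_swap (by exact (Measurable.lintegral_prod_right' mm).aemeasurable)]
        have e2 : ∀ p1, ∫⁻ p, ∫⁻ p2, (F1 p1 ^ 2 * F2 p2 ^ 2) * (A (p1, p - p1) * B (p - p2, p2))
            ≤ C * (F1 p1 ^ 2 * ∫⁻ p2, F2 p2 ^ 2) := by
          intro p1
          rw [lintegral_lintegral_swap (by fun_prop)]
          rw [← lintegral_const_mul _ (by fun_prop), ← lintegral_const_mul _ (by fun_prop)]
          apply lintegral_mono; intro p2
          simp only
          rw [lintegral_const_mul _ (by fun_prop), mul_comm]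
          gcongr; exact hC p1 p2
        refine (lintegral_mono e2).trans ?_
        rw [lintegral_const_mul _ (by fun_prop), lintegral_mul_const _ (by fun_prop)]
    _ = _ := by
        rw [half_mul, half_mul]; unfold nrm; ring

end KP


namespace KP

lemma iter3 (f : E3 → ℝ≥0∞) (hf : Measurable f) :
    ∫⁻ p, f p = ∫⁻ x : ℝ, ∫⁻ y : ℝ, ∫⁻ t : ℝ, f (t, x, y) := by
  have h1 : ∫⁻ p, f p = ∫⁻ q : ℝ × ℝ, ∫⁻ t : ℝ, f (t, q) := by
    rw [show (volume : Measure E3) = (volume : Measure ℝ).prod (volume : Measure (ℝ × ℝ)) from rfl,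
      lintegral_prod_symm' _ hf]
  rw [h1, show (volume : Measure (ℝ × ℝ)) = (volume : Measure ℝ).prod (volume : Measure ℝ) from rfl,
    lintegral_prod]
  exact (Measurable.lintegral_prod_left' (f := f) hf).aemeasurable

lemma slice (f : E3 → ℝ≥0∞) (hf : Measurable f) (S : Set ℝ) (hS : MeasurableSet S)
    (h0 : ∀ t x y, x ∉ S → f (t, x, y) = 0) (h : ℝ → ℝ≥0∞)
    (hh : ∀ x ∈ S, ∫⁻ y : ℝ, ∫⁻ t : ℝ, f (t, x, y) ≤ h x) :
    ∫⁻ p, f p ≤ ∫⁻ x in S, h x := by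
  rw [iter3 f hf, ← lintegral_indicator hS]
  apply lintegral_mono
  intro x
  by_cases hx : x ∈ S
  · simp only [indicator_of_mem hx]; exact hh x hx
  · simp only [indicator_of_notMem hx, h0 _ _ _ hx, lintegral_zero, le_refl]

/-- dispersion -/
noncomputable def om (α ξ η : ℝ) : ℝ := |ξ| ^ α * ξ + η ^ 2 / ξ

noncomputable def sg (α : ℝ) (p : E3) : ℝ := p.1 - om α p.2.1 p.2.2

@[fun_prop] lemma sg_meas (α : ℝ) : Measurable (sg α) := by unfold sg om; fun_prop

noncomputable def Pf (α x1 x2 : ℝ) : ℝ :=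
  |x1 + x2| ^ α * (x1 + x2) - |x1| ^ α * x1 - |x2| ^ α * x2

lemma reson (α x1 x2 y1 y2 : ℝ) (h1 : x1 ≠ 0) (h2 : x2 ≠ 0) (h : x1 + x2 ≠ 0) :
    om α (x1 + x2) (y1 + y2) - om α x1 y1 - om α x2 y2 =
      Pf α x1 x2 - x1 * x2 / (x1 + x2) * (y1 / x1 - y2 / x2) ^ 2 := by
  have : (y1 + y2) ^ 2 / (x1 + x2) - y1 ^ 2 / x1 - y2 ^ 2 / x2 =
      - (x1 * x2 / (x1 + x2) * (y1 / x1 - y2 / x2) ^ 2) := by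
    field_simp; ring
  unfold om Pf
  linarith

/-- boundedness of the trilinear form with kernel `k` -/
def Bd (k : E3 × E3 → ℝ≥0∞) : Prop :=
  ∃ C : ℝ≥0∞, C ≠ ∞ ∧ ∀ G F1 F2 : E3 → ℝ≥0∞, Measurable G → Measurable F1 → Measurable F2 →
    Tf k G F1 F2 ≤ C * (nrm G * nrm F1 * nrm F2)

lemma Bd.mono {k k' : E3 × E3 → ℝ≥0∞} (h : Bd k') (c : ℝ≥0∞) (hc : c ≠ ∞)
    (hk' : Measurable k') (hk : ∀ z, k z ≤ c * k' z) : Bd k := by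
  obtain ⟨C, hC, hB⟩ := h
  refine ⟨c * C, ENNReal.mul_ne_top hc hC, fun G F1 F2 hG h1 h2 => ?_⟩
  calc Tf k G F1 F2 ≤ c * Tf k' G F1 F2 := by
        unfold Tf
        rw [← lintegral_const_mul _ (by
          exact Measurable.lintegral_prod_right' (f := fun z : E3 × E3 =>
            G (z.1 + z.2) * F1 z.1 * F2 z.2 * k' (z.1, z.2)) (by fun_prop))]
        apply lintegral_mono; intro p1
        simp only
        rw [← lintegral_const_mul _ (by fun_prop)]
        apply lintegral_mono; intro p2
        calc _ ≤ G (p1 + p2) * F1 p1 * F2 p2 * (c * k' (p1, p2)) := mul_le_mul_right (hk _) _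
          _ = _ := by ring
    _ ≤ c * (C * (nrm G * nrm F1 * nrm F2)) := by gcongr; exact hB G F1 F2 hG h1 h2
    _ = _ := by ring

lemma Bd.add {k k' : E3 × E3 → ℝ≥0∞} (h : Bd k) (h' : Bd k') (hk : Measurable k) : Bd (fun z => k z + k' z) := by
  obtain ⟨C, hC, hB⟩ := h
  obtain ⟨C', hC', hB'⟩ := h'
  refine ⟨C + C', ENNReal.add_ne_top.2 ⟨hC, hC'⟩, fun G F1 F2 hG h1 h2 => ?_⟩
  have : Tf (fun z => k z + k' z) G F1 F2 = Tf k G F1 F2 + Tf k' G F1 F2 := by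
    unfold Tf
    rw [← lintegral_add_left (by
          exact Measurable.lintegral_prod_right' (f := fun z : E3 × E3 =>
            G (z.1 + z.2) * F1 z.1 * F2 z.2 * k (z.1, z.2)) (by fun_prop))]
    apply lintegral_congr; intro p1
    rw [← lintegral_add_left (by fun_prop)]
    apply lintegral_congr; intro p2
    ring
  rw [this, add_mul]
  exact add_le_add (hB G F1 F2 hG h1 h2) (hB' G F1 F2 hG h1 h2)

lemma Bd_union {k : E3 × E3 → ℝ≥0∞} (hk : Measurable k) {R S : Set (E3 × E3)} (hR : MeasurableSet R)
    (hS : MeasurableSet S) (h1 : Bd (R.indicator k)) (h2 : Bd (S.indicator k)) :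
    Bd ((R ∪ S).indicator k) := by
  have m1 := hk.indicator hR
  have m2 := hk.indicator hS
  refine (Bd.add h1 h2 m1).mono 1 (by simp) (m1.add m2) (fun z => ?_)
  rw [one_mul]
  by_cases hz : z ∈ R
  · simp [hz]
  · by_cases hz' : z ∈ S
    · simp [hz, hz']
    · simp [hz, hz']

lemma half_ne_top {C : ℝ≥0∞} (h : C ≠ ∞) : C ^ (1 / 2 : ℝ) ≠ ∞ :=
  ENNReal.rpow_ne_top_of_nonneg (by norm_num) h

lemma Bd_P (k : E3 × E3 → ℝ≥0∞) (hk : Measurable k) (C : ℝ≥0∞) (hC : C ≠ ∞)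
    (h : ∀ p, ∫⁻ p2, k (p - p2, p2) ^ 2 ≤ C) : Bd k := by
  refine ⟨_, half_ne_top hC, fun G F1 F2 hG h1 h2 => fixP k G F1 F2 hk hG h1 h2 C (fun p => ?_)⟩
  rw [← lintegral_sub_left_eq_self _ p]
  simpa using h p

lemma Bd_P1 (k : E3 × E3 → ℝ≥0∞) (hk : Measurable k) (C : ℝ≥0∞) (hC : C ≠ ∞)
    (h : ∀ p1, ∫⁻ p2, k (p1, p2) ^ 2 ≤ C) : Bd k :=
  ⟨_, half_ne_top hC, fun G F1 F2 hG h1 h2 => fixP1 k G F1 F2 hk hG h1 h2 C h⟩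

/-- the region `0 < ξ₂ ≤ ξ₁` -/
def R0 : Set (E3 × E3) := {z | 0 < z.2.2.1 ∧ z.2.2.1 ≤ z.1.2.1}

lemma R0_meas : MeasurableSet R0 := by
  unfold R0
  exact (measurableSet_lt (f := fun _ : E3 × E3 => (0 : ℝ)) (g := fun z => z.2.2.1) (by fun_prop) (by fun_prop)).inter
    (measurableSet_le (f := fun z : E3 × E3 => z.2.2.1) (g := fun z => z.1.2.1) (by fun_prop) (by fun_prop))

/-- slope difference -/
noncomputable def Df (z : E3 × E3) : ℝ := z.1.2.2 / z.1.2.1 - z.2.2.2 / z.2.2.1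

@[fun_prop] lemma Df_meas : Measurable Df := by unfold Df; fun_prop

lemma kappa_bd {ξ x : ℝ} (hx : 0 < x) (hxξ : x ≤ ξ / 2) :
    0 < (ξ - x) * x / ξ ∧ (ξ - x) * x / ξ ≤ x ∧ x / 2 ≤ (ξ - x) * x / ξ := by
  have hξ : 0 < ξ := by linarith
  refine ⟨by apply div_pos (mul_pos (by linarith) hx) hξ, ?_, ?_⟩
  · rw [div_le_iff₀ hξ]; nlinarith
  · rw [le_div_iff₀ hξ]; nlinarith

/-- quadratic form of the resonance, fixed output frequency -/
lemma reson_P (α τ ξ η x y : ℝ) (hx : 0 < x) (hxξ : x ≤ ξ / 2) :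
    (τ - om α (ξ - x) (η - y)) - om α x y =
      (τ - om α ξ η + Pf α (ξ - x) x) - (1 / ((ξ - x) * x / ξ)) * (y - η * x / ξ) ^ 2 := by
  have hξ : 0 < ξ := by linarith
  have h1 : 0 < ξ - x := by linarith
  have := reson α (ξ - x) x (η - y) y h1.ne' hx.ne' (by linarith)
  rw [sub_add_cancel, sub_add_cancel] at this
  have e : (ξ - x) * x / ξ * ((η - y) / (ξ - x) - y / x) ^ 2 =
      (1 / ((ξ - x) * x / ξ)) * (y - η * x / ξ) ^ 2 := by
    field_simp; ring
  rw [e] at this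
  linarith

lemma reson_D (ξ η x y : ℝ) (hx : 0 < x) (hxξ : x ≤ ξ / 2) :
    |(η - y) / (ξ - x) - y / x| = |y - η * x / ξ| / ((ξ - x) * x / ξ) := by
  have hξ : 0 < ξ := by linarith
  have h1 : 0 < ξ - x := by linarith
  have hk := (kappa_bd hx hxξ).1
  rw [eq_div_iff hk.ne']
  have e : ∀ A : ℝ, |A| * ((ξ - x) * x / ξ) = |A * ((ξ - x) * x / ξ)| := fun A => by
    rw [abs_mul, abs_of_pos hk]
  rw [e, ← abs_neg]
  congr 1
  field_simp; ring

lemma FP_A (α : ℝ) (k : E3 × E3 → ℝ≥0∞) (hkm : Measurable k) (w : ℝ → ℝ → ℝ) (hw0 : ∀ ξ x, 0 ≤ w ξ x)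
    (hz : ∀ p1 p2, (p1, p2) ∉ R0 → k (p1, p2) = 0)
    (hk : ∀ p1 p2, (p1, p2) ∈ R0 → k (p1, p2) ^ 2 ≤ ENNReal.ofReal
      (w (p1.2.1 + p2.2.1) p2.2.1 * (jb (sg α p2) ^ (-0.9 : ℝ) * jb (sg α p1) ^ (-0.9 : ℝ))))
    (C0 : ℝ) (hw : ∀ ξ > 0, ∫⁻ x in Ioc 0 (ξ / 2), ENNReal.ofReal (w ξ x * √x) ≤ ENNReal.ofReal C0) :
    Bd k := by
  obtain ⟨C1, hC1, h1⟩ := cv_int 0.9 0.7 (by norm_num) (by norm_num) (by norm_num)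
  obtain ⟨C2, hC2, h2⟩ := I2 0.7 (by norm_num)
  refine Bd_P k hkm (ENNReal.ofReal (C1 * C2) * ENNReal.ofReal C0)
    (ENNReal.mul_ne_top ENNReal.ofReal_ne_top ENNReal.ofReal_ne_top) ?_
  rintro ⟨τ, ξ, η⟩
  have hb : ∫⁻ p2, k ((τ, ξ, η) - p2, p2) ^ 2 ≤
      ∫⁻ x in Ioc 0 (ξ / 2), ENNReal.ofReal (C1 * C2) * ENNReal.ofReal (w ξ x * √x) := by
    apply slice _ (by fun_prop) _ measurableSet_Ioc
    · intro t x y hx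
      rw [hz, zero_pow two_ne_zero]
      intro hR; apply hx
      simp only [R0, mem_ofPred_eq, Prod.fst_sub, Prod.snd_sub] at hR
      exact ⟨hR.1, by linarith [hR.2]⟩
    · rintro x ⟨hx0, hx1⟩
      obtain ⟨k1, k2, k3⟩ := kappa_bd hx0 hx1
      have s1 : ∀ y t : ℝ, k ((τ, ξ, η) - (t, x, y), (t, x, y)) ^ 2 ≤ ENNReal.ofReal (w ξ x) *
          ENNReal.ofReal (jb (t - om α x y) ^ (-0.9 : ℝ) * jb ((τ - om α (ξ - x) (η - y)) - t) ^ (-0.9 : ℝ)) := by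
        intro y t
        have := hk ((τ, ξ, η) - (t, x, y)) (t, x, y) (by
          simp only [R0, mem_ofPred_eq, Prod.fst_sub, Prod.snd_sub]; exact ⟨hx0, by linarith⟩)
        simp only [sg, Prod.fst_sub, Prod.snd_sub, sub_add_cancel] at this
        rw [← ENNReal.ofReal_mul (hw0 _ _), show τ - om α (ξ - x) (η - y) - t = τ - t - om α (ξ - x) (η - y) by ring]
        exact this
      have s2 : ∀ y : ℝ, ∫⁻ t : ℝ, k ((τ, ξ, η) - (t, x, y), (t, x, y)) ^ 2 ≤ ENNReal.ofReal (w ξ x * C1) *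
          ENNReal.ofReal ((1 + |(τ - om α ξ η + Pf α (ξ - x) x) - (1 / ((ξ - x) * x / ξ)) * (y - η * x / ξ) ^ 2|) ^ (-0.7 : ℝ)) := by
        intro y
        refine (lintegral_mono (s1 y)).trans ?_
        rw [lintegral_const_mul _ (by fun_prop)]
        refine (mul_le_mul_right (h1 _ _) _).trans ?_
        rw [reson_P α τ ξ η x y hx0 hx1, ENNReal.ofReal_mul hC1.le, ENNReal.ofReal_mul (hw0 _ _), mul_assoc]
        rfl
      refine (lintegral_mono s2).trans ?_
      rw [lintegral_const_mul _ (by fun_prop)]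
      refine (mul_le_mul_right (h2 _ _ _ (by positivity)) _).trans ?_
      rw [← ENNReal.ofReal_mul (mul_nonneg (hw0 _ _) hC1.le), ← ENNReal.ofReal_mul (by positivity)]
      apply ENNReal.ofReal_le_ofReal
      have e : C2 / √(1 / ((ξ - x) * x / ξ)) = C2 * √((ξ - x) * x / ξ) := by
        rw [one_div, Real.sqrt_inv, div_inv_eq_mul]
      rw [e]
      calc w ξ x * C1 * (C2 * √((ξ - x) * x / ξ)) ≤ w ξ x * C1 * (C2 * √x) := by
            have := hw0 ξ x; gcongr
        _ = _ := by ring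
  refine hb.trans ?_
  rw [lintegral_const_mul' _ _ ENNReal.ofReal_ne_top]
  gcongr
  rcases lt_or_ge 0 ξ with h | h
  · exact hw ξ h
  · rw [Ioc_eq_empty (by linarith)]; simp

lemma FP_C (α g : ℝ) (hg : 1 < g) (d : ℝ → ℝ) (hd : ∀ ξ > 0, 0 < d ξ) (k : E3 × E3 → ℝ≥0∞) (hkm : Measurable k) (w : ℝ → ℝ → ℝ) (hw0 : ∀ ξ x, 0 ≤ w ξ x)
    (hz : ∀ p1 p2, (p1, p2) ∉ R0 → k (p1, p2) = 0)
    (hD : ∀ p1 p2, |Df (p1, p2)| < d (p1.2.1 + p2.2.1) → k (p1, p2) = 0)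
    (hk : ∀ p1 p2, (p1, p2) ∈ R0 → k (p1, p2) ^ 2 ≤ ENNReal.ofReal
      (w (p1.2.1 + p2.2.1) p2.2.1 * (jb (sg α p2) ^ (-g) * jb (sg α p1) ^ (-g))))
    (C0 : ℝ) (hw : ∀ ξ > 0, ∫⁻ x in Ioc 0 (ξ / 2), ENNReal.ofReal (w ξ x / d ξ) ≤ ENNReal.ofReal C0) :
    Bd k := by
  obtain ⟨C1, hC1, h1⟩ := cv_int g g (by linarith) le_rfl (by linarith)
  obtain ⟨C2, hC2, h2⟩ := I3 g hg
  refine Bd_P k hkm (ENNReal.ofReal (C1 * C2) * ENNReal.ofReal C0)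
    (ENNReal.mul_ne_top ENNReal.ofReal_ne_top ENNReal.ofReal_ne_top) ?_
  rintro ⟨τ, ξ, η⟩
  have hb : ∫⁻ p2, k ((τ, ξ, η) - p2, p2) ^ 2 ≤
      ∫⁻ x in Ioc 0 (ξ / 2), ENNReal.ofReal (C1 * C2) * ENNReal.ofReal (w ξ x / d ξ) := by
    apply slice _ (by fun_prop) _ measurableSet_Ioc
    · intro t x y hx
      rw [hz, zero_pow two_ne_zero]
      intro hR; apply hx
      simp only [R0, mem_ofPred_eq, Prod.fst_sub, Prod.snd_sub] at hR
      exact ⟨hR.1, by linarith [hR.2]⟩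
    · rintro x ⟨hx0, hx1⟩
      obtain ⟨k1, k2, k3⟩ := kappa_bd hx0 hx1
      have s1 : ∀ y t : ℝ, k ((τ, ξ, η) - (t, x, y), (t, x, y)) ^ 2 ≤ ENNReal.ofReal (w ξ x) *
          ENNReal.ofReal (jb (t - om α x y) ^ (-g) * jb ((τ - om α (ξ - x) (η - y)) - t) ^ (-g)) := by
        intro y t
        have := hk ((τ, ξ, η) - (t, x, y)) (t, x, y) (by
          simp only [R0, mem_ofPred_eq, Prod.fst_sub, Prod.snd_sub]; exact ⟨hx0, by linarith⟩)
        simp only [sg, Prod.fst_sub, Prod.snd_sub, sub_add_cancel] at this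
        rw [← ENNReal.ofReal_mul (hw0 _ _), show τ - om α (ξ - x) (η - y) - t = τ - t - om α (ξ - x) (η - y) by ring]
        exact this
      have s2 : ∀ y : ℝ, ∫⁻ t : ℝ, k ((τ, ξ, η) - (t, x, y), (t, x, y)) ^ 2 ≤ ENNReal.ofReal (w ξ x * C1) *
          ENNReal.ofReal ((1 + |(τ - om α ξ η + Pf α (ξ - x) x) - (1 / ((ξ - x) * x / ξ)) * (y - η * x / ξ) ^ 2|) ^ (-g)) := by
        intro y
        refine (lintegral_mono (s1 y)).trans ?_
        rw [lintegral_const_mul _ (by fun_prop)]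
        refine (mul_le_mul_right (h1 _ _) _).trans ?_
        rw [reson_P α τ ξ η x y hx0 hx1, ENNReal.ofReal_mul hC1.le, ENNReal.ofReal_mul (hw0 _ _), mul_assoc]
        rfl
      have hξ : 0 < ξ := by linarith
      have hdξ := hd ξ hξ
      have s3 : ∀ y : ℝ, ∫⁻ t : ℝ, k ((τ, ξ, η) - (t, x, y), (t, x, y)) ^ 2 ≤
          {y : ℝ | ((ξ - x) * x / ξ) * d ξ ≤ |y - η * x / ξ|}.indicator (fun y => ENNReal.ofReal (w ξ x * C1) *
          ENNReal.ofReal ((1 + |(τ - om α ξ η + Pf α (ξ - x) x) - (1 / ((ξ - x) * x / ξ)) * (y - η * x / ξ) ^ 2|) ^ (-g))) y := by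
        intro y
        by_cases hy : y ∈ {y : ℝ | ((ξ - x) * x / ξ) * d ξ ≤ |y - η * x / ξ|}
        · rw [indicator_of_mem hy]; exact s2 y
        · rw [indicator_of_notMem hy]
          apply le_of_eq
          rw [lintegral_eq_zero_iff (by fun_prop)]
          refine Filter.Eventually.of_forall fun t => ?_
          simp only [mem_ofPred_eq, not_le] at hy
          simp only [Pi.zero_apply]
          rw [hD, zero_pow two_ne_zero]
          simp only [Df, Prod.fst_sub, Prod.snd_sub, sub_add_cancel]
          rw [reson_D ξ η x y hx0 hx1, div_lt_iff₀ k1]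
          linarith
      refine (lintegral_mono s3).trans ?_
      rw [lintegral_indicator (measurableSet_le (by fun_prop) (by fun_prop)), lintegral_const_mul _ (by fun_prop)]
      refine (mul_le_mul_right (h2 _ _ _ _ (by positivity) (by positivity)) _).trans ?_
      rw [← ENNReal.ofReal_mul (mul_nonneg (hw0 _ _) hC1.le), ← ENNReal.ofReal_mul (by positivity)]
      apply ENNReal.ofReal_le_ofReal
      apply le_of_eq
      have hx1' : 0 < ξ - x := by linarith
      field_simp
  refine hb.trans ?_
  rw [lintegral_const_mul' _ _ ENNReal.ofReal_ne_top]
  gcongr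
  rcases lt_or_ge 0 ξ with h | h
  · exact hw ξ h
  · rw [Ioc_eq_empty (by linarith)]; simp

lemma FP_B (α g : ℝ) (hg : 1 < g) (L : ℝ → ℝ → ℝ) (hL : ∀ ξ x, 0 < ξ → 0 < x → 0 < L ξ x) (k : E3 × E3 → ℝ≥0∞) (hkm : Measurable k) (w : ℝ → ℝ → ℝ) (hw0 : ∀ ξ x, 0 ≤ w ξ x)
    (hz : ∀ p1 p2, (p1, p2) ∉ R0 → k (p1, p2) = 0)
    (hD : ∀ p1 p2, ¬ (L (p1.2.1 + p2.2.1) p2.2.1 ≤ |sg α p2| ∨ L (p1.2.1 + p2.2.1) p2.2.1 ≤ |sg α p1|) → k (p1, p2) = 0)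
    (hk : ∀ p1 p2, (p1, p2) ∈ R0 → k (p1, p2) ^ 2 ≤ ENNReal.ofReal
      (w (p1.2.1 + p2.2.1) p2.2.1 * (jb (sg α p2) ^ (-g) * jb (sg α p1) ^ (-g))))
    (C0 : ℝ) (hw : ∀ ξ > 0, ∫⁻ x in Ioc 0 (ξ / 2), ENNReal.ofReal (w ξ x * L ξ x ^ (-(1 / 2 : ℝ)) * √x) ≤ ENNReal.ofReal C0) :
    Bd k := by
  obtain ⟨C1, hC1, h1⟩ := cv2_int g (1 / 2) (by norm_num) (by linarith) hg
  obtain ⟨C2, hC2, h2⟩ := I2 (g - 1 / 2) (by linarith)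
  refine Bd_P k hkm (ENNReal.ofReal (C1 * C2) * ENNReal.ofReal C0)
    (ENNReal.mul_ne_top ENNReal.ofReal_ne_top ENNReal.ofReal_ne_top) ?_
  rintro ⟨τ, ξ, η⟩
  have hb : ∫⁻ p2, k ((τ, ξ, η) - p2, p2) ^ 2 ≤
      ∫⁻ x in Ioc 0 (ξ / 2), ENNReal.ofReal (C1 * C2) * ENNReal.ofReal (w ξ x * L ξ x ^ (-(1 / 2 : ℝ)) * √x) := by
    apply slice _ (by fun_prop) _ measurableSet_Ioc
    · intro t x y hx
      rw [hz, zero_pow two_ne_zero]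
      intro hR; apply hx
      simp only [R0, mem_ofPred_eq, Prod.fst_sub, Prod.snd_sub] at hR
      exact ⟨hR.1, by linarith [hR.2]⟩
    · rintro x ⟨hx0, hx1⟩
      obtain ⟨k1, k2, k3⟩ := kappa_bd hx0 hx1
      have s1 : ∀ y t : ℝ, k ((τ, ξ, η) - (t, x, y), (t, x, y)) ^ 2 ≤ ENNReal.ofReal (w ξ x) *
          ENNReal.ofReal (jb (t - om α x y) ^ (-g) * jb ((τ - om α (ξ - x) (η - y)) - t) ^ (-g)) := by
        intro y t
        have := hk ((τ, ξ, η) - (t, x, y)) (t, x, y) (by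
          simp only [R0, mem_ofPred_eq, Prod.fst_sub, Prod.snd_sub]; exact ⟨hx0, by linarith⟩)
        simp only [sg, Prod.fst_sub, Prod.snd_sub, sub_add_cancel] at this
        rw [← ENNReal.ofReal_mul (hw0 _ _), show τ - om α (ξ - x) (η - y) - t = τ - t - om α (ξ - x) (η - y) by ring]
        exact this
      have hLx := hL ξ x (by linarith) hx0
      have s2 : ∀ y : ℝ, ∫⁻ t : ℝ, k ((τ, ξ, η) - (t, x, y), (t, x, y)) ^ 2 ≤ ENNReal.ofReal (w ξ x * C1 * L ξ x ^ (-(1 / 2 : ℝ))) *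
          ENNReal.ofReal ((1 + |(τ - om α ξ η + Pf α (ξ - x) x) - (1 / ((ξ - x) * x / ξ)) * (y - η * x / ξ) ^ 2|) ^ (-(g - 1 / 2))) := by
        intro y
        have s3 : ∀ t : ℝ, k ((τ, ξ, η) - (t, x, y), (t, x, y)) ^ 2 ≤
            {t : ℝ | L ξ x ≤ |t - om α x y| ∨ L ξ x ≤ |(τ - om α (ξ - x) (η - y)) - t|}.indicator
              (fun t => ENNReal.ofReal (w ξ x) *
          ENNReal.ofReal (jb (t - om α x y) ^ (-g) * jb ((τ - om α (ξ - x) (η - y)) - t) ^ (-g))) t := by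
          intro t
          by_cases ht : t ∈ {t : ℝ | L ξ x ≤ |t - om α x y| ∨ L ξ x ≤ |(τ - om α (ξ - x) (η - y)) - t|}
          · rw [indicator_of_mem ht]; exact s1 y t
          · rw [indicator_of_notMem ht]
            apply le_of_eq
            rw [hD, zero_pow two_ne_zero]
            simp only [sg, Prod.fst_sub, Prod.snd_sub, sub_add_cancel]
            rw [show τ - t - om α (ξ - x) (η - y) = τ - om α (ξ - x) (η - y) - t by ring]
            exact ht
        refine (lintegral_mono s3).trans ?_
        refine (lintegral_indicator_le _ _).trans ?_
        rw [lintegral_const_mul _ (by fun_prop)]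
        refine (mul_le_mul_right (h1 _ _ _ hLx) _).trans ?_
        rw [reson_P α τ ξ η x y hx0 hx1, ← ENNReal.ofReal_mul (hw0 _ _), ← ENNReal.ofReal_mul (by have := hw0 ξ x; positivity)]
        apply ENNReal.ofReal_le_ofReal
        apply le_of_eq
        unfold jb
        ring
      refine (lintegral_mono s2).trans ?_
      rw [lintegral_const_mul _ (by fun_prop)]
      refine (mul_le_mul_right (h2 _ _ _ (by positivity)) _).trans ?_
      rw [← ENNReal.ofReal_mul (by have := hw0 ξ x; positivity), ← ENNReal.ofReal_mul (by positivity)]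
      apply ENNReal.ofReal_le_ofReal
      have e : C2 / √(1 / ((ξ - x) * x / ξ)) = C2 * √((ξ - x) * x / ξ) := by
        rw [one_div, Real.sqrt_inv, div_inv_eq_mul]
      rw [e]
      calc w ξ x * C1 * L ξ x ^ (-(1 / 2 : ℝ)) * (C2 * √((ξ - x) * x / ξ)) ≤ w ξ x * C1 * L ξ x ^ (-(1 / 2 : ℝ)) * (C2 * √x) := by
            have := hw0 ξ x; gcongr
        _ = _ := by ring
  refine hb.trans ?_
  rw [lintegral_const_mul' _ _ ENNReal.ofReal_ne_top]
  gcongr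
  rcases lt_or_ge 0 ξ with h | h
  · exact hw ξ h
  · rw [Ioc_eq_empty (by linarith)]; simp

lemma reson_P1 (α τ ξ η x y : ℝ) (hx : 0 < x) (hxξ : x ≤ ξ) :
    (om α (ξ + x) (η + y) - τ) - om α x y =
      (om α ξ η - τ + Pf α ξ x) - (ξ * x / (ξ + x) / x ^ 2) * (y - η / ξ * x) ^ 2 := by
  have h1 : 0 < ξ := by linarith
  have := reson α ξ x η y h1.ne' hx.ne' (by linarith)
  have e : ξ * x / (ξ + x) * (η / ξ - y / x) ^ 2 = (ξ * x / (ξ + x) / x ^ 2) * (y - η / ξ * x) ^ 2 := by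
    field_simp; ring
  rw [e] at this
  linarith

lemma FP_1 (α : ℝ) (k : E3 × E3 → ℝ≥0∞) (hkm : Measurable k) (w : ℝ → ℝ → ℝ) (hw0 : ∀ ξ x, 0 ≤ w ξ x)
    (hz : ∀ p1 p2, (p1, p2) ∉ R0 → k (p1, p2) = 0)
    (hk : ∀ p1 p2, (p1, p2) ∈ R0 → k (p1, p2) ^ 2 ≤ ENNReal.ofReal
      (w p1.2.1 p2.2.1 * (jb (sg α p2) ^ (-0.9 : ℝ) * jb (sg α (p1 + p2)) ^ (-0.9 : ℝ))))
    (C0 : ℝ) (hw : ∀ ξ > 0, ∫⁻ x in Ioc 0 ξ, ENNReal.ofReal (w ξ x * √x) ≤ ENNReal.ofReal C0) :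
    Bd k := by
  obtain ⟨C1, hC1, h1⟩ := cv_int 0.9 0.7 (by norm_num) (by norm_num) (by norm_num)
  obtain ⟨C2, hC2, h2⟩ := I2 0.7 (by norm_num)
  refine Bd_P1 k hkm (ENNReal.ofReal (2 * C1 * C2) * ENNReal.ofReal C0)
    (ENNReal.mul_ne_top ENNReal.ofReal_ne_top ENNReal.ofReal_ne_top) ?_
  rintro ⟨τ, ξ, η⟩
  have hb : ∫⁻ p2, k ((τ, ξ, η), p2) ^ 2 ≤
      ∫⁻ x in Ioc 0 ξ, ENNReal.ofReal (2 * C1 * C2) * ENNReal.ofReal (w ξ x * √x) := by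
    apply slice _ (by fun_prop) _ measurableSet_Ioc
    · intro t x y hx
      rw [hz, zero_pow two_ne_zero]
      intro hR; apply hx
      simp only [R0, mem_ofPred_eq] at hR
      exact ⟨hR.1, hR.2⟩
    · rintro x ⟨hx0, hx1⟩
      have hξ0 : 0 < ξ := by linarith
      obtain ⟨k1, k2, k3⟩ := kappa_bd (ξ := ξ + x) hx0 (by linarith)
      have s1 : ∀ y t : ℝ, k ((τ, ξ, η), (t, x, y)) ^ 2 ≤ ENNReal.ofReal (w ξ x) *
          ENNReal.ofReal (jb (t - om α x y) ^ (-0.9 : ℝ) * jb ((om α (ξ + x) (η + y) - τ) - t) ^ (-0.9 : ℝ)) := by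
        intro y t
        have := hk ((τ, ξ, η)) (t, x, y) (by
          simp only [R0, mem_ofPred_eq]; exact ⟨hx0, by linarith⟩)
        simp only [sg, Prod.fst_add, Prod.snd_add] at this
        rw [← ENNReal.ofReal_mul (hw0 _ _), show om α (ξ + x) (η + y) - τ - t = -(τ + t - om α (ξ + x) (η + y)) by ring, jb_neg]
        exact this
      have s2 : ∀ y : ℝ, ∫⁻ t : ℝ, k ((τ, ξ, η), (t, x, y)) ^ 2 ≤ ENNReal.ofReal (w ξ x * C1) *
          ENNReal.ofReal ((1 + |(om α ξ η - τ + Pf α ξ x) - (ξ * x / (ξ + x) / x ^ 2) * (y - η / ξ * x) ^ 2|) ^ (-0.7 : ℝ)) := by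
        intro y
        refine (lintegral_mono (s1 y)).trans ?_
        rw [lintegral_const_mul _ (by fun_prop)]
        refine (mul_le_mul_right (h1 _ _) _).trans ?_
        rw [reson_P1 α τ ξ η x y hx0 hx1, ENNReal.ofReal_mul hC1.le, ENNReal.ofReal_mul (hw0 _ _), mul_assoc]
        rfl
      refine (lintegral_mono s2).trans ?_
      rw [lintegral_const_mul _ (by fun_prop)]
      refine (mul_le_mul_right (h2 _ _ _ (by positivity)) _).trans ?_
      rw [← ENNReal.ofReal_mul (mul_nonneg (hw0 _ _) hC1.le), ← ENNReal.ofReal_mul (by positivity)]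
      apply ENNReal.ofReal_le_ofReal
      have hsx := Real.sqrt_pos.2 hx0
      have e : C2 / √(ξ * x / (ξ + x) / x ^ 2) ≤ C2 * (2 * √x) := by
        rw [div_le_iff₀ (Real.sqrt_pos.2 (by positivity)), mul_assoc, mul_assoc, ← Real.sqrt_mul hx0.le]
        have : (1/2 : ℝ) ≤ √(x * (ξ * x / (ξ + x) / x ^ 2)) := by
          apply Real.le_sqrt_of_sq_le
          rw [show x * (ξ * x / (ξ + x) / x ^ 2) = ξ / (ξ + x) by field_simp, le_div_iff₀ (by positivity)]
          linarith
        nlinarith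
      calc w ξ x * C1 * (C2 / √(ξ * x / (ξ + x) / x ^ 2)) ≤ w ξ x * C1 * (C2 * (2 * √x)) := by
            have := hw0 ξ x; gcongr
        _ = _ := by ring
  refine hb.trans ?_
  rw [lintegral_const_mul' _ _ ENNReal.ofReal_ne_top]
  gcongr
  rcases lt_or_ge 0 ξ with h | h
  · exact hw ξ h
  · rw [Ioc_eq_empty (by linarith)]; simp

end KP


namespace KP

noncomputable def mat2 (a1 b1 a2 b2 : ℝ) : ℝ × ℝ →L[ℝ] ℝ × ℝ :=
  LinearMap.toContinuousLinearMap (Matrix.toLin (Module.Basis.finTwoProd ℝ) (Module.Basis.finTwoProd ℝ)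
    !![a1, b1; a2, b2])

lemma mat2_det (a1 b1 a2 b2 : ℝ) : (mat2 a1 b1 a2 b2).det = a1 * b2 - b1 * a2 := by
  unfold mat2
  simp only [LinearMap.det_toContinuousLinearMap, LinearMap.det_toLin, Matrix.det_fin_two_of]

lemma mat2_deriv {f1 f2 : ℝ × ℝ → ℝ} {x : ℝ × ℝ} {a1 b1 a2 b2 : ℝ}
    (h1 : HasFDerivAt f1 (a1 • ContinuousLinearMap.fst ℝ ℝ ℝ + b1 • ContinuousLinearMap.snd ℝ ℝ ℝ) x)
    (h2 : HasFDerivAt f2 (a2 • ContinuousLinearMap.fst ℝ ℝ ℝ + b2 • ContinuousLinearMap.snd ℝ ℝ ℝ) x) :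
    HasFDerivAt (fun x => (f1 x, f2 x)) (mat2 a1 b1 a2 b2) x := by
  unfold mat2
  rw [Matrix.toLin_finTwoProd_toContinuousLinearMap]
  exact h1.prodMk h2

lemma PL (g : ℝ) (hg : 1 < g) : ∃ C : ℝ, 0 < C ∧ ∀ (S : Set (ℝ × ℝ)) (f1 f2 a1 b1 a2 b2 : ℝ × ℝ → ℝ)
    (J : ℝ), 0 < J → MeasurableSet S →
    (∀ x ∈ S, HasFDerivAt f1 (a1 x • ContinuousLinearMap.fst ℝ ℝ ℝ + b1 x • ContinuousLinearMap.snd ℝ ℝ ℝ) x) →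
    (∀ x ∈ S, HasFDerivAt f2 (a2 x • ContinuousLinearMap.fst ℝ ℝ ℝ + b2 x • ContinuousLinearMap.snd ℝ ℝ ℝ) x) →
    InjOn (fun x => (f1 x, f2 x)) S →
    (∀ x ∈ S, J ≤ |a1 x * b2 x - b1 x * a2 x|) →
    ∀ c1 c2 : ℝ, ∫⁻ x in S, ENNReal.ofReal (jb (f1 x - c1) ^ (-g) * jb (f2 x - c2) ^ (-g)) ≤
      ENNReal.ofReal (C / J) := by
  obtain ⟨C, hC, h⟩ := jb_int g hg
  refine ⟨C * C, by positivity, ?_⟩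
  intro S f1 f2 a1 b1 a2 b2 J hJ hS h1 h2 hinj hJb c1 c2
  set F : ℝ × ℝ → ℝ≥0∞ := fun q => ENNReal.ofReal (jb (q.1 - c1) ^ (-g) * jb (q.2 - c2) ^ (-g)) with hF
  have hFm : Measurable F := by rw [hF]; fun_prop
  have key := lintegral_image_eq_lintegral_abs_det_fderiv_mul volume hS
    (f := fun x => (f1 x, f2 x)) (f' := fun x => mat2 (a1 x) (b1 x) (a2 x) (b2 x))
    (fun x hx => (mat2_deriv (h1 x hx) (h2 x hx)).hasFDerivWithinAt) hinj F
  simp only [mat2_det] at key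
  have tot : ∫⁻ q, F q ≤ ENNReal.ofReal (C * C) := by
    have e : ∀ q : ℝ × ℝ, F q = ENNReal.ofReal (jb (q.1 - c1) ^ (-g)) * ENNReal.ofReal (jb (q.2 - c2) ^ (-g)) := by
      intro q
      simp only [hF]
      rw [ENNReal.ofReal_mul (Real.rpow_nonneg (jb_pos _).le _)]
    simp only [e]
    rw [show (volume : Measure (ℝ × ℝ)) = (volume : Measure ℝ).prod (volume : Measure ℝ) from rfl,
      lintegral_prod_mul (f := fun x => ENNReal.ofReal (jb (x - c1) ^ (-g)))
       (g := fun x => ENNReal.ofReal (jb (x - c2) ^ (-g))) (by fun_prop) (by fun_prop), ENNReal.ofReal_mul hC.le]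
    gcongr
    · exact (h c1).1
    · exact (h c2).1
  have lb : ENNReal.ofReal J * ∫⁻ x in S, F (f1 x, f2 x) ≤ ENNReal.ofReal (C * C) := by
    rw [← lintegral_const_mul' _ _ ENNReal.ofReal_ne_top]
    calc _ ≤ ∫⁻ x in S, ENNReal.ofReal |a1 x * b2 x - b1 x * a2 x| * F (f1 x, f2 x) := by
          apply setLIntegral_mono' hS
          intro x hx
          gcongr; exact hJb x hx
      _ = _ := key.symm
      _ ≤ _ := (setLIntegral_le_lintegral _ _).trans tot
  rw [div_eq_inv_mul, ENNReal.ofReal_mul (by positivity), ENNReal.ofReal_inv_of_pos hJ,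
    ← ENNReal.div_eq_inv_mul, ENNReal.le_div_iff_mul_le (Or.inl (by simpa using hJ)) (Or.inl ENNReal.ofReal_ne_top), mul_comm]
  exact lb

/-- reduction of Loomis–Whitney integrals to planar ones -/
lemma LWred (α g : ℝ) (hg : 1 < g) : ∃ C : ℝ, 0 < C ∧ ∀ (f : E3 → ℝ≥0∞) (_ : Measurable f) (x1 : ℝ)
    (H : ℝ → ℝ × ℝ → ℝ≥0∞) (K w0 : ℝ), 0 < x1 → 
    (∀ t x y, x ∉ Ioc x1 (2 * x1) → f (t, x, y) = 0) → 
    (∀ t x v, x ∈ Ioc x1 (2 * x1) → v ≠ w0 → f (t + om α x (x * v), x, x * v) ≤ ENNReal.ofReal (jb t ^ (-g)) * H t (x, v)) →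
    (∀ t, ∫⁻ q, H t q ≤ ENNReal.ofReal K) →
    ∫⁻ p, f p ≤ ENNReal.ofReal (C * x1) * ENNReal.ofReal K := by
  obtain ⟨C, hC, h⟩ := jb_int g hg
  refine ⟨2 * C, by positivity, ?_⟩
  intro f hf x1 H K w0 hx1 h0 hH hK
  have hom : Measurable fun w : E3 => om α w.2.1 (w.2.1 * w.2.2) := by unfold om; fun_prop
  set F : E3 → ℝ≥0∞ := fun w => f (w.1 + om α w.2.1 (w.2.1 * w.2.2), w.2.1, w.2.1 * w.2.2) with hF
  have hFm : Measurable F := by rw [hF]; fun_prop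
  have e1 : ∫⁻ p, f p ≤ ∫⁻ x : ℝ, ∫⁻ v : ℝ, ∫⁻ t : ℝ, ENNReal.ofReal (2 * x1) * F (t, x, v) := by
    rw [iter3 f hf]
    apply lintegral_mono; intro x
    by_cases hx : x ∈ Ioc x1 (2 * x1)
    · have hx0 : 0 < x := hx1.trans hx.1
      set Gf : ℝ → ℝ≥0∞ := fun y => ∫⁻ t : ℝ, f (t, x, y) with hGf
      have hGm : Measurable Gf :=
        Measurable.lintegral_prod_left' (f := fun w : ℝ × ℝ => f (w.1, x, w.2)) (by fun_prop)
      have sc := scale_lint Gf hGm 0 x hx0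
      simp only [sub_zero] at sc
      have : ∫⁻ y, Gf y = ENNReal.ofReal x * ∫⁻ v, Gf (x * v) := by
        rw [sc, ← mul_assoc, ← ENNReal.ofReal_mul hx0.le, mul_one_div_cancel hx0.ne', ENNReal.ofReal_one, one_mul]
      simp only
      rw [show (∫⁻ (y : ℝ) (t : ℝ), f (t, x, y)) = ∫⁻ y, Gf y from rfl, this]
      have : ∀ v, ∫⁻ t : ℝ, ENNReal.ofReal (2 * x1) * F (t, x, v) = ENNReal.ofReal (2 * x1) * Gf (x * v) := by
        intro v
        rw [lintegral_const_mul' _ _ ENNReal.ofReal_ne_top]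
        congr 1
        simp only [hF, hGf]
        exact lintegral_add_right_eq_self (fun t => f (t, x, x * v)) _
      simp only [this]
      rw [lintegral_const_mul' _ _ ENNReal.ofReal_ne_top]
      gcongr; exact hx.2
    · simp [h0 _ x _ hx]
  have e2 : ∫⁻ x : ℝ, ∫⁻ v : ℝ, ∫⁻ t : ℝ, ENNReal.ofReal (2 * x1) * F (t, x, v) 
     = ∫⁻ t : ℝ, ∫⁻ q : ℝ × ℝ, ENNReal.ofReal (2 * x1) * F (t, q) := by
    rw [← iter3 (fun w => ENNReal.ofReal (2 * x1) * F w) (by fun_prop), 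
      show (volume : Measure E3) = (volume : Measure ℝ).prod (volume : Measure (ℝ × ℝ)) from rfl,
      lintegral_prod _ (by fun_prop)]
  have e3 : ∀ t : ℝ, ∫⁻ q : ℝ × ℝ, ENNReal.ofReal (2 * x1) * F (t, q) ≤ 
      ENNReal.ofReal (2 * x1) * ENNReal.ofReal K * ENNReal.ofReal (jb t ^ (-g)) := by
    intro t
    rw [lintegral_const_mul' _ _ ENNReal.ofReal_ne_top, mul_assoc]
    gcongr
    calc ∫⁻ q : ℝ × ℝ, F (t, q) ≤ ∫⁻ q : ℝ × ℝ, ENNReal.ofReal (jb t ^ (-g)) * H t q := by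
          have ae : ∀ᵐ q : ℝ × ℝ, q.2 ≠ w0 := by
            rw [ae_iff]
            have : {q : ℝ × ℝ | ¬ q.2 ≠ w0} = univ ×ˢ {w0} := by ext q; simp
            rw [this, show (volume : Measure (ℝ × ℝ)) = (volume : Measure ℝ).prod (volume : Measure ℝ) from rfl,
              Measure.prod_prod]
            simp
          refine lintegral_mono_ae ?_
          filter_upwards [ae]
          rintro ⟨x, v⟩ hv
          by_cases hx : x ∈ Ioc x1 (2 * x1)
          · exact hH t x v hx hv
          · simp [hF, h0 _ x _ hx]
      _ = ENNReal.ofReal (jb t ^ (-g)) * ∫⁻ q, H t q := lintegral_const_mul' _ _ ENNReal.ofReal_ne_top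
      _ ≤ ENNReal.ofReal (jb t ^ (-g)) * ENNReal.ofReal K := by gcongr; exact hK t
      _ = _ := mul_comm _ _
  rw [e2] at e1
  refine (e1.trans (lintegral_mono e3)).trans ?_
  rw [lintegral_const_mul _ (by fun_prop)]
  have := (h 0).1
  simp only [sub_zero] at this
  refine (mul_le_mul_right this _).trans (le_of_eq ?_)
  rw [show 2 * C * x1 = (2 * x1) * C by ring, ENNReal.ofReal_mul (p := 2 * x1) (by positivity)]
  ring

/-- phase function -/
noncomputable def Psi (α h w : ℝ) (q : ℝ × ℝ) : ℝ :=
  om α q.1 (q.1 * q.2) - om α (q.1 - h) (q.1 * q.2 - h * w) - om α h (h * w)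

lemma Psi_eq (α h w x v : ℝ) (hh : 0 < h) (hx : h < x) :
    Psi α h w (x, v) = x ^ (α + 1) - (x - h) ^ (α + 1) - h ^ (α + 1) - (h + h ^ 2 / (x - h)) * (v - w) ^ 2 := by
  have hx0 : 0 < x := hh.trans hx
  have hxh : 0 < x - h := by linarith
  unfold Psi om
  simp only
  rw [abs_of_pos hx0, abs_of_pos hxh, abs_of_pos hh, Real.rpow_add_one hx0.ne', Real.rpow_add_one hxh.ne',
    Real.rpow_add_one hh.ne']
  field_simp
  ring

lemma pow_gap {α h x : ℝ} (hα : 2 < α) (hh : 0 < h) (hx : h < x) :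
    h * x ^ (α - 1) ≤ x ^ α - (x - h) ^ α := by
  have hx0 : 0 < x := hh.trans hx
  have hxh : 0 < x - h := by linarith
  have e1 : x ^ α = x ^ (α - 1) * x := by rw [← Real.rpow_add_one hx0.ne']; congr 1; ring
  have e2 : (x - h) ^ α = (x - h) ^ (α - 1) * (x - h) := by rw [← Real.rpow_add_one hxh.ne']; congr 1; ring
  rw [e1, e2]
  have := Real.rpow_le_rpow hxh.le (by linarith : x - h ≤ x) (by linarith : 0 ≤ α - 1)
  nlinarith

noncomputable def PsiX (α h w : ℝ) (q : ℝ × ℝ) : ℝ :=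
  (α + 1) * (q.1 ^ α - (q.1 - h) ^ α) + h ^ 2 / (q.1 - h) ^ 2 * (q.2 - w) ^ 2
noncomputable def PsiV (h w : ℝ) (q : ℝ × ℝ) : ℝ := - ((h + h ^ 2 / (q.1 - h)) * (2 * (q.2 - w)))

lemma PsiX_lb {α h w x v : ℝ} (hα : 2 < α) (hh : 0 < h) (hx : h < x) :
    h * x ^ (α - 1) ≤ PsiX α h w (x, v) := by
  have h1 := pow_gap hα hh hx
  have hx0 : 0 < x := hh.trans hx
  unfold PsiX; simp only
  have : 0 ≤ h ^ 2 / (x - h) ^ 2 * (v - w) ^ 2 := by positivity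
  have : 0 ≤ h * x ^ (α - 1) := by positivity
  nlinarith

lemma Psi_deriv {α h w x v : ℝ} (hα : 2 < α) (hh : 0 < h) (hx : h < x) :
    HasFDerivAt (Psi α h w) (PsiX α h w (x, v) • ContinuousLinearMap.fst ℝ ℝ ℝ +
      PsiV h w (x, v) • ContinuousLinearMap.snd ℝ ℝ ℝ) (x, v) := by
  have hx0 : 0 < x := hh.trans hx
  have hxh : 0 < x - h := by linarith
  have d1 : HasFDerivAt (fun q : ℝ × ℝ => q.1) (ContinuousLinearMap.fst ℝ ℝ ℝ) (x, v) := hasFDerivAt_fst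
  have d2 : HasFDerivAt (fun q : ℝ × ℝ => q.2) (ContinuousLinearMap.snd ℝ ℝ ℝ) (x, v) := hasFDerivAt_snd
  have A1 := d1.rpow_const (p := α + 1) (Or.inl hx0.ne')
  have A2 := (d1.sub_const h).rpow_const (p := α + 1) (Or.inl hxh.ne')
  have A3 : HasFDerivAt (fun q : ℝ × ℝ => (h + h ^ 2 / (q.1 - h)))
      ((-(h ^ 2 / (x - h) ^ 2)) • ContinuousLinearMap.fst ℝ ℝ ℝ) (x, v) := by
    have : HasDerivAt (fun s : ℝ => h + h ^ 2 / (s - h)) (-(h ^ 2 / (x - h) ^ 2)) x := by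
      have t1 : HasDerivAt (fun s : ℝ => s - h) 1 x := (hasDerivAt_id x).sub_const h
      have t2 := ((hasDerivAt_const x (h ^ 2)).div t1 hxh.ne').const_add h
      refine HasDerivAt.congr_deriv t2 ?_
      ring
    have t3 := HasDerivAt.comp_hasFDerivAt (x, v) (h₂ := fun s : ℝ => h + h ^ 2 / (s - h))
      (f := fun q : ℝ × ℝ => q.1) this d1
    exact t3
  have A4 := A3.mul ((d2.sub_const w).pow 2)
  have A5 := ((A1.sub A2).sub_const (h ^ (α + 1))).sub A4
  have ev : Psi α h w =ᶠ[nhds (x, v)] fun q : ℝ × ℝ =>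
      q.1 ^ (α + 1) - (q.1 - h) ^ (α + 1) - h ^ (α + 1) - (h + h ^ 2 / (q.1 - h)) * (q.2 - w) ^ 2 := by
    have : ∀ᶠ q : ℝ × ℝ in nhds (x, v), h < q.1 := 
      (isOpen_lt continuous_const continuous_fst).mem_nhds hx
    filter_upwards [this] with q hq
    exact Psi_eq α h w q.1 q.2 hh hq
  refine HasFDerivAt.congr_of_eventuallyEq ?_ ev
  refine A5.congr_fderiv ?_
  ext <;> simp [PsiX, PsiV] <;> ring

lemma Psi_slope {α h w v x x' : ℝ} (hα : 2 < α) (hh : 0 < h) (hx : h < x) (hxx : x ≤ x') :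
    h * x ^ (α - 1) * (x' - x) ≤ Psi α h w (x', v) - Psi α h w (x, v) := by
  have hx0 : 0 < x := hh.trans hx
  have hd : ∀ y ∈ Ici x, HasDerivAt (fun s => Psi α h w (s, v)) (PsiX α h w (y, v)) y := by
    intro y hy
    have hy' : x ≤ y := hy
    have := (Psi_deriv (w := w) (v := v) hα hh (hx.trans_le hy')).comp_hasDerivAt y
      ((hasDerivAt_id y).prodMk (hasDerivAt_const y v))
    have e : (PsiX α h w (y, v) • ContinuousLinearMap.fst ℝ ℝ ℝ +
      PsiV h w (y, v) • ContinuousLinearMap.snd ℝ ℝ ℝ) (1, 0) = PsiX α h w (y, v) := by simp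
    exact this.congr_deriv e
  have := (convex_Ici x).mul_sub_le_image_sub_of_le_deriv (f := fun s => Psi α h w (s, v)) (C := h * x ^ (α - 1))
    (fun y hy => (hd y hy).continuousAt.continuousWithinAt)
    (fun y hy => (hd y (interior_subset hy)).differentiableAt.differentiableWithinAt)
    (fun y hy => by
      have hy' : x ≤ y := interior_subset hy
      rw [(hd y (interior_subset hy)).deriv]
      refine le_trans ?_ (PsiX_lb hα hh (hx.trans_le hy'))
      have := Real.rpow_le_rpow hx0.le hy' (by linarith : 0 ≤ α - 1)
      gcongr)
    x (by simp) x' hxx hxx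
  exact this

end KP


namespace KP

lemma Psi_inj {α h1 w1 h2 w2 : ℝ} (hα : 2 < α) (hh1 : 0 < h1) (hh2 : 0 < h2) :
    InjOn (fun q => (Psi α h1 w1 q, Psi α h2 w2 q)) {q : ℝ × ℝ | h1 < q.1 ∧ h2 < q.1 ∧ w2 < q.2 ∧ q.2 < w1} := by
  have main : ∀ x v x' v' : ℝ, h1 < x → h2 < x → w2 < v → v < w1 → w2 < v' → v' < w1 → x ≤ x' →
      Psi α h1 w1 (x, v) = Psi α h1 w1 (x', v') → Psi α h2 w2 (x, v) = Psi α h2 w2 (x', v') → x = x' ∧ v = v' := by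
    intro x v x' v' a1 a2 b1 b2 b1' b2' hxx e1 e2
    have hx0 : 0 < x := hh1.trans a1
    have s1 := Psi_slope (w := w1) (v := v) hα hh1 a1 hxx
    have s2 := Psi_slope (w := w2) (v := v) hα hh2 a2 hxx
    have p1 : 0 < h1 * x ^ (α - 1) := by positivity
    have p2 : 0 < h2 * x ^ (α - 1) := by positivity
    have q1 : Psi α h1 w1 (x', v') - Psi α h1 w1 (x', v) =
        (h1 + h1 ^ 2 / (x' - h1)) * ((v' - v) * ((w1 - v) + (w1 - v'))) := by
      rw [Psi_eq α h1 w1 x' v hh1 (by linarith), Psi_eq α h1 w1 x' v' hh1 (by linarith)]; ring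
    have q2 : Psi α h2 w2 (x', v') - Psi α h2 w2 (x', v) =
        (h2 + h2 ^ 2 / (x' - h2)) * ((v - v') * ((v - w2) + (v' - w2))) := by
      rw [Psi_eq α h2 w2 x' v hh2 (by linarith), Psi_eq α h2 w2 x' v' hh2 (by linarith)]; ring
    have r1 : 0 < (h1 + h1 ^ 2 / (x' - h1)) := by
      have : 0 < x' - h1 := by linarith
      positivity
    have r2 : 0 < (h2 + h2 ^ 2 / (x' - h2)) := by
      have : 0 < x' - h2 := by linarith
      positivity
    have t1 : 0 ≤ h1 * x ^ (α - 1) * (x' - x) := mul_nonneg p1.le (by linarith)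
    have t2 : 0 ≤ h2 * x ^ (α - 1) * (x' - x) := mul_nonneg p2.le (by linarith)
    have hv : v = v' := by
      rcases lt_trichotomy v v' with h | h | h
      · exfalso
        have : 0 < (h1 + h1 ^ 2 / (x' - h1)) * ((v' - v) * ((w1 - v) + (w1 - v'))) :=
          mul_pos r1 (mul_pos (by linarith) (by linarith))
        linarith
      · exact h
      · exfalso
        have : 0 < (h2 + h2 ^ 2 / (x' - h2)) * ((v - v') * ((v - w2) + (v' - w2))) :=
          mul_pos r2 (mul_pos (by linarith) (by linarith))
        linarith
    refine ⟨?_, hv⟩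
    subst hv
    have : h1 * x ^ (α - 1) * (x' - x) ≤ 0 := by linarith
    nlinarith
  rintro ⟨x, v⟩ ⟨a1, a2, a3, a4⟩ ⟨x', v'⟩ ⟨b1, b2, b3, b4⟩ h
  simp only [Prod.mk.injEq] at h ⊢
  simp only at a1 a2 a3 a4 b1 b2 b3 b4
  rcases le_total x x' with hx | hx
  · exact main x v x' v' a1 a2 a3 a4 b3 b4 hx h.1 h.2
  · have := main x' v' x v b1 b2 b3 b4 a3 a4 hx h.1.symm h.2.symm
    exact ⟨this.1.symm, this.2.symm⟩

lemma Bd_LW (k A B : E3 × E3 → ℝ≥0∞) (hk : Measurable k)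
    (hA : Measurable A) (hB : Measurable B) (C : ℝ≥0∞) (hCt : C ≠ ∞)
    (hkAB : ∀ z, k z ^ 2 ≤ A z * B z)
    (hC : ∀ p1 p2, ∫⁻ p, A (p1, p - p1) * B (p - p2, p2) ≤ C) : Bd k :=
  ⟨_, half_ne_top hCt, fun G F1 F2 hG h1 h2 => fixLW k A B G F1 F2 hk hA hB hG h1 h2 C hkAB hC⟩

lemma sg_Psi (α t x v t1 x1 y1 : ℝ) (hx1 : 0 < x1) :
    sg α ((t + om α x (x * v), x, x * v) - (t1, x1, y1)) =
      Psi α x1 (y1 / x1) (x, v) - (sg α (t1, x1, y1) - t) := by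
  have : x1 * (y1 / x1) = y1 := by field_simp
  simp only [sg, Psi, Prod.fst_sub, Prod.snd_sub, this]; ring

lemma sg_self (α t x v : ℝ) : sg α (t + om α x (x * v), x, x * v) = t := by
  simp only [sg]; ring

lemma D1_eq (x v x1 y1 : ℝ) (hx1 : 0 < x1) (hx : x1 < x) :
    y1 / x1 - (x * v - y1) / (x - x1) = x * (y1 / x1 - v) / (x - x1) := by
  have : 0 < x - x1 := by linarith
  field_simp; ring

lemma D2_eq (x v x2 y2 : ℝ) (hx2 : 0 < x2) (hx : x2 < x) :
    (x * v - y2) / (x - x2) - y2 / x2 = x * (v - y2 / x2) / (x - x2) := by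
  have : 0 < x - x2 := by linarith
  field_simp; ring

/-- the region for the transversal case -/
def RA (α : ℝ) : Set (E3 × E3) := R0 ∩ {z | (z.1.2.1 + z.2.2.1) ^ (α / 2) / 2 ≤ Df z}

lemma RA_meas (α : ℝ) : MeasurableSet (RA α) := by
  unfold RA
  exact R0_meas.inter (measurableSet_le (f := fun z : E3 × E3 => (z.1.2.1 + z.2.2.1) ^ (α / 2) / 2)
    (by fun_prop) (by fun_prop))

lemma LW_A (α g c : ℝ) (hα : 2 < α) (hg : 1 < g) (hc : 0 ≤ c) (k : E3 × E3 → ℝ≥0∞) (hkm : Measurable k)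
    (hz : ∀ z, z ∉ RA α → k z = 0)
    (hk : ∀ z, z ∈ RA α → k z ^ 2 ≤ ENNReal.ofReal (jb (sg α z.2) ^ (-g)) *
      ENNReal.ofReal (c * z.2.2.1 * (z.1.2.1 + z.2.2.1) ^ (3 * α / 2 - 1) * (jb (sg α (z.1 + z.2)) ^ (-g) * jb (sg α z.1) ^ (-g)))) :
    Bd k := by
  obtain ⟨C1, hC1, hred⟩ := LWred α g hg
  obtain ⟨C2, hC2, hPL⟩ := PL g hg
  set A : E3 × E3 → ℝ≥0∞ := (RA α).indicator (fun z => ENNReal.ofReal (jb (sg α z.2) ^ (-g))) with hA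
  set B : E3 × E3 → ℝ≥0∞ := (RA α).indicator (fun z => 
    ENNReal.ofReal (c * z.2.2.1 * (z.1.2.1 + z.2.2.1) ^ (3 * α / 2 - 1) * (jb (sg α (z.1 + z.2)) ^ (-g) * jb (sg α z.1) ^ (-g)))) with hB
  have hAm : Measurable A := Measurable.indicator (by fun_prop) (RA_meas α)
  have hBm : Measurable B := Measurable.indicator (by fun_prop) (RA_meas α)
  refine Bd_LW k A B hkm hAm hBm (ENNReal.ofReal (C1 * C2 * c * 2 ^ (3 * α / 2 - 1))) ENNReal.ofReal_ne_top ?_ ?_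
  · intro z
    by_cases hR : z ∈ RA α
    · simp only [hA, hB, indicator_of_mem hR]; exact hk z hR
    · simp [hz z hR]
  · rintro ⟨t1, x1, y1⟩ ⟨t2, x2, y2⟩
    by_cases hpos : 0 < x1 ∧ 0 < x2
    swap
    · have : ∀ p, A ((t1, x1, y1), p - (t1, x1, y1)) * B (p - (t2, x2, y2), (t2, x2, y2)) = 0 := by
        rintro ⟨t, x, y⟩
        by_cases h1 : 0 < x1
        · have h2 : ¬ 0 < x2 := fun h2 => hpos ⟨h1, h2⟩
          rw [hB, indicator_of_notMem, mul_zero]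
          intro hR
          exact h2 hR.1.1
        · rw [hA, indicator_of_notMem, zero_mul]
          intro hR
          have := hR.1
          simp only [R0, mem_ofPred_eq, Prod.fst_sub, Prod.snd_sub] at this
          exact h1 (this.1.trans_le this.2)
      simp [this]
    obtain ⟨hx1, hx2⟩ := hpos
    set w1 := y1 / x1 with hw1
    set w2 := y2 / x2 with hw2
    set S : Set (ℝ × ℝ) := {q | (x1 < q.1 ∧ x2 < q.1 ∧ w2 < q.2 ∧ q.2 < w1) ∧ q.1 ^ (α / 2) / 2 ≤ q.1 * (w1 - q.2) / (q.1 - x1)} with hS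
    have hSm : MeasurableSet S := by
      have m1 : MeasurableSet {q : ℝ × ℝ | x1 < q.1} := measurableSet_lt (by fun_prop) (by fun_prop)
      have m2 : MeasurableSet {q : ℝ × ℝ | x2 < q.1} := measurableSet_lt (by fun_prop) (by fun_prop)
      have m3 : MeasurableSet {q : ℝ × ℝ | w2 < q.2} := measurableSet_lt (by fun_prop) (by fun_prop)
      have m4 : MeasurableSet {q : ℝ × ℝ | q.2 < w1} := measurableSet_lt (by fun_prop) (by fun_prop)
      have m5 : MeasurableSet {q : ℝ × ℝ | q.1 ^ (α / 2) / 2 ≤ q.1 * (w1 - q.2) / (q.1 - x1)} :=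
        measurableSet_le (by fun_prop) (by fun_prop)
      exact (m1.inter (m2.inter (m3.inter m4))).inter m5
    set J : ℝ := x1 * x1 ^ (α / 2) * (x2 * x1 ^ (α - 1)) with hJ
    have hJ0 : 0 < J := by positivity
    have hpl := hPL S (Psi α x1 w1) (Psi α x2 w2) (PsiX α x1 w1) (PsiV x1 w1) (PsiX α x2 w2) (PsiV x2 w2) J hJ0 hSm
      (fun q hq => Psi_deriv hα hx1 hq.1.1) (fun q hq => Psi_deriv hα hx2 hq.1.2.1)
      ((Psi_inj hα hx1 hx2).mono fun q hq => hq.1) (by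
        rintro ⟨x, v⟩ ⟨⟨i1, i2, i3, i4⟩, i5⟩
        simp only at i1 i2 i3 i4 i5
        have hx0 : 0 < x := hx1.trans i1
        have hxx1 : 0 < x - x1 := by linarith
        have hxx2 : 0 < x - x2 := by linarith
        have a1 := PsiX_lb (w := w1) (v := v) hα hx1 i1
        have a2 := PsiX_lb (w := w2) (v := v) hα hx2 i2
        have a1' : 0 ≤ PsiX α x1 w1 (x, v) := le_trans (by positivity) a1
        have b1 : x1 * x ^ (α / 2) ≤ PsiV x1 w1 (x, v) := by
          have : PsiV x1 w1 (x, v) = 2 * x1 * (x * (w1 - v) / (x - x1)) := by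
            unfold PsiV; field_simp; ring
          rw [this]; nlinarith
        have b2 : PsiV x2 w2 (x, v) ≤ 0 := by
          unfold PsiV
          have : 0 < v - w2 := by linarith
          simp only [Left.neg_nonpos_iff]; positivity
        have l1 : x1 ^ (α / 2) ≤ x ^ (α / 2) := Real.rpow_le_rpow hx1.le i1.le (by linarith)
        have l2 : x1 ^ (α - 1) ≤ x ^ (α - 1) := Real.rpow_le_rpow hx1.le i1.le (by linarith)
        have m : J ≤ PsiV x1 w1 (x, v) * PsiX α x2 w2 (x, v) := by
          rw [hJ]
          apply mul_le_mul
          · exact le_trans (by gcongr) b1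
          · exact le_trans (by gcongr) a2
          · positivity
          · exact le_trans (by positivity) b1
        have m2 : PsiX α x1 w1 (x, v) * PsiV x2 w2 (x, v) ≤ 0 := mul_nonpos_of_nonneg_of_nonpos a1' b2
        rw [abs_of_nonpos (by linarith)]
        linarith)
    have := hred (fun p => A ((t1, x1, y1), p - (t1, x1, y1)) * B (p - (t2, x2, y2), (t2, x2, y2))) (by fun_prop) x1
      (fun t => S.indicator fun q => ENNReal.ofReal (c * x2 * (2 * x1) ^ (3 * α / 2 - 1)) *
        ENNReal.ofReal (jb (Psi α x1 w1 q - (sg α (t1, x1, y1) - t)) ^ (-g) * jb (Psi α x2 w2 q - (sg α (t2, x2, y2) - t)) ^ (-g)))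
      (c * x2 * (2 * x1) ^ (3 * α / 2 - 1) * (C2 / J)) 0 hx1 ?_ ?_ ?_
    · refine this.trans (le_of_eq ?_)
      rw [← ENNReal.ofReal_mul (by positivity)]
      congr 1
      have e : x1 ^ (3 * α / 2 - 1) = x1 ^ (α / 2) * x1 ^ (α - 1) := by
        rw [← Real.rpow_add hx1]; congr 1; ring
      rw [Real.mul_rpow (by norm_num) hx1.le, e, hJ]
      field_simp
    · intro t x y hx
      rw [hA, indicator_of_notMem, zero_mul]
      intro hR
      have := hR.1
      simp only [R0, mem_ofPred_eq, Prod.fst_sub, Prod.snd_sub] at this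
      exact hx ⟨by linarith [this.1], by linarith [this.2]⟩
    · intro t x v hx _
      by_cases hR1 : ((t1, x1, y1), (t + om α x (x * v), x, x * v) - (t1, x1, y1)) ∈ RA α
      swap
      · rw [hA, indicator_of_notMem hR1]; simp
      by_cases hR2 : ((t + om α x (x * v), x, x * v) - (t2, x2, y2), (t2, x2, y2)) ∈ RA α
      swap
      · rw [hB, indicator_of_notMem hR2]; simp
      have hx0 : 0 < x := hx1.trans hx.1
      have j1 := hR1.2
      have j2 := hR2.2
      have j3 := hR2.1
      simp only [R0, Df, mem_ofPred_eq, Prod.fst_sub, Prod.snd_sub, sub_add_cancel, add_sub_cancel] at j1 j2 j3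
      have hx2x : x2 < x := by linarith
      rw [D1_eq x v x1 y1 hx1 hx.1] at j1
      rw [D2_eq x v x2 y2 hx2 hx2x] at j2
      have hp : 0 < x ^ (α / 2) / 2 := by positivity
      have hS' : (x, v) ∈ S := by
        refine ⟨⟨hx.1, hx2x, ?_, ?_⟩, j1⟩
        · have := (div_pos_iff_of_pos_right (by linarith : 0 < x - x2)).1 (hp.trans_le j2)
          have := pos_of_mul_pos_right this hx0.le
          simp only; linarith
        · have := (div_pos_iff_of_pos_right (by linarith [hx.1] : 0 < x - x1)).1 (hp.trans_le j1)
          have := pos_of_mul_pos_right this hx0.le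
          simp only; linarith
      rw [indicator_of_mem hS', hA, hB, indicator_of_mem hR1, indicator_of_mem hR2]
      simp only [sub_add_cancel]
      rw [sg_Psi α t x v t1 x1 y1 hx1, sg_Psi α t x v t2 x2 y2 hx2, sg_self]
      simp only [Prod.fst_sub, Prod.snd_sub, sub_add_cancel]
      rw [← ENNReal.ofReal_mul (Real.rpow_nonneg (jb_pos _).le _), ← ENNReal.ofReal_mul (by positivity), ← ENNReal.ofReal_mul (Real.rpow_nonneg (jb_pos _).le _)]
      apply ENNReal.ofReal_le_ofReal
      set P1 := jb (Psi α x1 w1 (x, v) - (sg α (t1, x1, y1) - t)) ^ (-g)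
      set P2 := jb (Psi α x2 w2 (x, v) - (sg α (t2, x2, y2) - t)) ^ (-g)
      set P3 := jb t ^ (-g)
      have q1 : 0 ≤ P1 := Real.rpow_nonneg (jb_pos _).le _
      have q2 : 0 ≤ P2 := Real.rpow_nonneg (jb_pos _).le _
      have q3 : 0 ≤ P3 := Real.rpow_nonneg (jb_pos _).le _
      have l := Real.rpow_le_rpow hx0.le hx.2 (by linarith : 0 ≤ 3 * α / 2 - 1)
      calc P1 * (c * x2 * x ^ (3 * α / 2 - 1) * (P3 * P2)) ≤ P1 * (c * x2 * (2 * x1) ^ (3 * α / 2 - 1) * (P3 * P2)) := by gcongr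
        _ = _ := by ring
    · intro t
      rw [lintegral_indicator hSm, lintegral_const_mul' _ _ ENNReal.ofReal_ne_top,
        ENNReal.ofReal_mul (p := c * x2 * (2 * x1) ^ (3 * α / 2 - 1)) (by positivity)]
      gcongr
      exact hpl _ _

end KP


namespace KP

def RC (α : ℝ) : Set (E3 × E3) := R0 ∩ ({z | (z.1.2.1 + z.2.2.1) ^ (-((α - 1) / 2)) ≤ z.2.2.1} ∩
  {z | |Df z| ≤ (z.1.2.1 + z.2.2.1) ^ (α / 2) / 2})

lemma RC_meas (α : ℝ) : MeasurableSet (RC α) := by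
  unfold RC
  exact R0_meas.inter ((measurableSet_le (f := fun z : E3 × E3 => (z.1.2.1 + z.2.2.1) ^ (-((α - 1) / 2)))
    (g := fun z => z.2.2.1) (by fun_prop) (by fun_prop)).inter 
    (measurableSet_le (f := fun z : E3 × E3 => |Df z|) (by fun_prop) (by fun_prop)))

lemma C_pt {α θ x x1 d : ℝ} (hα : 2 < α) (hθ : 0 < θ) (hθ1 : θ < 1) (hx1 : 0 < x1) (h1 : x1 < x) (h2 : x ≤ 2 * x1)
    (hd : 0 < d) (hz : x ^ (-((α - 1) / 2)) ≤ x - x1) (hdz : d ≤ (x - x1) * x ^ (α / 2 - 1) / 2) :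
    1 / ((x - x1) * x ^ α) ≤ 2 ^ α * (2 * x1) ^ (θ * (α - 1) / 2 + (1 - α / 2) * (θ - 1) - α) * d ^ (θ - 1) ∧
    d ≤ (2 * x1) ^ (α / 2) := by
  have hx0 : 0 < x := hx1.trans h1
  have hz0 : 0 < x - x1 := by linarith
  set X := 2 * x1 with hX
  have hX0 : 0 < X := by positivity
  set z := x - x1 with hzd
  have a1 : z ^ (-θ) ≤ X ^ (θ * (α - 1) / 2) := by
    have := rpow_neg_anti (g := θ) (by positivity) hz hθ.le
    rw [← Real.rpow_mul hx0.le] at this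
    refine this.trans ?_
    rw [show -((α - 1) / 2) * -θ = θ * (α - 1) / 2 by ring]
    apply Real.rpow_le_rpow hx0.le h2
    have : 0 < θ * (α - 1) := mul_pos hθ (by linarith)
    linarith
  have a2 : z ^ (-(1 - θ)) ≤ d ^ (θ - 1) * X ^ ((1 - α / 2) * (θ - 1)) := by
    have l : d * X ^ (1 - α / 2) ≤ z := by
      have l1 : X ^ (1 - α / 2) ≤ x ^ (1 - α / 2) := Real.rpow_le_rpow_of_nonpos hx0 h2 (by linarith)
      have l2 : x ^ (α / 2 - 1) * x ^ (1 - α / 2) = 1 := by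
        rw [← Real.rpow_add hx0]; simp
      have l3 : 0 < x ^ (1 - α / 2) := by positivity
      calc d * X ^ (1 - α / 2) ≤ (z * x ^ (α / 2 - 1) / 2) * x ^ (1 - α / 2) := by gcongr
        _ = z / 2 * (x ^ (α / 2 - 1) * x ^ (1 - α / 2)) := by ring
        _ ≤ z := by rw [l2]; linarith
    have := rpow_neg_anti (g := 1 - θ) (by positivity) l (by linarith)
    rw [Real.mul_rpow hd.le (by positivity), ← Real.rpow_mul hX0.le] at this
    rw [show θ - 1 = -(1 - θ) by ring]
    exact this
  have a3 : 1 / x ^ α ≤ 2 ^ α * X ^ (-α) := by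
    have : x1 ^ α ≤ x ^ α := Real.rpow_le_rpow hx1.le h1.le (by linarith)
    have e : 2 ^ α * X ^ (-α) = 1 / x1 ^ α := by
      rw [hX, Real.mul_rpow (by norm_num) hx1.le, Real.rpow_neg (by norm_num), Real.rpow_neg hx1.le]
      field_simp
    rw [e]
    have : 0 < x1 ^ α := by positivity
    gcongr
  have e : 1 / (z * x ^ α) = z ^ (-θ) * z ^ (-(1 - θ)) * (1 / x ^ α) := by
    rw [← Real.rpow_add hz0, show -θ + -(1 - θ) = -1 by ring, Real.rpow_neg_one]
    field_simp
  have e2 : X ^ (θ * (α - 1) / 2 + (1 - α / 2) * (θ - 1) - α) = X ^ (θ * (α - 1) / 2) * X ^ ((1 - α / 2) * (θ - 1)) * X ^ (-α) := by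
    rw [← Real.rpow_add hX0, ← Real.rpow_add hX0]; congr 1
  constructor
  · rw [e, e2]
    calc z ^ (-θ) * z ^ (-(1 - θ)) * (1 / x ^ α) ≤ X ^ (θ * (α - 1) / 2) * (d ^ (θ - 1) * X ^ ((1 - α / 2) * (θ - 1))) * (2 ^ α * X ^ (-α)) := by gcongr
      _ = _ := by ring
  · have l1 : x ^ (α / 2 - 1) ≤ X ^ (α / 2 - 1) := Real.rpow_le_rpow hx0.le h2 (by linarith)
    have l2 : X ^ (α / 2) = X * X ^ (α / 2 - 1) := by
      rw [mul_comm, ← Real.rpow_add_one hX0.ne']; congr 1; ring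
    rw [l2]
    have : z ≤ X := by linarith
    calc d ≤ z * x ^ (α / 2 - 1) / 2 := hdz
      _ ≤ z * x ^ (α / 2 - 1) := by
        have : 0 ≤ z * x ^ (α / 2 - 1) := by positivity
        linarith
      _ ≤ _ := by gcongr

lemma LW_C (α g c μ : ℝ) (hα : 2 < α) (hg : 1 < g) (hc : 0 ≤ c) (hμ : 0 < μ) (hμ1 : μ < 1) (k : E3 × E3 → ℝ≥0∞) (hkm : Measurable k)
    (hz : ∀ z, z ∉ RC α → k z = 0)
    (hk : ∀ z, z ∈ RC α → k z ^ 2 ≤ ENNReal.ofReal (1 / (z.2.2.1 * (z.1.2.1 + z.2.2.1) ^ α)) *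
      ENNReal.ofReal (c * z.2.2.1 * (z.1.2.1 + z.2.2.1) ^ (3 * α / 2 - 1 - μ) * (jb (sg α (z.1 + z.2)) ^ (-g) * jb (sg α z.1) ^ (-g)))) :
    Bd k := by
  obtain ⟨C1, hC1, hred⟩ := LWred α g hg
  obtain ⟨C2, hC2, hI4⟩ := I4 g hg
  set θ := 2 * μ / (α + 1) with hθd
  have hθ : 0 < θ := by have : 0 < α + 1 := by linarith
                        positivity
  have hθ1 : θ < 1 := by rw [hθd, div_lt_one (by linarith)]; linarith
  have hθμ : θ * (α + 1) / 2 = μ := by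
    have : α + 1 ≠ 0 := by linarith
    rw [hθd]; field_simp
  set A : E3 × E3 → ℝ≥0∞ := (RC α).indicator (fun z => ENNReal.ofReal (1 / (z.2.2.1 * (z.1.2.1 + z.2.2.1) ^ α))) with hA
  set B : E3 × E3 → ℝ≥0∞ := (RC α).indicator (fun z => 
    ENNReal.ofReal (c * z.2.2.1 * (z.1.2.1 + z.2.2.1) ^ (3 * α / 2 - 1 - μ) * (jb (sg α (z.1 + z.2)) ^ (-g) * jb (sg α z.1) ^ (-g)))) with hB
  have hAm : Measurable A := Measurable.indicator (by fun_prop) (RC_meas α)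
  have hBm : Measurable B := Measurable.indicator (by fun_prop) (RC_meas α)
  refine Bd_LW k A B hkm hAm hBm (ENNReal.ofReal (C1 * C2 * c * 2 ^ α * 2 ^ (α - 1) * (1 / θ))) ENNReal.ofReal_ne_top ?_ ?_
  · intro z
    by_cases hR : z ∈ RC α
    · simp only [hA, hB, indicator_of_mem hR]; exact hk z hR
    · simp [hz z hR]
  · rintro ⟨t1, x1, y1⟩ ⟨t2, x2, y2⟩
    by_cases hpos : 0 < x1 ∧ 0 < x2
    swap
    · have : ∀ p, A ((t1, x1, y1), p - (t1, x1, y1)) * B (p - (t2, x2, y2), (t2, x2, y2)) = 0 := by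
        rintro ⟨t, x, y⟩
        by_cases h1 : 0 < x1
        · have h2 : ¬ 0 < x2 := fun h2 => hpos ⟨h1, h2⟩
          rw [hB, indicator_of_notMem, mul_zero]
          intro hR
          exact h2 hR.1.1
        · rw [hA, indicator_of_notMem, zero_mul]
          intro hR
          have := hR.1
          simp only [R0, mem_ofPred_eq, Prod.fst_sub, Prod.snd_sub] at this
          exact h1 (this.1.trans_le this.2)
      simp [this]
    obtain ⟨hx1, hx2⟩ := hpos
    set w1 := y1 / x1 with hw1
    set w2 := y2 / x2 with hw2
    set X := 2 * x1 with hX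
    have hX0 : 0 < X := by positivity
    set E1 := θ * (α - 1) / 2 + (1 - α / 2) * (θ - 1) - α with hE1
    set V : Set ℝ := {v | |v - w1| ≤ X ^ (α / 2)} with hV
    have hVm : MeasurableSet V := measurableSet_le (by fun_prop) (by fun_prop)
    set T : Set ℝ := {x | x1 < x ∧ x2 < x} with hT
    have hTm : MeasurableSet T := by
      have m1 : MeasurableSet {q : ℝ | x1 < q} := measurableSet_lt (by fun_prop) (by fun_prop)
      have m2 : MeasurableSet {q : ℝ | x2 < q} := measurableSet_lt (by fun_prop) (by fun_prop)
      exact m1.inter m2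
    set c0 := 2 ^ α * X ^ E1 * (c * x2 * X ^ (3 * α / 2 - 1 - μ)) with hc0
    have hc00 : 0 ≤ c0 := by positivity
    set l := x2 * x1 ^ (α - 1) with hl
    have hl0 : 0 < l := by positivity
    have hPm : Measurable (Psi α x2 w2) := by unfold Psi om; fun_prop
    set Hf : ℝ → ℝ × ℝ → ℝ≥0∞ := (fun t q => (V.indicator (fun v => ENNReal.ofReal (c0 * |v - w1| ^ (θ - 1))) q.2) * 
        T.indicator (fun x => ENNReal.ofReal (jb (Psi α x2 w2 (x, q.2) - (sg α (t2, x2, y2) - t)) ^ (-g))) q.1) with hHf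
    have hVim : Measurable (V.indicator (fun v => ENNReal.ofReal (c0 * |v - w1| ^ (θ - 1)))) :=
      Measurable.indicator (by fun_prop) hVm
    have hHm : ∀ t, Measurable (Hf t) := by
      intro t
      have : Hf t = fun q => (V.indicator (fun v => ENNReal.ofReal (c0 * |v - w1| ^ (θ - 1))) q.2) *
        (Prod.fst ⁻¹' T).indicator (fun q => ENNReal.ofReal (jb (Psi α x2 w2 q - (sg α (t2, x2, y2) - t)) ^ (-g))) q := by
        funext q
        simp only [hHf, indicator, mem_preimage]
      rw [this]
      have m3 : Measurable ((Prod.fst ⁻¹' T).indicator (fun q : ℝ × ℝ => ENNReal.ofReal (jb (Psi α x2 w2 q - (sg α (t2, x2, y2) - t)) ^ (-g)))) :=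
        Measurable.indicator (by fun_prop) (measurable_fst hTm)
      fun_prop
    have := hred (fun p => A ((t1, x1, y1), p - (t1, x1, y1)) * B (p - (t2, x2, y2), (t2, x2, y2))) (by fun_prop) x1
      Hf (c0 * (C2 / l) * (2 * (X ^ (α / 2)) ^ θ / θ)) w1 hx1 ?_ ?_ ?_
    · refine this.trans (le_of_eq ?_)
      rw [← ENNReal.ofReal_mul (by positivity)]
      congr 1
      have e : X ^ E1 * X ^ (3 * α / 2 - 1 - μ) * (X ^ (α / 2)) ^ θ * X = X ^ (α - 1) := by
        rw [← Real.rpow_mul hX0.le, ← Real.rpow_add hX0, ← Real.rpow_add hX0, ← Real.rpow_add_one hX0.ne']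
        congr 1
        rw [hE1, ← hθμ]; ring
      have e2 : x1 ^ (α - 1) * 2 ^ (α - 1) = X ^ (α - 1) := by
        rw [hX, Real.mul_rpow (by norm_num) hx1.le]; ring
      calc C1 * x1 * (c0 * (C2 / l) * (2 * (X ^ (α / 2)) ^ θ / θ)) 
          = C1 * C2 * c * 2 ^ α * (X ^ E1 * X ^ (3 * α / 2 - 1 - μ) * (X ^ (α / 2)) ^ θ * X) * (x2 / l) * (1 / θ) := by
            rw [hc0, hX]; ring
        _ = _ := by
            rw [e, ← e2, hl]; field_simp
    · intro t x y hx
      rw [hA, indicator_of_notMem, zero_mul]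
      intro hR
      have := hR.1
      simp only [R0, mem_ofPred_eq, Prod.fst_sub, Prod.snd_sub] at this
      exact hx ⟨by linarith [this.1], by linarith [this.2]⟩
    · intro t x v hx hv
      by_cases hR1 : ((t1, x1, y1), (t + om α x (x * v), x, x * v) - (t1, x1, y1)) ∈ RC α
      swap
      · rw [hA, indicator_of_notMem hR1]; simp
      by_cases hR2 : ((t + om α x (x * v), x, x * v) - (t2, x2, y2), (t2, x2, y2)) ∈ RC α
      swap
      · rw [hB, indicator_of_notMem hR2]; simp
      have hx0 : 0 < x := hx1.trans hx.1
      have j1 := hR1.2.2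
      have j2 := hR1.2.1
      have j3 := hR2.1
      simp only [R0, Df, mem_ofPred_eq, Prod.fst_sub, Prod.snd_sub, sub_add_cancel, add_sub_cancel] at j1 j2 j3
      have hx2x : x2 < x := by linarith
      have hz0 : 0 < x - x1 := by linarith [hx.1]
      rw [D1_eq x v x1 y1 hx1 hx.1, abs_div, abs_mul, abs_of_pos hx0, abs_of_pos hz0, abs_sub_comm, div_le_iff₀ hz0] at j1
      have hd : 0 < |v - w1| := abs_pos.2 (sub_ne_zero.2 hv)
      have hdz : |v - w1| ≤ (x - x1) * x ^ (α / 2 - 1) / 2 := by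
        have e : x ^ (α / 2) = x ^ (α / 2 - 1) * x := by
          rw [← Real.rpow_add_one hx0.ne']; congr 1; ring
        rw [e] at j1
        nlinarith
      obtain ⟨u1, u2⟩ := C_pt hα hθ hθ1 hx1 hx.1 hx.2 hd j2 hdz
      rw [hHf, hA, hB, indicator_of_mem hR1, indicator_of_mem hR2]
      simp only [sub_add_cancel]
      rw [sg_Psi α t x v t2 x2 y2 hx2, sg_self, indicator_of_mem (show v ∈ V from u2),
        indicator_of_mem (show x ∈ T from ⟨hx.1, hx2x⟩)]
      simp only [Prod.fst_sub, Prod.snd_sub, sub_add_cancel, add_sub_cancel]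
      rw [← ENNReal.ofReal_mul (by positivity), ← ENNReal.ofReal_mul (by positivity), ← ENNReal.ofReal_mul (Real.rpow_nonneg (jb_pos _).le _)]
      apply ENNReal.ofReal_le_ofReal
      set P2 := jb (Psi α x2 w2 (x, v) - (sg α (t2, x2, y2) - t)) ^ (-g)
      set P3 := jb t ^ (-g)
      have q2 : 0 ≤ P2 := Real.rpow_nonneg (jb_pos _).le _
      have q3 : 0 ≤ P3 := Real.rpow_nonneg (jb_pos _).le _
      have lx := Real.rpow_le_rpow hx0.le hx.2 (by linarith : 0 ≤ 3 * α / 2 - 1 - μ)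
      calc 1 / ((x - x1) * x ^ α) * (c * x2 * x ^ (3 * α / 2 - 1 - μ) * (P3 * P2)) 
          ≤ (2 ^ α * X ^ E1 * |v - w1| ^ (θ - 1)) * (c * x2 * X ^ (3 * α / 2 - 1 - μ) * (P3 * P2)) := by gcongr
        _ = _ := by rw [hc0]; ring
    · intro t
      rw [show (volume : Measure (ℝ × ℝ)) = (volume : Measure ℝ).prod (volume : Measure ℝ) from rfl,
        lintegral_prod_symm' _ (hHm t)]
      have b1 : ∀ v, ∫⁻ x, Hf t (x, v) ≤ ENNReal.ofReal (C2 / l) * V.indicator (fun v => ENNReal.ofReal (c0 * |v - w1| ^ (θ - 1))) v := by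
        intro v
        simp only [hHf]
        have hne : V.indicator (fun v => ENNReal.ofReal (c0 * |v - w1| ^ (θ - 1))) v ≠ ∞ := by
          unfold indicator; split_ifs <;> simp
        rw [lintegral_const_mul' _ _ hne, mul_comm, lintegral_indicator hTm]
        gcongr
        refine hI4 T (fun x => Psi α x2 w2 (x, v)) l hl0 ?_ _
        have mm : ∀ x ∈ T, ∀ x' ∈ T, x ≤ x' → l * |x - x'| ≤ |Psi α x2 w2 (x, v) - Psi α x2 w2 (x', v)| := by
          intro x hx x' hx' hxx
          have := Psi_slope (w := w2) (v := v) hα hx2 hx.2 hxx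
          rw [abs_sub_comm x x', abs_of_nonneg (by linarith : 0 ≤ x' - x), abs_sub_comm]
          refine le_trans ?_ (le_abs_self _)
          refine le_trans ?_ this
          have := Real.rpow_le_rpow hx1.le hx.1.le (by linarith : 0 ≤ α - 1)
          have : 0 ≤ x' - x := by linarith
          rw [hl]; gcongr
        intro x hx x' hx'
        rcases le_total x x' with h | h
        · exact mm x hx x' hx' h
        · rw [abs_sub_comm x x', abs_sub_comm (Psi _ _ _ _)]; exact mm x' hx' x hx h
      refine (lintegral_mono b1).trans ?_
      rw [lintegral_const_mul' _ _ ENNReal.ofReal_ne_top, lintegral_indicator hVm]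
      have := I6' θ (X ^ (α / 2)) w1 hθ (by positivity)
      simp only [ENNReal.ofReal_mul hc00]
      rw [lintegral_const_mul' _ _ ENNReal.ofReal_ne_top]
      have e9 : ENNReal.ofReal (c0 * (C2 / l) * (2 * (X ^ (α / 2)) ^ θ / θ)) = ENNReal.ofReal (C2 / l) * (ENNReal.ofReal c0 * ENNReal.ofReal (2 * (X ^ (α / 2)) ^ θ / θ)) := by
        rw [← ENNReal.ofReal_mul hc00, ← ENNReal.ofReal_mul (by positivity)]
        congr 1; ring
      refine le_trans ?_ e9.ge
      gcongr

end KP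

namespace KP
open MeasureTheory Set
open scoped ENNReal

/-! ### multiplier bounds -/

noncomputable def Mm (r c b : ℝ) : ℝ := c * (1 + b) ^ r + b * (1 + b) ^ (-r) * (1 + c) ^ (2 * r)

lemma Mm_nonneg {r c b : ℝ} (hb : 0 ≤ b) (hc : 0 ≤ c) : 0 ≤ Mm r c b := by
  unfold Mm; positivity

lemma Mm_a {r c b : ℝ} (hr : 0 ≤ r) (hr1 : r ≤ 1) (hb : 0 ≤ b) (hbc : b ≤ c) (hc : c ≤ 1) : Mm r c b ≤ 6 := by
  unfold Mm
  have h1 : (1 + b) ^ r ≤ 2 := by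
    calc (1 + b) ^ r ≤ (1 + b) ^ (1 : ℝ) := Real.rpow_le_rpow_of_exponent_le (by linarith) hr1
      _ ≤ 2 := by rw [Real.rpow_one]; linarith
  have h2 : (1 + b) ^ (-r) ≤ 1 := Real.rpow_le_one_of_one_le_of_nonpos (by linarith) (by linarith)
  have h3 : (1 + c) ^ (2 * r) ≤ 4 := by
    calc (1 + c) ^ (2 * r) ≤ (1 + c) ^ (2 : ℝ) := Real.rpow_le_rpow_of_exponent_le (by linarith) (by linarith)
      _ ≤ 4 := by rw [Real.rpow_two]; nlinarith
  calc c * (1 + b) ^ r + b * (1 + b) ^ (-r) * (1 + c) ^ (2 * r) ≤ 1 * 2 + 1 * 1 * 4 := by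
        have hc0 : 0 ≤ c := hb.trans hbc
        have : 0 ≤ (1 + c) ^ (2 * r) := by positivity
        gcongr <;> linarith
    _ = 6 := by norm_num

lemma two_pow_le {c e n : ℝ} (hc : 0 ≤ c) (hen : e ≤ n) : (2 * c) ^ e ≤ 2 ^ n * c ^ e := by
  rw [Real.mul_rpow (by norm_num) hc]
  gcongr
  norm_num

lemma Mm_b {r c b : ℝ} (hr : 0 ≤ r) (hr1 : r ≤ 1) (hb : 0 ≤ b) (hbc : b ≤ c) (hc : 1 ≤ c) :
    Mm r c b ≤ 6 * c ^ (1 + r) := by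
  unfold Mm
  have h1 : (1 + b) ^ r ≤ 2 * c ^ r := by
    calc (1 + b) ^ r ≤ (2 * c) ^ r := by gcongr; linarith
      _ ≤ 2 ^ (1 : ℝ) * c ^ r := two_pow_le (by linarith) hr1
      _ = _ := by rw [Real.rpow_one]
  have h2 : b * (1 + b) ^ (-r) * (1 + c) ^ (2 * r) ≤ 4 * c ^ (1 + r) := by
    calc b * (1 + b) ^ (-r) * (1 + c) ^ (2 * r) ≤ (1 + b) ^ (1 : ℝ) * (1 + b) ^ (-r) * (1 + c) ^ (2 * r) := by
          gcongr; rw [Real.rpow_one]; linarith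
      _ = (1 + b) ^ (1 - r) * (1 + c) ^ (2 * r) := by rw [← Real.rpow_add (by linarith)]; rfl
      _ ≤ (2 * c) ^ (1 - r) * (2 * c) ^ (2 * r) := by
          gcongr <;> linarith
      _ = (2 * c) ^ (1 + r) := by rw [← Real.rpow_add (by linarith)]; congr 1; ring
      _ ≤ 2 ^ (2 : ℝ) * c ^ (1 + r) := two_pow_le (by linarith) (by linarith)
      _ = _ := by norm_num
  have h3 : c * c ^ r = c ^ (1 + r) := by rw [Real.rpow_add (by linarith), Real.rpow_one]
  nlinarith

lemma Mm_c {r c b : ℝ} (hr : 0 ≤ r) (hr1 : r ≤ 1) (hb : 0 ≤ b) (hbc : b ≤ c) (hc : 1 ≤ c) :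
    Mm r c b ^ 2 ≤ 40 * (c ^ (2 : ℝ) + b * c ^ (2 + 2 * r)) := by
  unfold Mm
  have hc0 : 0 < c := by linarith
  have e2 : ∀ x : ℝ, 0 ≤ x → (x ^ r) ^ 2 = x ^ (2 * r) := fun x hx => by
    rw [mul_comm, Real.rpow_mul hx, Real.rpow_two]
  have e3 : ∀ x : ℝ, 0 ≤ x → (x ^ (-r)) ^ 2 = x ^ (-(2 * r)) := fun x hx => by
    rw [show -(2 * r) = (-r) * 2 by ring, Real.rpow_mul hx, Real.rpow_two]
  have e4 : ∀ x : ℝ, 0 ≤ x → (x ^ (2 * r)) ^ 2 = x ^ (4 * r) := fun x hx => by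
    rw [show 4 * r = (2 * r) * 2 by ring, Real.rpow_mul hx (2 * r) 2, Real.rpow_two]
  have h1 : (c * (1 + b) ^ r) ^ 2 ≤ 4 * c ^ (2 : ℝ) + 4 * (b * c ^ (2 + 2 * r)) := by
    rw [mul_pow, e2 _ (by linarith), Real.rpow_add hc0, Real.rpow_two]
    have : (1 + b) ^ (2 * r) ≤ 4 + 4 * (b * c ^ (2 * r)) := by
      rcases le_total b 1 with h | h
      · have : (1 + b) ^ (2 * r) ≤ 4 := by
          calc (1 + b) ^ (2 * r) ≤ (1 + b) ^ (2 : ℝ) := Real.rpow_le_rpow_of_exponent_le (by linarith) (by linarith)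
            _ ≤ 4 := by rw [Real.rpow_two]; nlinarith
        have : 0 ≤ b * c ^ (2 * r) := by positivity
        linarith
      · have : (1 + b) ^ (2 * r) ≤ 4 * c ^ (2 * r) := by
          calc (1 + b) ^ (2 * r) ≤ (2 * c) ^ (2 * r) := by gcongr; linarith
            _ ≤ 2 ^ (2 : ℝ) * c ^ (2 * r) := two_pow_le (by linarith) (by linarith)
            _ = _ := by norm_num
        have : 1 * c ^ (2 * r) ≤ b * c ^ (2 * r) := by gcongr
        linarith
    nlinarith [sq_nonneg c]
  have h2 : (b * (1 + b) ^ (-r) * (1 + c) ^ (2 * r)) ^ 2 ≤ 16 * (b * c ^ (2 + 2 * r)) := by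
    rw [mul_pow, mul_pow, e3 _ (by linarith), e4 _ (by linarith)]
    have a1 : b * (1 + b) ^ (-(2 * r)) ≤ (2 * c) ^ (1 - r) := by
      calc b * (1 + b) ^ (-(2 * r)) ≤ (1 + b) ^ (1 : ℝ) * (1 + b) ^ (-(2 * r)) := by
            gcongr; rw [Real.rpow_one]; linarith
        _ = (1 + b) ^ (1 - 2 * r) := by rw [← Real.rpow_add (by linarith)]; rfl
        _ ≤ (1 + b) ^ (1 - r) := Real.rpow_le_rpow_of_exponent_le (by linarith) (by linarith)
        _ ≤ _ := by gcongr <;> linarith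
    have a2 : (1 + c) ^ (4 * r) ≤ (2 * c) ^ (4 * r) := by gcongr; linarith
    have a3 : (2 * c) ^ (1 - r) * (2 * c) ^ (4 * r) ≤ 16 * c ^ (2 + 2 * r) := by
      rw [← Real.rpow_add (by linarith)]
      calc (2 * c) ^ (1 - r + 4 * r) ≤ (2 * c) ^ (2 + 2 * r) := Real.rpow_le_rpow_of_exponent_le (by linarith) (by linarith)
        _ ≤ 2 ^ (4 : ℝ) * c ^ (2 + 2 * r) := two_pow_le (by linarith) (by linarith)
        _ = _ := by norm_num
    calc b ^ 2 * (1 + b) ^ (-(2 * r)) * (1 + c) ^ (4 * r) = b * ((b * (1 + b) ^ (-(2 * r))) * (1 + c) ^ (4 * r)) := by ring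
      _ ≤ b * ((2 * c) ^ (1 - r) * (2 * c) ^ (4 * r)) := by gcongr
      _ ≤ b * (16 * c ^ (2 + 2 * r)) := by gcongr
      _ = _ := by ring
  have p1 : 0 ≤ c ^ (2 : ℝ) := by positivity
  have p2 : 0 ≤ b * c ^ (2 + 2 * r) := by positivity
  have hab : ∀ A B : ℝ, (A + B) ^ 2 ≤ 2 * A ^ 2 + 2 * B ^ 2 := fun A B => by nlinarith [sq_nonneg (A - B)]
  have := hab (c * (1 + b) ^ r) (b * (1 + b) ^ (-r) * (1 + c) ^ (2 * r))
  linarith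

/-- low interaction -/
lemma Mm_low {α r c b : ℝ} (hr : 0 ≤ r) (hr1 : r ≤ 1) (hα : α < 4) (hrα : 2 * r ≤ α - 5 / 2) (hb : 0 ≤ b) (hbc : b ≤ c) (hc : 1 ≤ c)
    (hbL : b ≤ c ^ (-((α - 1) / 2))) : Mm r c b ^ 2 ≤ 80 * c ^ (2 : ℝ) := by
  have := Mm_c hr hr1 hb hbc hc
  have h : b * c ^ (2 + 2 * r) ≤ c ^ (2 : ℝ) := by
    calc b * c ^ (2 + 2 * r) ≤ c ^ (-((α - 1) / 2)) * c ^ (2 + 2 * r) := by gcongr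
      _ = c ^ (-((α - 1) / 2) + (2 + 2 * r)) := by rw [← Real.rpow_add (by linarith)]
      _ ≤ _ := Real.rpow_le_rpow_of_exponent_le hc (by linarith)
  linarith

lemma Mm_high {α r μ c b : ℝ} (hr : 0 ≤ r) (hr1 : r ≤ 1) (hα : 5 / 2 < α) (hrα : 2 * μ + 2 * r ≤ α - 5 / 2) (hμ : 0 ≤ μ) (hb : 0 ≤ b) (hbc : b ≤ c) (hc : 1 ≤ c)
    (hbL : c ^ (-((α - 1) / 2)) ≤ b) : Mm r c b ^ 2 * c ^ μ ≤ 80 * b * c ^ (3 * α / 2 - 1 - μ) := by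
  have := Mm_c hr hr1 hb hbc hc
  have hc0 : 0 < c := by linarith
  have h : c ^ (2 : ℝ) * c ^ μ ≤ b * c ^ (3 * α / 2 - 1 - μ) := by
    calc c ^ (2 : ℝ) * c ^ μ = c ^ (2 + μ) := by rw [Real.rpow_add hc0]
      _ ≤ c ^ (-((α - 1) / 2) + (3 * α / 2 - 1 - μ)) := Real.rpow_le_rpow_of_exponent_le hc (by linarith)
      _ = c ^ (-((α - 1) / 2)) * c ^ (3 * α / 2 - 1 - μ) := by rw [Real.rpow_add hc0]
      _ ≤ _ := by gcongr
  have h' : b * c ^ (2 + 2 * r) * c ^ μ ≤ b * c ^ (3 * α / 2 - 1 - μ) := by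
    rw [mul_assoc, ← Real.rpow_add hc0]
    have := Real.rpow_le_rpow_of_exponent_le hc (by linarith : 2 + 2 * r + μ ≤ 3 * α / 2 - 1 - μ)
    gcongr
  have : Mm r c b ^ 2 * c ^ μ ≤ 40 * (c ^ (2 : ℝ) + b * c ^ (2 + 2 * r)) * c ^ μ := by gcongr
  nlinarith

/-! ### resonance lower bound -/

lemma Pf_lb {α c b : ℝ} (hα : 2 < α) (hb : 0 < b) (hbc : b ≤ c / 2) : b * c ^ α / 2 ≤ Pf α (c - b) b := by
  have hc : 0 < c := by linarith
  have h1 := pow_gap (α := α + 1) (by linarith) hb (by linarith : b < c)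
  unfold Pf
  rw [sub_add_cancel, abs_of_pos hc, abs_of_pos hb, abs_of_pos (by linarith : 0 < c - b),
    ← Real.rpow_add_one hc.ne', ← Real.rpow_add_one (by linarith : c - b ≠ 0)]
  rw [add_sub_cancel_right] at h1
  have : b ^ α ≤ c ^ α / 2 := by
    calc b ^ α ≤ (c / 2) ^ α := by gcongr
      _ = c ^ α / 2 ^ α := Real.div_rpow hc.le (by norm_num) _
      _ ≤ c ^ α / 2 := by
        gcongr
        calc (2 : ℝ) = 2 ^ (1 : ℝ) := by norm_num
          _ ≤ 2 ^ α := Real.rpow_le_rpow_of_exponent_le (by norm_num) (by linarith)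
  nlinarith

lemma max_sg {α : ℝ} (hα : 2 < α) (z : E3 × E3) (hz : z ∈ R0) (hD : |Df z| ≤ (z.1.2.1 + z.2.2.1) ^ (α / 2) / 2) :
    z.2.2.1 * (z.1.2.1 + z.2.2.1) ^ α / 12 ≤ |sg α (z.1 + z.2)| ∨ z.2.2.1 * (z.1.2.1 + z.2.2.1) ^ α / 12 ≤ |sg α z.1| ∨
      z.2.2.1 * (z.1.2.1 + z.2.2.1) ^ α / 12 ≤ |sg α z.2| := by
  obtain ⟨⟨t1, x1, y1⟩, ⟨t2, x2, y2⟩⟩ := z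
  simp only [R0, Df, mem_ofPred_eq, sg, Prod.mk_add_mk] at *
  obtain ⟨h2, h1⟩ := hz
  have hx : 0 < x1 + x2 := by linarith
  have hP := Pf_lb (c := x1 + x2) hα h2 (by linarith)
  rw [add_sub_cancel_right] at hP
  have hr := reson α x1 x2 y1 y2 (by linarith) h2.ne' hx.ne'
  have hk : x1 * x2 / (x1 + x2) ≤ x2 := by
    rw [div_le_iff₀ hx]; nlinarith
  have hk0 : 0 ≤ x1 * x2 / (x1 + x2) := by
    have : 0 < x1 := by linarith
    positivity
  have hD2 : (y1 / x1 - y2 / x2) ^ 2 ≤ (x1 + x2) ^ α / 4 := by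
    rw [← sq_abs]
    calc |y1 / x1 - y2 / x2| ^ 2 ≤ ((x1 + x2) ^ (α / 2) / 2) ^ 2 := by gcongr
      _ = _ := by 
        rw [div_pow, ← Real.rpow_two, ← Real.rpow_mul hx.le]; norm_num
  have : x1 * x2 / (x1 + x2) * (y1 / x1 - y2 / x2) ^ 2 ≤ x2 * ((x1 + x2) ^ α / 4) := by gcongr
  by_contra! hcon
  obtain ⟨c1, c2, c3⟩ := hcon
  rw [abs_lt] at c1 c2 c3
  linarith [c1.1, c1.2, c2.1, c2.2, c3.1, c3.2]

/-! ### integrals of weights -/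

lemma J1 {A L C R : ℝ} (hA : 0 ≤ A) (hL : 0 ≤ L) (h : A * L ≤ C) (f : ℝ → ℝ)
    (hf : ∀ x, 0 < x → x ≤ L → f x ≤ A) (hf' : ∀ x, L < x → f x ≤ 0) :
    ∫⁻ x in Ioc 0 R, ENNReal.ofReal (f x) ≤ ENNReal.ofReal C := by
  calc ∫⁻ x in Ioc 0 R, ENNReal.ofReal (f x) ≤ ∫⁻ x in Ioc 0 R, (Ioc 0 L).indicator (fun _ => ENNReal.ofReal A) x := by
        refine setLIntegral_mono' measurableSet_Ioc fun x hx => ?_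
        by_cases hxL : x ≤ L
        · rw [indicator_of_mem (show x ∈ Ioc 0 L from ⟨hx.1, hxL⟩)]
          exact ENNReal.ofReal_le_ofReal (hf x hx.1 hxL)
        · rw [ENNReal.ofReal_of_nonpos (hf' x (not_le.1 hxL))]; exact zero_le
    _ ≤ ∫⁻ x, (Ioc 0 L).indicator (fun _ => ENNReal.ofReal A) x := setLIntegral_le_lintegral _ _
    _ = ENNReal.ofReal (A * L) := by
        rw [lintegral_indicator measurableSet_Ioc, lintegral_const, ENNReal.ofReal_mul hA]
        simp
    _ ≤ _ := ENNReal.ofReal_le_ofReal h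

lemma J2 {A t C R : ℝ} (hA : 0 ≤ A) (ht : 0 < t) (hR : 0 < R) (h : A * (R ^ t / t) ≤ C) (f : ℝ → ℝ)
    (hf : ∀ x, 0 < x → x ≤ R → f x ≤ A * x ^ (t - 1)) :
    ∫⁻ x in Ioc 0 R, ENNReal.ofReal (f x) ≤ ENNReal.ofReal C := by
  calc ∫⁻ x in Ioc 0 R, ENNReal.ofReal (f x) ≤ ∫⁻ x in Ioc 0 R, ENNReal.ofReal A * ENNReal.ofReal (x ^ (t - 1)) := by
        refine setLIntegral_mono' measurableSet_Ioc fun x hx => ?_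
        rw [← ENNReal.ofReal_mul hA]
        exact ENNReal.ofReal_le_ofReal (hf x hx.1 hx.2)
    _ = ENNReal.ofReal (A * (R ^ t / t)) := by
        rw [lintegral_const_mul' _ _ ENNReal.ofReal_ne_top, I6 t R ht hR, ENNReal.ofReal_mul hA]
    _ ≤ _ := ENNReal.ofReal_le_ofReal h

/-! ### invariance of boundedness -/

lemma Tf_comp (k : E3 × E3 → ℝ≥0∞) (hk : Measurable k) (E : E3 → E3) (hE : MeasurePreserving E volume volume)
    (hadd : ∀ p q, E (p + q) = E p + E q) (G F1 F2 : E3 → ℝ≥0∞) (hG : Measurable G) (h1 : Measurable F1) (h2 : Measurable F2) :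
    Tf k G F1 F2 = Tf (fun z => k (E z.1, E z.2)) (fun p => G (E p)) (fun p => F1 (E p)) (fun p => F2 (E p)) := by
  unfold Tf
  rw [← hE.lintegral_comp (f := fun p1 => ∫⁻ p2, G (p1 + p2) * F1 p1 * F2 p2 * k (p1, p2))]
  · refine lintegral_congr fun p1 => ?_
    rw [← hE.lintegral_comp (f := fun p2 => G (E p1 + p2) * F1 (E p1) * F2 p2 * k (E p1, p2))]
    · simp only [hadd]
    · fun_prop
  · apply Measurable.lintegral_prod_right' (f := fun z : E3 × E3 => G (z.1 + z.2) * F1 z.1 * F2 z.2 * k (z.1, z.2))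
    fun_prop

lemma nrm_comp (E : E3 → E3) (hE : MeasurePreserving E volume volume) (F : E3 → ℝ≥0∞) (hF : Measurable F) :
    nrm (fun p => F (E p)) = nrm F := by
  unfold nrm
  rw [hE.lintegral_comp (f := fun p => F p ^ 2) (by fun_prop)]

lemma Bd_comp (k : E3 × E3 → ℝ≥0∞) (hk : Measurable k) (E : E3 → E3) (hE : MeasurePreserving E volume volume)
    (hadd : ∀ p q, E (p + q) = E p + E q) (h : Bd (fun z => k (E z.1, E z.2))) : Bd k := by
  obtain ⟨C, hC, hh⟩ := h
  refine ⟨C, hC, fun G F1 F2 hG h1 h2 => ?_⟩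
  have hEm := hE.measurable
  rw [Tf_comp k hk E hE hadd G F1 F2 hG h1 h2, ← nrm_comp E hE G hG, ← nrm_comp E hE F1 h1, ← nrm_comp E hE F2 h2]
  exact hh _ _ _ (by fun_prop) (by fun_prop) (by fun_prop)

def etaNeg (p : E3) : E3 := (p.1, p.2.1, -p.2.2)

lemma etaNeg_mp : MeasurePreserving etaNeg volume volume :=
  (MeasurePreserving.id (volume : Measure ℝ)).prod
    ((MeasurePreserving.id (volume : Measure ℝ)).prod (Measure.measurePreserving_neg (volume : Measure ℝ)))

lemma etaNeg_add (p q : E3) : etaNeg (p + q) = etaNeg p + etaNeg q := by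
  simp [etaNeg, add_comm]

lemma sg_etaNeg (α : ℝ) (p : E3) : sg α (etaNeg p) = sg α p := by
  simp [sg, om, etaNeg]

lemma neg_mp : MeasurePreserving (fun p : E3 => -p) volume volume := Measure.measurePreserving_neg _

lemma sg_neg (α : ℝ) (p : E3) : sg α (-p) = - sg α p := by
  simp [sg, om, div_neg]; ring

end KP

namespace KP
open MeasureTheory Set
open scoped ENNReal

/-! ### the standard form -/

structure Par (α r ε μ : ℝ) : Prop where
  a1 : 5 / 2 < α
  a2 : α < 4
  r0 : 0 ≤ r
  r1 : r ≤ 1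
  e0 : 0 < ε
  e1 : ε ≤ 1 / 500
  m0 : 0 < μ
  m1 : μ < 1
  mr : 2 * μ + 2 * r = α - 5 / 2
  me : μ = 440 * ε

/-- output frequency -/
def xo (z : E3 × E3) : ℝ := z.1.2.1 + z.2.2.1

@[fun_prop] lemma xo_meas : Measurable xo := by unfold xo; fun_prop

noncomputable def Qf (α : ℝ) (z : E3 × E3) : ℝ := jb (sg α (z.1 + z.2)) * jb (sg α z.1) * jb (sg α z.2)

lemma Qf_one (α : ℝ) (z) : 1 ≤ Qf α z := by
  unfold Qf
  have h1 := jb_one_le (sg α (z.1 + z.2))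
  have h2 := jb_one_le (sg α z.1)
  have h3 := jb_one_le (sg α z.2)
  exact one_le_mul_of_one_le_of_one_le (one_le_mul_of_one_le_of_one_le h1 h2) h3

@[fun_prop] lemma Qf_meas (α : ℝ) : Measurable (Qf α) := by unfold Qf; fun_prop

noncomputable def kr (α r ε : ℝ) (z : E3 × E3) : ℝ := Mm r (xo z) z.2.2.1 * Qf α z ^ (-(1 / 2 - ε))

noncomputable def k0 (α r ε : ℝ) (z : E3 × E3) : ℝ≥0∞ := ENNReal.ofReal (kr α r ε z)

@[fun_prop] lemma k0_meas (α r ε : ℝ) : Measurable (k0 α r ε) := by unfold k0 kr Mm; fun_prop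

lemma ind_sq {α r ε : ℝ} (S : Set (E3 × E3)) (hS : S ⊆ R0) (z : E3 × E3) (A : ℝ) (h : z ∈ S → kr α r ε z ^ 2 ≤ A) :
    S.indicator (k0 α r ε) z ^ 2 ≤ ENNReal.ofReal A := by
  by_cases hz : z ∈ S
  · rw [indicator_of_mem hz, k0, ← ENNReal.ofReal_pow]
    · exact ENNReal.ofReal_le_ofReal (h hz)
    · have := hS hz
      unfold R0 at this
      simp only [mem_ofPred_eq] at this
      have h1 : 0 ≤ Mm r (xo z) z.2.2.1 := Mm_nonneg this.1.le (by unfold xo; linarith)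
      have h2 : 0 ≤ Qf α z := zero_le_one.trans (Qf_one α z)
      unfold kr; positivity
  · simp [indicator_of_notMem hz]

lemma kr_sq (α r ε : ℝ) (z) : kr α r ε z ^ 2 = Mm r (xo z) z.2.2.1 ^ 2 * Qf α z ^ (-(1 - 2 * ε)) := by
  have h2 : 0 ≤ Qf α z := zero_le_one.trans (Qf_one α z)
  unfold kr
  rw [mul_pow]
  congr 1
  rw [← Real.rpow_two, ← Real.rpow_mul h2]
  congr 1; ring

lemma Q_pow (α e : ℝ) (z) : Qf α z ^ e = jb (sg α (z.1 + z.2)) ^ e * jb (sg α z.1) ^ e * jb (sg α z.2) ^ e := by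
  have h1 := (jb_pos (sg α (z.1 + z.2))).le
  have h2 := (jb_pos (sg α z.1)).le
  have h3 := (jb_pos (sg α z.2)).le
  unfold Qf
  rw [Real.mul_rpow (mul_nonneg h1 h2) h3, Real.mul_rpow h1 h2]

lemma jb_pow_le_one (x e : ℝ) (he : 0 ≤ e) : jb x ^ (-e) ≤ 1 :=
  Real.rpow_le_one_of_one_le_of_nonpos (jb_one_le x) (by linarith)

lemma jb_pow_mono {x e f : ℝ} (hef : e ≤ f) : jb x ^ (-f) ≤ jb x ^ (-e) :=
  Real.rpow_le_rpow_of_exponent_le (jb_one_le x) (by linarith)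

lemma jb_pow_nn (x e : ℝ) : 0 ≤ jb x ^ e := Real.rpow_nonneg (jb_pos x).le _

lemma R0_x {z : E3 × E3} (hz : z ∈ R0) : 0 < z.2.2.1 ∧ z.2.2.1 ≤ z.1.2.1 ∧ z.2.2.1 ≤ xo z / 2 ∧ 0 < xo z ∧ z.2.2.1 ≤ xo z := by
  unfold R0 at hz
  simp only [mem_ofPred_eq] at hz
  obtain ⟨h1, h2⟩ := hz
  unfold xo
  refine ⟨h1, h2, ?_, ?_, ?_⟩ <;> linarith

/-- main region -/
def NR (α : ℝ) : Set (E3 × E3) := {z | z ∈ R0 ∧ 1 ≤ xo z ∧ Qf α z ≤ xo z ^ (110 : ℝ)}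

lemma NR_meas (α : ℝ) : MeasurableSet (NR α) :=
  R0_meas.inter ((measurableSet_le (f := fun _ => (1 : ℝ)) (by fun_prop) (by fun_prop)).inter
    (measurableSet_le (f := fun z => Qf α z) (g := fun z => xo z ^ (110 : ℝ)) (by fun_prop) (by fun_prop)))

lemma NR_bd {α r ε μ : ℝ} (h : Par α r ε μ) {z} (hz : z ∈ NR α) :
    kr α r ε z ^ 2 ≤ Mm r (xo z) z.2.2.1 ^ 2 * xo z ^ μ * (jb (sg α (z.1 + z.2)) ^ (-(1 + 2 * ε)) * jb (sg α z.1) ^ (-(1 + 2 * ε)) * jb (sg α z.2) ^ (-(1 + 2 * ε))) := by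
  obtain ⟨h1, h2, h3⟩ := hz
  have hQ := Qf_one α z
  rw [kr_sq, ← Q_pow, mul_assoc]
  gcongr
  have e : Qf α z ^ (-(1 - 2 * ε)) = Qf α z ^ (4 * ε) * Qf α z ^ (-(1 + 2 * ε)) := by
    rw [← Real.rpow_add (by linarith)]; congr 1; ring
  rw [e]
  have : Qf α z ^ (4 * ε) ≤ xo z ^ μ := by
    calc Qf α z ^ (4 * ε) ≤ (xo z ^ (110 : ℝ)) ^ (4 * ε) := by
          have := h.e0
          gcongr
      _ = xo z ^ μ := by rw [← Real.rpow_mul (by linarith), h.me]; congr 1; ring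
  gcongr

lemma sqrt_rpow' (x : ℝ) : √x = x ^ ((3 / 2 : ℝ) - 1) := by rw [Real.sqrt_eq_rpow]; norm_num

/-- region 0a : small output frequency -/
lemma B0a {α r ε μ : ℝ} (h : Par α r ε μ) : Bd ((R0 ∩ {z | xo z ≤ 1}).indicator (k0 α r ε)) := by
  have hm : MeasurableSet (R0 ∩ {z | xo z ≤ 1}) := R0_meas.inter (measurableSet_le (by fun_prop) (by fun_prop))
  refine FP_A α _ ((k0_meas α r ε).indicator hm) (fun ξ _ => if ξ ≤ 1 then 36 else 0) ?_ ?_ ?_ 36 ?_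
  · intro ξ x; split_ifs <;> norm_num
  · intro p1 p2 hp; rw [indicator_of_notMem]; exact fun hh => hp hh.1
  · intro p1 p2 hp
    refine ind_sq _ inter_subset_left _ _ fun hz => ?_
    obtain ⟨x1, x2, x3, x4, x5⟩ := R0_x hp
    have hz2 : xo (p1, p2) ≤ 1 := hz.2
    have hz3 : p1.2.1 + p2.2.1 ≤ 1 := hz2
    rw [if_pos hz3, kr_sq]
    have hM := Mm_a h.r0 h.r1 x1.le x5 hz2
    have hM0 := Mm_nonneg (r := r) x1.le x4.le
    have hQ := Qf_one α (p1, p2)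
    have := h.e1
    have hq : Qf α (p1, p2) ^ (-(1 - 2 * ε)) ≤ jb (sg α p2) ^ (-0.9 : ℝ) * jb (sg α p1) ^ (-0.9 : ℝ) := by
      calc Qf α (p1, p2) ^ (-(1 - 2 * ε)) ≤ Qf α (p1, p2) ^ (-0.9 : ℝ) := Real.rpow_le_rpow_of_exponent_le hQ (by linarith)
        _ ≤ _ := by
          rw [Q_pow, mul_assoc, mul_comm (jb (sg α p2) ^ _)]
          apply mul_le_of_le_one_left
          · exact mul_nonneg (jb_pow_nn _ _) (jb_pow_nn _ _)
          · exact jb_pow_le_one _ _ (by norm_num)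
    have : Mm r (xo (p1, p2)) p2.2.1 ^ 2 ≤ 36 := by nlinarith
    simp only
    gcongr
  · intro ξ hξ
    by_cases h1 : ξ ≤ 1
    · simp only [if_pos h1]
      refine J2 (A := 36) (t := 3 / 2) (by norm_num) (by norm_num) (by linarith) ?_ _ fun x hx _ => ?_
      · have : (ξ / 2) ^ (3 / 2 : ℝ) ≤ 1 := Real.rpow_le_one (by linarith) (by linarith) (by norm_num)
        linarith
      · rw [sqrt_rpow']
    · simp [if_neg h1]

/-- region 0b : very large modulation -/
lemma B0b {α r ε μ : ℝ} (h : Par α r ε μ) : Bd ((R0 ∩ {z | 1 ≤ xo z ∧ xo z ^ (110 : ℝ) ≤ Qf α z}).indicator (k0 α r ε)) := by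
  have hm : MeasurableSet (R0 ∩ {z | 1 ≤ xo z ∧ xo z ^ (110 : ℝ) ≤ Qf α z}) := R0_meas.inter 
    ((measurableSet_le (f := fun _ => (1 : ℝ)) (by fun_prop) (by fun_prop)).inter
    (measurableSet_le (f := fun z => xo z ^ (110 : ℝ)) (g := fun z => Qf α z) (by fun_prop) (by fun_prop)))
  refine FP_A α _ ((k0_meas α r ε).indicator hm) (fun ξ _ => if 1 ≤ ξ then 36 * ξ ^ (-(3 / 2) : ℝ) else 0) ?_ ?_ ?_ 36 ?_
  · intro ξ x; split_ifs <;> positivity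
  · intro p1 p2 hp; rw [indicator_of_notMem]; exact fun hh => hp hh.1
  · intro p1 p2 hp
    refine ind_sq _ inter_subset_left _ _ fun hz => ?_
    obtain ⟨x1, x2, x3, x4, x5⟩ := R0_x hp
    have hz2 : 1 ≤ xo (p1, p2) := hz.2.1
    have hz3 : 1 ≤ p1.2.1 + p2.2.1 := hz2
    rw [if_pos hz3, kr_sq]
    have hM := Mm_b h.r0 h.r1 x1.le x5 hz2
    have hM0 := Mm_nonneg (r := r) x1.le x4.le
    have hQ := Qf_one α (p1, p2)
    have hK : xo (p1, p2) ^ (110 : ℝ) ≤ Qf α (p1, p2) := hz.2.2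
    have := h.e1
    have hq0 : Qf α (p1, p2) ^ (-0.9 : ℝ) ≤ jb (sg α p2) ^ (-0.9 : ℝ) * jb (sg α p1) ^ (-0.9 : ℝ) := by
          rw [Q_pow, mul_assoc, mul_comm (jb (sg α p2) ^ _)]
          apply mul_le_of_le_one_left
          · exact mul_nonneg (jb_pow_nn _ _) (jb_pow_nn _ _)
          · exact jb_pow_le_one _ _ (by norm_num)
    have hq1 : Qf α (p1, p2) ^ (-(0.09 : ℝ)) ≤ xo (p1, p2) ^ (-9.9 : ℝ) := by
      calc Qf α (p1, p2) ^ (-(0.09 : ℝ)) ≤ (xo (p1, p2) ^ (110 : ℝ)) ^ (-(0.09 : ℝ)) := 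
            rpow_neg_anti (by positivity) hK (by norm_num)
        _ = _ := by rw [← Real.rpow_mul x4.le]; norm_num
    have hM2 : Mm r (xo (p1, p2)) p2.2.1 ^ 2 ≤ 36 * xo (p1, p2) ^ (4 : ℝ) := by
      calc Mm r (xo (p1, p2)) p2.2.1 ^ 2 ≤ (6 * xo (p1, p2) ^ (1 + r)) ^ 2 := by gcongr
        _ = 36 * xo (p1, p2) ^ ((1 + r) * 2) := by rw [mul_pow, Real.rpow_mul x4.le, Real.rpow_two]; norm_num
        _ ≤ _ := by 
          have := Real.rpow_le_rpow_of_exponent_le hz2 (by linarith [h.r1] : (1 + r) * 2 ≤ 4)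
          gcongr
    calc Mm r (xo (p1, p2)) p2.2.1 ^ 2 * Qf α (p1, p2) ^ (-(1 - 2 * ε)) 
        ≤ Mm r (xo (p1, p2)) p2.2.1 ^ 2 * Qf α (p1, p2) ^ (-(0.09 : ℝ) + (-0.9)) := by
          have := Real.rpow_le_rpow_of_exponent_le hQ (by linarith : -(1 - 2 * ε) ≤ -(0.09 : ℝ) + (-0.9))
          gcongr
      _ = Mm r (xo (p1, p2)) p2.2.1 ^ 2 * (Qf α (p1, p2) ^ (-(0.09 : ℝ)) * Qf α (p1, p2) ^ (-0.9 : ℝ)) := by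
          rw [Real.rpow_add (by linarith)]
      _ ≤ (36 * xo (p1, p2) ^ (4 : ℝ)) * (xo (p1, p2) ^ (-9.9 : ℝ) * (jb (sg α p2) ^ (-0.9 : ℝ) * jb (sg α p1) ^ (-0.9 : ℝ))) := by
          gcongr
      _ = 36 * (xo (p1, p2) ^ (4 + (-9.9) : ℝ)) * (jb (sg α p2) ^ (-0.9 : ℝ) * jb (sg α p1) ^ (-0.9 : ℝ)) := by
          rw [Real.rpow_add x4]; ring
      _ ≤ _ := by
          have := Real.rpow_le_rpow_of_exponent_le hz2 (by norm_num : (4 + (-9.9) : ℝ) ≤ -(3 / 2))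
          have h3 := jb_pow_nn (sg α p2) (-0.9)
          have h4 := jb_pow_nn (sg α p1) (-0.9)
          unfold xo at this ⊢
          gcongr
  · intro ξ hξ
    by_cases h1 : 1 ≤ ξ
    · simp only [if_pos h1]
      refine J2 (A := 36 * ξ ^ (-(3 / 2) : ℝ)) (t := 3 / 2) (by positivity) (by norm_num) (by linarith) ?_ _ fun x hx _ => ?_
      · have e1 : (ξ / 2) ^ (3 / 2 : ℝ) ≤ ξ ^ (3 / 2 : ℝ) := by gcongr; linarith
        have e2 : ξ ^ (-(3 / 2) : ℝ) * ξ ^ (3 / 2 : ℝ) = 1 := by rw [← Real.rpow_add hξ]; norm_num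
        have e3 : 0 < ξ ^ (-(3 / 2) : ℝ) := by positivity
        have e4 : 0 < (ξ / 2) ^ ((3 / 2) : ℝ) := by positivity
        have := mul_le_mul_of_nonneg_left e1 e3.le
        rw [e2] at this
        rw [mul_div_assoc', div_le_iff₀ (by norm_num)]
        nlinarith
      · rw [sqrt_rpow']
    · simp [if_neg h1]

end KP

namespace KP
open MeasureTheory Set
open scoped ENNReal

lemma NR_R0 (α : ℝ) (T : Set (E3 × E3)) : NR α ∩ T ⊆ R0 := fun _ hz => hz.1.1

lemma low_meas (α : ℝ) : MeasurableSet {z : E3 × E3 | z.2.2.1 ≤ xo z ^ (-((α - 1) / 2))} :=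
  measurableSet_le (by fun_prop) (by fun_prop)

/-- threshold for the modulation -/
noncomputable def Lam (α : ℝ) (z : E3 × E3) : ℝ := z.2.2.1 * xo z ^ α / 12

@[fun_prop] lemma Lam_meas (α : ℝ) : Measurable (Lam α) := by unfold Lam; fun_prop

lemma jb_Lam {L x e : ℝ} (hL : 0 < L) (h : L ≤ |x|) (he : 1 ≤ e) : jb x ^ (-e) ≤ 1 / L := by
  have h1 := jb_abs_le x
  calc jb x ^ (-e) ≤ jb x ^ (-(1 : ℝ)) := jb_pow_mono he
    _ ≤ L ^ (-(1 : ℝ)) := rpow_neg_anti hL (h.trans h1) (by norm_num)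
    _ = 1 / L := by rw [Real.rpow_neg_one, one_div]

/-- region 1a -/
lemma B1a {α r ε μ : ℝ} (h : Par α r ε μ) : Bd ((NR α ∩ ({z | z.2.2.1 ≤ xo z ^ (-((α - 1) / 2))} ∩
    {z | xo z ^ (α / 2) / 2 ≤ |Df z|})).indicator (k0 α r ε)) := by
  have ha1 := h.a1
  have ha2 := h.a2
  have hr0 := h.r0
  have he0 := h.e0
  have hmr := h.mr
  have hm0 := h.m0
  have hm := (NR_meas α).inter ((low_meas α).inter (measurableSet_le (f := fun z => xo z ^ (α / 2) / 2) (g := fun z => |Df z|) (by fun_prop) (by fun_prop)))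
  refine FP_C α (1 + 2 * ε) (by linarith) (fun ξ => ξ ^ (α / 2) / 2) (fun ξ hξ => by positivity) _ 
    ((k0_meas α r ε).indicator hm) (fun ξ x => if 1 ≤ ξ ∧ x ≤ ξ ^ (-((α - 1) / 2)) then 80 * ξ ^ (2 + μ) else 0) ?_ ?_ ?_ ?_ 160 ?_
  · intro ξ x; split_ifs with hh
    · have := hh.1; positivity
    · exact le_rfl
  · intro p1 p2 hp; rw [indicator_of_notMem]; exact fun hh => hp (NR_R0 _ _ hh)
  · intro p1 p2 hp; rw [indicator_of_notMem]; exact fun hh => absurd hp (not_lt.2 hh.2.2)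
  · intro p1 p2 hp
    refine ind_sq _ (NR_R0 _ _) _ _ fun hz => ?_
    obtain ⟨x1, x2, x3, x4, x5⟩ := R0_x hp
    have hz2 : 1 ≤ xo (p1, p2) := hz.1.2.1
    have hz3 : p2.2.1 ≤ xo (p1, p2) ^ (-((α - 1) / 2)) := hz.2.1
    rw [if_pos ⟨hz2, hz3⟩]
    refine (NR_bd h hz.1).trans ?_
    have hM := Mm_low h.r0 h.r1 ha2 (by linarith) x1.le x5 hz2 hz3
    have j1 := jb_pow_nn (sg α p1) (-(1 + 2 * ε))
    have j2 := jb_pow_nn (sg α p2) (-(1 + 2 * ε))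
    have j0 := jb_pow_le_one (sg α (p1 + p2)) (1 + 2 * ε) (by linarith)
    have j5 := jb_pow_nn (sg α (p1 + p2)) (-(1 + 2 * ε))
    simp only
    calc _ ≤ (80 * xo (p1, p2) ^ (2 : ℝ)) * xo (p1, p2) ^ μ * (1 * jb (sg α p1) ^ (-(1 + 2 * ε)) * jb (sg α p2) ^ (-(1 + 2 * ε))) := by
          gcongr
      _ = 80 * xo (p1, p2) ^ (2 + μ) * (jb (sg α p2) ^ (-(1 + 2 * ε)) * jb (sg α p1) ^ (-(1 + 2 * ε))) := by
          rw [Real.rpow_add x4]; ring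
      _ = _ := rfl
  · intro ξ hξ
    by_cases h1 : 1 ≤ ξ
    · refine J1 (A := 80 * ξ ^ (2 + μ) / (ξ ^ (α / 2) / 2)) (L := ξ ^ (-((α - 1) / 2))) (by positivity) (by positivity) ?_ _ ?_ ?_
      · calc 80 * ξ ^ (2 + μ) / (ξ ^ (α / 2) / 2) * ξ ^ (-((α - 1) / 2)) = 160 * (ξ ^ (2 + μ) * ξ ^ (-(α / 2)) * ξ ^ (-((α - 1) / 2))) := by
              rw [Real.rpow_neg hξ.le (α / 2)]; field_simp; norm_num
          _ = 160 * ξ ^ (2 + μ + -(α / 2) + -((α - 1) / 2)) := by rw [Real.rpow_add hξ (2 + μ + -(α / 2)), Real.rpow_add hξ (2 + μ)]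
          _ ≤ 160 * 1 := by
              gcongr
              exact Real.rpow_le_one_of_one_le_of_nonpos h1 (by linarith)
          _ = 160 := by norm_num
      · intro x hx hxL
        rw [if_pos ⟨h1, hxL⟩]
      · intro x hxL
        rw [if_neg (fun hh => absurd hh.2 (not_le.2 hxL))]; simp
    · simp [h1]

/-- region 1b -/
lemma B1b {α r ε μ : ℝ} (h : Par α r ε μ) : Bd ((NR α ∩ ({z | z.2.2.1 ≤ xo z ^ (-((α - 1) / 2))} ∩
    {z | Lam α z ≤ |sg α z.2|})).indicator (k0 α r ε)) := by
  have ha1 := h.a1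
  have ha2 := h.a2
  have hr0 := h.r0
  have he0 := h.e0
  have hmr := h.mr
  have hm0 := h.m0
  have hm := (NR_meas α).inter ((low_meas α).inter (measurableSet_le (f := fun z => Lam α z) (g := fun z => |sg α z.2|) (by fun_prop) (by fun_prop)))
  refine FP_B α (1 + 2 * ε) (by linarith) (fun ξ x => x * ξ ^ α / 12) (fun ξ x hξ hx => by positivity) _ 
    ((k0_meas α r ε).indicator hm) (fun ξ x => if 1 ≤ ξ ∧ x ≤ ξ ^ (-((α - 1) / 2)) then 80 * ξ ^ (2 + μ) else 0) ?_ ?_ ?_ ?_ 320 ?_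
  · intro ξ x; split_ifs with hh
    · have := hh.1; positivity
    · exact le_rfl
  · intro p1 p2 hp; rw [indicator_of_notMem]; exact fun hh => hp (NR_R0 _ _ hh)
  · intro p1 p2 hp; rw [indicator_of_notMem]; exact fun hh => hp (Or.inl hh.2.2)
  · intro p1 p2 hp
    refine ind_sq _ (NR_R0 _ _) _ _ fun hz => ?_
    obtain ⟨x1, x2, x3, x4, x5⟩ := R0_x hp
    have hz2 : 1 ≤ xo (p1, p2) := hz.1.2.1
    have hz3 : p2.2.1 ≤ xo (p1, p2) ^ (-((α - 1) / 2)) := hz.2.1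
    rw [if_pos ⟨hz2, hz3⟩]
    refine (NR_bd h hz.1).trans ?_
    have hM := Mm_low h.r0 h.r1 ha2 (by linarith) x1.le x5 hz2 hz3
    have j1 := jb_pow_nn (sg α p1) (-(1 + 2 * ε))
    have j2 := jb_pow_nn (sg α p2) (-(1 + 2 * ε))
    have j0 := jb_pow_le_one (sg α (p1 + p2)) (1 + 2 * ε) (by linarith)
    have j5 := jb_pow_nn (sg α (p1 + p2)) (-(1 + 2 * ε))
    simp only
    calc _ ≤ (80 * xo (p1, p2) ^ (2 : ℝ)) * xo (p1, p2) ^ μ * (1 * jb (sg α p1) ^ (-(1 + 2 * ε)) * jb (sg α p2) ^ (-(1 + 2 * ε))) := by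
          gcongr
      _ = 80 * xo (p1, p2) ^ (2 + μ) * (jb (sg α p2) ^ (-(1 + 2 * ε)) * jb (sg α p1) ^ (-(1 + 2 * ε))) := by
          rw [Real.rpow_add x4]; ring
      _ = _ := rfl
  · intro ξ hξ
    by_cases h1 : 1 ≤ ξ
    · refine J1 (A := 320 * ξ ^ (2 + μ) * ξ ^ (-(α / 2))) (L := ξ ^ (-((α - 1) / 2))) (by positivity) (by positivity) ?_ _ ?_ ?_
      · calc 320 * ξ ^ (2 + μ) * ξ ^ (-(α / 2)) * ξ ^ (-((α - 1) / 2)) = 320 * (ξ ^ (2 + μ) * ξ ^ (-(α / 2)) * ξ ^ (-((α - 1) / 2))) := by ring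
          _ = 320 * ξ ^ (2 + μ + -(α / 2) + -((α - 1) / 2)) := by rw [Real.rpow_add hξ (2 + μ + -(α / 2)), Real.rpow_add hξ (2 + μ)]
          _ ≤ 320 * 1 := by
              gcongr
              exact Real.rpow_le_one_of_one_le_of_nonpos h1 (by linarith)
          _ = 320 := by norm_num
      · intro x hx hxL
        rw [if_pos ⟨h1, hxL⟩]
        have e1 : (x * ξ ^ α / 12) ^ (-(1 / 2 : ℝ)) * √x = √12 * ξ ^ (-(α / 2)) := by
          rw [Real.rpow_neg (by positivity), ← Real.sqrt_eq_rpow, Real.sqrt_div (by positivity), Real.sqrt_mul hx.le,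
            Real.rpow_neg hξ.le, Real.sqrt_eq_rpow (ξ ^ α), ← Real.rpow_mul hξ.le, mul_one_div]
          have : √x ≠ 0 := by positivity
          field_simp
        have e2 : √12 ≤ 4 := by rw [Real.sqrt_le_left (by norm_num)]; norm_num
        rw [mul_assoc, e1]
        calc 80 * ξ ^ (2 + μ) * (√12 * ξ ^ (-(α / 2))) ≤ 80 * ξ ^ (2 + μ) * (4 * ξ ^ (-(α / 2))) := by gcongr
          _ = _ := by ring
      · intro x hxL
        rw [if_neg (fun hh => absurd hh.2 (not_le.2 hxL))]; simp
    · simp [h1]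

lemma Mm_b2 {r c b : ℝ} (hr : 0 ≤ r) (hr1 : r ≤ 1) (hb : 0 ≤ b) (hbc : b ≤ c) (hc : 1 ≤ c) :
    Mm r c b ^ 2 ≤ 36 * c ^ (2 + 2 * r) := by
  have h0 := Mm_nonneg (r := r) hb (hb.trans hbc)
  calc Mm r c b ^ 2 ≤ (6 * c ^ (1 + r)) ^ 2 := by
        have := Mm_b hr hr1 hb hbc hc
        gcongr
    _ = 36 * c ^ ((1 + r) * 2) := by rw [mul_pow, Real.rpow_mul (by linarith), Real.rpow_two]; norm_num
    _ = _ := by congr 2; ring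

/-- pointwise bound common to regions 2c, 2d -/
lemma two_pt {α r μ c b J : ℝ} (hr : 0 ≤ r) (hr1 : r ≤ 1) (hb : 0 < b) (hbc : b ≤ c) (hc : 1 ≤ c)
    (hJ0 : 0 ≤ J) (hJ : J ≤ 1 / (b * c ^ α / 12)) :
    Mm r c b ^ 2 * c ^ μ * J ≤ 432 * c ^ (2 + 2 * r + μ - α) * b⁻¹ := by
  have hc0 : 0 < c := by linarith
  calc Mm r c b ^ 2 * c ^ μ * J ≤ 36 * c ^ (2 + 2 * r) * c ^ μ * (1 / (b * c ^ α / 12)) := by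
        have := Mm_b2 hr hr1 hb.le hbc hc
        gcongr
    _ = _ := by
        rw [Real.rpow_sub hc0, Real.rpow_add hc0 (2 + 2 * r) μ]
        field_simp
        norm_num

/-- region 2c -/
lemma B2c {α r ε μ : ℝ} (h : Par α r ε μ) : Bd ((NR α ∩ {z | Lam α z ≤ |sg α (z.1 + z.2)|}).indicator (k0 α r ε)) := by
  have ha1 := h.a1
  have ha2 := h.a2
  have hr0 := h.r0
  have he0 := h.e0
  have hmr := h.mr
  have hm0 := h.m0
  have hm := (NR_meas α).inter (measurableSet_le (f := fun z => Lam α z) (g := fun z : E3 × E3 => |sg α (z.1 + z.2)|) (by fun_prop) (by fun_prop))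
  refine FP_A α _ ((k0_meas α r ε).indicator hm) (fun ξ x => if 1 ≤ ξ ∧ 0 < x then 432 * ξ ^ (2 + 2 * r + μ - α) * x⁻¹ else 0) ?_ ?_ ?_ 864 ?_
  · intro ξ x; split_ifs with hh
    · have := hh.1; have := hh.2; positivity
    · exact le_rfl
  · intro p1 p2 hp; rw [indicator_of_notMem]; exact fun hh => hp (NR_R0 _ _ hh)
  · intro p1 p2 hp
    refine ind_sq _ (NR_R0 _ _) _ _ fun hz => ?_
    obtain ⟨x1, x2, x3, x4, x5⟩ := R0_x hp
    have hz2 : 1 ≤ xo (p1, p2) := hz.1.2.1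
    have hz3 : Lam α (p1, p2) ≤ |sg α (p1 + p2)| := hz.2
    rw [if_pos ⟨hz2, x1⟩]
    refine (NR_bd h hz.1).trans ?_
    have j1 := jb_pow_nn (sg α p1) (-(1 + 2 * ε))
    have j2 := jb_pow_nn (sg α p2) (-(1 + 2 * ε))
    have jj := jb_Lam (by unfold Lam; positivity) hz3 (by linarith : 1 ≤ 1 + 2 * ε)
    have j6 := jb_pow_nn (sg α p2) (-0.9)
    have j3 := jb_pow_mono (x := sg α p1) (by linarith : (0.9 : ℝ) ≤ 1 + 2 * ε)
    have j4 := jb_pow_mono (x := sg α p2) (by linarith : (0.9 : ℝ) ≤ 1 + 2 * ε)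
    have := two_pt (μ := μ) hr0 h.r1 x1 x5 hz2 (jb_pow_nn _ _) jj
    have xx : p1.2.1 + p2.2.1 = xo (p1, p2) := rfl
    simp only [xx] at this ⊢
    set A := Mm r (xo (p1, p2)) p2.2.1 ^ 2 * xo (p1, p2) ^ μ
    calc A * (jb (sg α (p1 + p2)) ^ (-(1 + 2 * ε)) * jb (sg α p1) ^ (-(1 + 2 * ε)) * jb (sg α p2) ^ (-(1 + 2 * ε))) 
        = (A * jb (sg α (p1 + p2)) ^ (-(1 + 2 * ε))) * (jb (sg α p2) ^ (-(1 + 2 * ε)) * jb (sg α p1) ^ (-(1 + 2 * ε))) := by ring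
      _ ≤ _ := by gcongr
  · intro ξ hξ
    by_cases h1 : 1 ≤ ξ
    · refine J2 (A := 432 * ξ ^ (2 + 2 * r + μ - α)) (t := 1 / 2) (by positivity) (by norm_num) (by linarith) ?_ _ fun x hx _ => ?_
      · calc 432 * ξ ^ (2 + 2 * r + μ - α) * ((ξ / 2) ^ (1 / 2 : ℝ) / (1 / 2)) ≤ 432 * ξ ^ (2 + 2 * r + μ - α) * (ξ ^ (1 / 2 : ℝ) / (1 / 2)) := by
              gcongr; linarith
          _ = 864 * ξ ^ (2 + 2 * r + μ - α + 1 / 2) := by rw [Real.rpow_add hξ]; ring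
          _ ≤ 864 * 1 := by gcongr; exact Real.rpow_le_one_of_one_le_of_nonpos h1 (by linarith)
          _ = 864 := by norm_num
      · rw [if_pos ⟨h1, hx⟩, mul_assoc]
        apply le_of_eq; congr 1
        rw [Real.sqrt_eq_rpow, ← Real.rpow_neg_one, ← Real.rpow_add hx]; norm_num
    · simp [h1]

/-- region 2d -/
lemma B2d {α r ε μ : ℝ} (h : Par α r ε μ) : Bd ((NR α ∩ {z | Lam α z ≤ |sg α z.1|}).indicator (k0 α r ε)) := by
  have ha1 := h.a1
  have ha2 := h.a2
  have hr0 := h.r0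
  have he0 := h.e0
  have hmr := h.mr
  have hm0 := h.m0
  have hm1 := h.m1
  have hm := (NR_meas α).inter (measurableSet_le (f := fun z => Lam α z) (g := fun z : E3 × E3 => |sg α z.1|) (by fun_prop) (by fun_prop))
  refine FP_1 α _ ((k0_meas α r ε).indicator hm) (fun ξ x => if 1 / 2 ≤ ξ ∧ 0 < x then 432 * ξ ^ (2 + 2 * r + μ - α) * x⁻¹ else 0) ?_ ?_ ?_ (864 * 2) ?_
  · intro ξ x; split_ifs with hh
    · have := hh.1; have := hh.2
      have : 0 < ξ := by linarith
      positivity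
    · exact le_rfl
  · intro p1 p2 hp; rw [indicator_of_notMem]; exact fun hh => hp (NR_R0 _ _ hh)
  · intro p1 p2 hp
    refine ind_sq _ (NR_R0 _ _) _ _ fun hz => ?_
    obtain ⟨x1, x2, x3, x4, x5⟩ := R0_x hp
    have hz2 : 1 ≤ xo (p1, p2) := hz.1.2.1
    have hz3 : Lam α (p1, p2) ≤ |sg α p1| := hz.2
    have xx : p1.2.1 + p2.2.1 = xo (p1, p2) := rfl
    simp only at x2
    have x6 : 0 < p1.2.1 := lt_of_lt_of_le x1 x2
    rw [if_pos ⟨by linarith, x1⟩]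
    refine (NR_bd h hz.1).trans ?_
    have j1 := jb_pow_nn (sg α (p1 + p2)) (-(1 + 2 * ε))
    have j2 := jb_pow_nn (sg α p2) (-(1 + 2 * ε))
    have jj := jb_Lam (by unfold Lam; positivity) hz3 (by linarith : 1 ≤ 1 + 2 * ε)
    have j6 := jb_pow_nn (sg α p2) (-0.9)
    have j3 := jb_pow_mono (x := sg α (p1 + p2)) (by linarith : (0.9 : ℝ) ≤ 1 + 2 * ε)
    have j4 := jb_pow_mono (x := sg α p2) (by linarith : (0.9 : ℝ) ≤ 1 + 2 * ε)
    have := two_pt (μ := μ) hr0 h.r1 x1 x5 hz2 (jb_pow_nn _ _) jj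
    simp only at this ⊢
    have hxx : xo (p1, p2) ^ (2 + 2 * r + μ - α) ≤ p1.2.1 ^ (2 + 2 * r + μ - α) := by
      apply Real.rpow_le_rpow_of_nonpos x6
      · rw [← xx]; linarith
      · linarith
    set A := Mm r (xo (p1, p2)) p2.2.1 ^ 2 * xo (p1, p2) ^ μ
    calc A * (jb (sg α (p1 + p2)) ^ (-(1 + 2 * ε)) * jb (sg α p1) ^ (-(1 + 2 * ε)) * jb (sg α p2) ^ (-(1 + 2 * ε))) 
        = (A * jb (sg α p1) ^ (-(1 + 2 * ε))) * (jb (sg α p2) ^ (-(1 + 2 * ε)) * jb (sg α (p1 + p2)) ^ (-(1 + 2 * ε))) := by ring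
      _ ≤ (432 * xo (p1, p2) ^ (2 + 2 * r + μ - α) * (p2.2.1)⁻¹) * (jb (sg α p2) ^ (-0.9 : ℝ) * jb (sg α (p1 + p2)) ^ (-0.9 : ℝ)) := by gcongr
      _ ≤ _ := by
        have h3 := jb_pow_nn (sg α p2) (-0.9)
        have h4 := jb_pow_nn (sg α (p1 + p2)) (-0.9)
        gcongr
  · intro ξ hξ
    by_cases h1 : 1 / 2 ≤ ξ
    · refine J2 (A := 432 * ξ ^ (2 + 2 * r + μ - α)) (t := 1 / 2) (by positivity) (by norm_num) (by linarith) ?_ _ fun x hx _ => ?_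
      · calc 432 * ξ ^ (2 + 2 * r + μ - α) * (ξ ^ (1 / 2 : ℝ) / (1 / 2)) 
            = 864 * ξ ^ (2 + 2 * r + μ - α + 1 / 2) := by rw [Real.rpow_add hξ]; ring
          _ ≤ 864 * (1 / 2) ^ (2 + 2 * r + μ - α + 1 / 2) := by 
              gcongr 864 * ?_
              exact Real.rpow_le_rpow_of_nonpos (by norm_num) h1 (by linarith)
          _ ≤ 864 * (1 / 2) ^ (-1 : ℝ) := by
              gcongr 864 * ?_
              exact Real.rpow_le_rpow_of_exponent_ge (by norm_num) (by norm_num) (by linarith)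
          _ = 864 * 2 := by rw [Real.rpow_neg_one]; norm_num
      · rw [if_pos ⟨h1, hx⟩, mul_assoc]
        apply le_of_eq; congr 1
        rw [Real.sqrt_eq_rpow, ← Real.rpow_neg_one, ← Real.rpow_add hx]; norm_num
    · have : ¬ (2 : ℝ)⁻¹ ≤ ξ := by rwa [← one_div]
      simp [this]

end KP

namespace KP
open MeasureTheory Set
open scoped ENNReal

lemma high_meas (α : ℝ) : MeasurableSet {z : E3 × E3 | xo z ^ (-((α - 1) / 2)) ≤ z.2.2.1} :=
  measurableSet_le (by fun_prop) (by fun_prop)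

def S2a (α : ℝ) : Set (E3 × E3) := NR α ∩ ({z | xo z ^ (-((α - 1) / 2)) ≤ z.2.2.1} ∩ {z | xo z ^ (α / 2) / 2 ≤ Df z})

def S2a' (α : ℝ) : Set (E3 × E3) := NR α ∩ ({z | xo z ^ (-((α - 1) / 2)) ≤ z.2.2.1} ∩ {z | xo z ^ (α / 2) / 2 ≤ -Df z})

lemma S2a_meas (α : ℝ) : MeasurableSet (S2a α) :=
  (NR_meas α).inter ((high_meas α).inter (measurableSet_le (f := fun z => xo z ^ (α / 2) / 2) (g := fun z => Df z) (by fun_prop) (by fun_prop)))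

lemma S2a'_meas (α : ℝ) : MeasurableSet (S2a' α) :=
  (NR_meas α).inter ((high_meas α).inter (measurableSet_le (f := fun z => xo z ^ (α / 2) / 2) (g := fun z => -Df z) (by fun_prop) (by fun_prop)))

/-- region 2a -/
lemma B2a {α r ε μ : ℝ} (h : Par α r ε μ) : Bd ((S2a α).indicator (k0 α r ε)) := by
  have ha1 := h.a1
  have he0 := h.e0
  have hmr := h.mr
  have hm0 := h.m0
  refine LW_A α (1 + 2 * ε) 80 (by linarith) (by linarith) (by norm_num) _ ((k0_meas α r ε).indicator (S2a_meas α)) ?_ ?_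
  · intro z hz; rw [indicator_of_notMem]; exact fun hh => hz ⟨hh.1.1, hh.2.2⟩
  · intro z hz
    rw [← ENNReal.ofReal_mul (jb_pow_nn _ _)]
    refine ind_sq _ (NR_R0 _ _) _ _ fun hzS => ?_
    obtain ⟨x1, x2, x3, x4, x5⟩ := R0_x hz.1
    have hz2 : 1 ≤ xo z := hzS.1.2.1
    refine (NR_bd h hzS.1).trans ?_
    have hM := Mm_high h.r0 h.r1 ha1 hmr.le hm0.le x1.le x5 hz2 hzS.2.1
    have hM2 : xo z ^ (3 * α / 2 - 1 - μ) ≤ xo z ^ (3 * α / 2 - 1) := Real.rpow_le_rpow_of_exponent_le hz2 (by linarith)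
    have j0 := jb_pow_nn (sg α (z.1 + z.2)) (-(1 + 2 * ε))
    have j1 := jb_pow_nn (sg α z.1) (-(1 + 2 * ε))
    have j2 := jb_pow_nn (sg α z.2) (-(1 + 2 * ε))
    have xx : z.1.2.1 + z.2.2.1 = xo z := rfl
    rw [xx]
    calc _ ≤ (80 * z.2.2.1 * xo z ^ (3 * α / 2 - 1 - μ)) * (jb (sg α (z.1 + z.2)) ^ (-(1 + 2 * ε)) * jb (sg α z.1) ^ (-(1 + 2 * ε)) * jb (sg α z.2) ^ (-(1 + 2 * ε))) := by
          gcongr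
      _ ≤ (80 * z.2.2.1 * xo z ^ (3 * α / 2 - 1)) * (jb (sg α (z.1 + z.2)) ^ (-(1 + 2 * ε)) * jb (sg α z.1) ^ (-(1 + 2 * ε)) * jb (sg α z.2) ^ (-(1 + 2 * ε))) := by
          gcongr
      _ = _ := by ring

/-- region 2a, opposite sign -/
lemma B2a' {α r ε μ : ℝ} (h : Par α r ε μ) : Bd ((S2a' α).indicator (k0 α r ε)) := by
  refine Bd_comp _ ((k0_meas α r ε).indicator (S2a'_meas α)) etaNeg etaNeg_mp etaNeg_add ?_
  convert B2a h using 1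
  funext z
  have e1 : xo (etaNeg z.1, etaNeg z.2) = xo z := rfl
  have e2 : (etaNeg z.2).2.1 = z.2.2.1 := rfl
  have e3 : Qf α (etaNeg z.1, etaNeg z.2) = Qf α z := by
    simp only [Qf, ← etaNeg_add, sg_etaNeg]
  have e4 : Df (etaNeg z.1, etaNeg z.2) = - Df z := by
    simp only [Df, etaNeg]; ring
  have e5 : k0 α r ε (etaNeg z.1, etaNeg z.2) = k0 α r ε z := by
    simp only [k0, kr, e1, e3]; rfl
  have e6 : (etaNeg z.1, etaNeg z.2) ∈ S2a' α ↔ z ∈ S2a α := by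
    simp only [S2a, S2a', NR, R0, mem_inter_iff, mem_ofPred_eq, e1, e3, e4, neg_neg]
    rfl
  by_cases hz : z ∈ S2a α
  · rw [indicator_of_mem hz, indicator_of_mem (e6.2 hz), e5]
  · rw [indicator_of_notMem hz, indicator_of_notMem (fun hh => hz (e6.1 hh))]

def S2e (α : ℝ) : Set (E3 × E3) := NR α ∩ ({z | xo z ^ (-((α - 1) / 2)) ≤ z.2.2.1} ∩ ({z | |Df z| ≤ xo z ^ (α / 2) / 2} ∩
  {z | Lam α z ≤ |sg α z.2|}))

lemma S2e_meas (α : ℝ) : MeasurableSet (S2e α) :=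
  (NR_meas α).inter ((high_meas α).inter ((measurableSet_le (f := fun z => |Df z|) (g := fun z => xo z ^ (α / 2) / 2) (by fun_prop) (by fun_prop)).inter
    (measurableSet_le (f := fun z => Lam α z) (g := fun z => |sg α z.2|) (by fun_prop) (by fun_prop))))

lemma B2e {α r ε μ : ℝ} (h : Par α r ε μ) : Bd ((S2e α).indicator (k0 α r ε)) := by
  have ha1 := h.a1
  have he0 := h.e0
  have hmr := h.mr
  have hm0 := h.m0
  refine LW_C α (1 + 2 * ε) 960 μ (by linarith) (by linarith) (by norm_num) hm0 h.m1 _ ((k0_meas α r ε).indicator (S2e_meas α)) ?_ ?_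
  · intro z hz; rw [indicator_of_notMem]; exact fun hh => hz ⟨hh.1.1, hh.2.1, hh.2.2.1⟩
  · intro z hz
    obtain ⟨x1, x2, x3, x4, x5⟩ := R0_x hz.1
    have xx : z.1.2.1 + z.2.2.1 = xo z := rfl
    rw [xx]
    rw [← ENNReal.ofReal_mul (by positivity)]
    refine ind_sq _ (NR_R0 _ _) _ _ fun hzS => ?_
    have hz2 : 1 ≤ xo z := hzS.1.2.1
    refine (NR_bd h hzS.1).trans ?_
    have hM := Mm_high h.r0 h.r1 ha1 hmr.le hm0.le x1.le x5 hz2 hzS.2.1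
    have j0 := jb_pow_nn (sg α (z.1 + z.2)) (-(1 + 2 * ε))
    have j1 := jb_pow_nn (sg α z.1) (-(1 + 2 * ε))
    have j2 := jb_pow_nn (sg α z.2) (-(1 + 2 * ε))
    have jj := jb_Lam (by unfold Lam; positivity) hzS.2.2.2 (by linarith : 1 ≤ 1 + 2 * ε)
    calc _ ≤ (80 * z.2.2.1 * xo z ^ (3 * α / 2 - 1 - μ)) * (jb (sg α (z.1 + z.2)) ^ (-(1 + 2 * ε)) * jb (sg α z.1) ^ (-(1 + 2 * ε)) * (1 / Lam α z)) := by
          gcongr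
      _ = _ := by unfold Lam; field_simp; ring

/-- the trilinear form in standard position is bounded -/
lemma B_std {α r ε μ : ℝ} (h : Par α r ε μ) : Bd (R0.indicator (k0 α r ε)) := by
  have hk := k0_meas α r ε
  have m1 : MeasurableSet (R0 ∩ {z | xo z ≤ 1}) := R0_meas.inter (measurableSet_le (by fun_prop) (by fun_prop))
  have m2 : MeasurableSet (R0 ∩ {z | 1 ≤ xo z ∧ xo z ^ (110 : ℝ) ≤ Qf α z}) := R0_meas.inter 
    ((measurableSet_le (f := fun _ => (1 : ℝ)) (by fun_prop) (by fun_prop)).inter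
    (measurableSet_le (f := fun z => xo z ^ (110 : ℝ)) (g := fun z => Qf α z) (by fun_prop) (by fun_prop)))
  have m3 := (NR_meas α).inter ((low_meas α).inter (measurableSet_le (f := fun z => xo z ^ (α / 2) / 2) (g := fun z => |Df z|) (by fun_prop) (by fun_prop)))
  have m4 := (NR_meas α).inter ((low_meas α).inter (measurableSet_le (f := fun z => Lam α z) (g := fun z => |sg α z.2|) (by fun_prop) (by fun_prop)))
  have m5 := (NR_meas α).inter (measurableSet_le (f := fun z => Lam α z) (g := fun z : E3 × E3 => |sg α (z.1 + z.2)|) (by fun_prop) (by fun_prop))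
  have m6 := (NR_meas α).inter (measurableSet_le (f := fun z => Lam α z) (g := fun z : E3 × E3 => |sg α z.1|) (by fun_prop) (by fun_prop))
  have u1 := Bd_union hk m1 m2 (B0a h) (B0b h)
  have u2 := Bd_union hk (m1.union m2) m3 u1 (B1a h)
  have u3 := Bd_union hk ((m1.union m2).union m3) m4 u2 (B1b h)
  have u4 := Bd_union hk (((m1.union m2).union m3).union m4) m5 u3 (B2c h)
  have u5 := Bd_union hk ((((m1.union m2).union m3).union m4).union m5) m6 u4 (B2d h)
  have u6 := Bd_union hk (((((m1.union m2).union m3).union m4).union m5).union m6) (S2a_meas α) u5 (B2a h)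
  have u7 := Bd_union hk ((((((m1.union m2).union m3).union m4).union m5).union m6).union (S2a_meas α)) (S2a'_meas α) u6 (B2a' h)
  have mU := (((((((m1.union m2).union m3).union m4).union m5).union m6).union (S2a_meas α)).union (S2a'_meas α))
  have u8 := Bd_union hk mU (S2e_meas α) u7 (B2e h)
  refine u8.mono 1 (by simp) (hk.indicator (mU.union (S2e_meas α))) fun z => ?_
  rw [one_mul]
  refine indicator_le_indicator_of_subset ?_ (fun _ => zero_le) z
  intro z hz
  obtain ⟨x1, x2, x3, x4, x5⟩ := R0_x hz
  rcases le_total (xo z) 1 with h1 | h1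
  · iterate 7 left
    left
    exact ⟨hz, h1⟩
  rcases le_total (xo z ^ (110 : ℝ)) (Qf α z) with h2 | h2
  · iterate 7 left
    right
    exact ⟨hz, h1, h2⟩
  have hN : z ∈ NR α := ⟨hz, h1, h2⟩
  rcases le_total (xo z ^ (α / 2) / 2) |Df z| with h3 | h3
  · rcases le_total z.2.2.1 (xo z ^ (-((α - 1) / 2))) with h4 | h4
    · iterate 6 left
      right
      exact ⟨hN, h4, h3⟩
    · rcases le_abs.1 h3 with h5 | h5
      · left; left; right
        exact ⟨hN, h4, h5⟩
      · left; right
        exact ⟨hN, h4, h5⟩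
  · rcases max_sg (by linarith [h.a1]) z hz h3 with h5 | h5 | h5
    · iterate 4 left
      right
      exact ⟨hN, h5⟩
    · iterate 3 left
      right
      exact ⟨hN, h5⟩
    · rcases le_total z.2.2.1 (xo z ^ (-((α - 1) / 2))) with h4 | h4
      · iterate 5 left
        right
        exact ⟨hN, h4, h5⟩
      · right
        exact ⟨hN, h4, h3, h5⟩

end KP

namespace KP
open MeasureTheory Set
open scoped ENNReal

/-! ### symmetrization -/

lemma ae_x : ∀ᵐ p : E3, p.2.1 ≠ 0 := by
  have h : ∀ᵐ x : ℝ, x ≠ 0 := by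
    simp [ae_iff]
  have q : Measure.QuasiMeasurePreserving (fun p : E3 => p.2.1) volume volume :=
    (Measure.quasiMeasurePreserving_fst (μ := (volume : Measure ℝ)) (ν := (volume : Measure ℝ))).comp
      (Measure.quasiMeasurePreserving_snd (μ := (volume : Measure ℝ)) (ν := (volume : Measure (ℝ × ℝ))))
  exact q.ae h

lemma Bd.mono_ae {k k' : E3 × E3 → ℝ≥0∞} (h : Bd k') (c : ℝ≥0∞) (hc : c ≠ ∞)
    (hk' : Measurable k') (hk : ∀ z : E3 × E3, z.1.2.1 ≠ 0 → z.2.2.1 ≠ 0 → k z ≤ c * k' z) : Bd k := by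
  obtain ⟨C, hC, hh⟩ := h
  refine ⟨c * C, ENNReal.mul_ne_top hc hC, fun G F1 F2 hG h1 h2 => ?_⟩
  have : Tf k G F1 F2 ≤ c * Tf k' G F1 F2 := by
    unfold Tf
    rw [← lintegral_const_mul]
    · refine lintegral_mono_ae ?_
      filter_upwards [ae_x] with p1 hp1
      rw [← lintegral_const_mul]
      · refine lintegral_mono_ae ?_
        filter_upwards [ae_x] with p2 hp2
        calc G (p1 + p2) * F1 p1 * F2 p2 * k (p1, p2) ≤ G (p1 + p2) * F1 p1 * F2 p2 * (c * k' (p1, p2)) := by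
              gcongr; exact hk _ hp1 hp2
          _ = _ := by ring
      · fun_prop
    · apply Measurable.lintegral_prod_right' (f := fun z : E3 × E3 => G (z.1 + z.2) * F1 z.1 * F2 z.2 * k' (z.1, z.2))
      fun_prop
  refine this.trans ?_
  rw [mul_assoc]
  gcongr
  exact hh G F1 F2 hG h1 h2

lemma Bd_swap {k : E3 × E3 → ℝ≥0∞} (hk : Measurable k) (h : Bd k) : Bd (fun z => k (z.2, z.1)) := by
  obtain ⟨C, hC, hh⟩ := h
  refine ⟨C, hC, fun G F1 F2 hG h1 h2 => ?_⟩
  have : Tf (fun z => k (z.2, z.1)) G F1 F2 = Tf k G F2 F1 := by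
    unfold Tf
    rw [lintegral_lintegral_swap]
    · refine lintegral_congr fun p1 => lintegral_congr fun p2 => ?_
      rw [add_comm p2 p1]; ring
    · apply Measurable.aemeasurable
      show Measurable (fun z : E3 × E3 => G (z.1 + z.2) * F1 z.1 * F2 z.2 * k (z.2, z.1))
      fun_prop
  rw [this]
  refine (hh G F2 F1 hG h2 h1).trans (le_of_eq ?_)
  ring

lemma Bd_role {k : E3 × E3 → ℝ≥0∞} (hk : Measurable k) (h : Bd k) : Bd (fun z => k (z.1 + z.2, -z.2)) := by
  obtain ⟨C, hC, hh⟩ := h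
  refine ⟨C, hC, fun G F1 F2 hG h1 h2 => ?_⟩
  have : Tf (fun z => k (z.1 + z.2, -z.2)) G F1 F2 = Tf k F1 G (fun p => F2 (-p)) := by
    unfold Tf
    have m1 : Measurable (fun z : E3 × E3 => G (z.1 + z.2) * F1 z.1 * F2 z.2 * k (z.1 + z.2, -z.2)) := by fun_prop
    have m2 : Measurable (fun z : E3 × E3 => F1 (z.1 + z.2) * G z.1 * F2 (-z.2) * k (z.1, z.2)) := by fun_prop
    rw [lintegral_lintegral_swap (f := fun p1 p2 => G (p1 + p2) * F1 p1 * F2 p2 * k (p1 + p2, -p2)) m1.aemeasurable,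
      lintegral_lintegral_swap (f := fun p1 p2 => F1 (p1 + p2) * G p1 * F2 (-p2) * k (p1, p2)) m2.aemeasurable]
    rw [← neg_mp.lintegral_comp (f := fun y => ∫⁻ x, F1 (x + y) * G x * F2 (-y) * k (x, y))]
    · refine lintegral_congr fun p2 => ?_
      rw [← lintegral_add_right_eq_self (fun x => F1 (x + -p2) * G x * F2 (- -p2) * k (x, -p2)) p2]
      refine lintegral_congr fun p1 => ?_
      rw [add_neg_cancel_right, neg_neg]; ring
    · exact Measurable.lintegral_prod_left' m2
  rw [this]
  refine (hh F1 G _ h1 hG (by fun_prop)).trans (le_of_eq ?_)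
  rw [nrm_comp (fun p => -p) neg_mp F2 h2]
  ring

noncomputable def Nm (r x1 x2 : ℝ) : ℝ := |x1 + x2| * (1 + |x1 + x2|) ^ (-r) * (1 + |x1|) ^ r * (1 + |x2|) ^ r

lemma Nm_swap (r x1 x2 : ℝ) : Nm r x1 x2 = Nm r x2 x1 := by unfold Nm; rw [add_comm x1 x2]; ring

lemma Nm_neg (r x1 x2 : ℝ) : Nm r (-x1) (-x2) = Nm r x1 x2 := by
  unfold Nm; rw [← neg_add, abs_neg, abs_neg, abs_neg]

lemma pp1 {r a c : ℝ} (ha : 0 ≤ a) (hac : a ≤ c) (hr : 0 ≤ r) : (1 + c) ^ (-r) * (1 + a) ^ r ≤ 1 := by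
  rw [Real.rpow_neg (by linarith), inv_mul_le_one₀ (by have : 0 ≤ c := by linarith
                                                       positivity)]
  gcongr

lemma Nm_A {r a b : ℝ} (hr : 0 ≤ r) (ha : 0 < a) (hb : 0 < b) : Nm r a b ≤ 2 * Mm r (a + b) b := by
  unfold Nm Mm
  rw [abs_of_pos ha, abs_of_pos hb, abs_of_pos (by linarith : 0 < a + b)]
  have := pp1 ha.le (by linarith : a ≤ a + b) hr
  have h2 : 0 ≤ b * (1 + b) ^ (-r) * (1 + (a + b)) ^ (2 * r) := by positivity
  have h3 : 0 ≤ (a + b) * (1 + b) ^ r := by positivity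
  calc (a + b) * (1 + (a + b)) ^ (-r) * (1 + a) ^ r * (1 + b) ^ r 
      = ((1 + (a + b)) ^ (-r) * (1 + a) ^ r) * ((a + b) * (1 + b) ^ r) := by ring
    _ ≤ 1 * ((a + b) * (1 + b) ^ r) := by gcongr
    _ ≤ _ := by linarith

/-- smaller one is the second input -/
lemma Nm_B1 {r x b : ℝ} (hr : 0 ≤ r) (hr1 : r ≤ 1) (hb : 0 < b) (hbx : b ≤ x) : Nm r (x + b) (-b) ≤ 2 * Mm r (x + b) b := by
  unfold Nm Mm
  have hx : 0 < x := by linarith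
  rw [add_neg_cancel_right, abs_neg, abs_of_pos hx, abs_of_pos hb, abs_of_pos (by linarith : 0 < x + b)]
  have h1 : (1 + (x + b)) ^ r ≤ 2 * (1 + x) ^ r := by
    calc (1 + (x + b)) ^ r ≤ (2 * (1 + x)) ^ r := by gcongr; linarith
      _ ≤ 2 ^ (1 : ℝ) * (1 + x) ^ r := two_pow_le (by linarith) hr1
      _ = _ := by rw [Real.rpow_one]
  have h2 : 0 ≤ b * (1 + b) ^ (-r) * (1 + (x + b)) ^ (2 * r) := by positivity
  have h3 := pp1 hx.le le_rfl hr
  calc x * (1 + x) ^ (-r) * (1 + (x + b)) ^ r * (1 + b) ^ r ≤ (x + b) * (1 + x) ^ (-r) * (2 * (1 + x) ^ r) * (1 + b) ^ r := by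
        gcongr; linarith
    _ = 2 * ((1 + x) ^ (-r) * (1 + x) ^ r) * ((x + b) * (1 + b) ^ r) := by ring
    _ ≤ 2 * 1 * ((x + b) * (1 + b) ^ r) := by gcongr
    _ ≤ _ := by linarith

/-- smaller one is the output -/
lemma Nm_B2 {r x a : ℝ} (hr : 0 ≤ r) (hx : 0 < x) (hxa : x ≤ a) : Nm r (x + a) (-a) ≤ 2 * Mm r (x + a) x := by
  unfold Nm Mm
  have ha : 0 < a := by linarith
  rw [add_neg_cancel_right, abs_neg, abs_of_pos hx, abs_of_pos ha, abs_of_pos (by linarith : 0 < x + a)]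
  have h1 : (1 + a) ^ r ≤ (1 + (x + a)) ^ r := by gcongr; linarith
  have h2 : (1 + (x + a)) ^ r * (1 + (x + a)) ^ r = (1 + (x + a)) ^ (2 * r) := by
    rw [← Real.rpow_add (by linarith)]; congr 1; ring
  have h3 : 0 ≤ (x + a) * (1 + x) ^ r := by positivity
  have h4 : 0 ≤ x * (1 + x) ^ (-r) * (1 + (x + a)) ^ (2 * r) := by positivity
  calc x * (1 + x) ^ (-r) * (1 + (x + a)) ^ r * (1 + a) ^ r ≤ x * (1 + x) ^ (-r) * (1 + (x + a)) ^ r * (1 + (x + a)) ^ r := by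
        gcongr
    _ = x * (1 + x) ^ (-r) * (1 + (x + a)) ^ (2 * r) := by rw [mul_assoc, h2]
    _ ≤ _ := by linarith

/-- full kernel -/
noncomputable def kf (α r ε : ℝ) (z : E3 × E3) : ℝ≥0∞ := 
  ENNReal.ofReal (Nm r z.1.2.1 z.2.2.1 * Qf α z ^ (-(1 / 2 - ε)))

lemma Qf_swap (α : ℝ) (p1 p2 : E3) : Qf α (p2, p1) = Qf α (p1, p2) := by
  unfold Qf; simp only; rw [add_comm p2 p1]; ring

lemma Qf_neg (α : ℝ) (p1 p2 : E3) : Qf α (-p1, -p2) = Qf α (p1, p2) := by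
  unfold Qf; simp only; rw [← neg_add, sg_neg, sg_neg, sg_neg, jb_neg, jb_neg, jb_neg]

lemma Qf_role (α : ℝ) (p1 p2 : E3) : Qf α (p1 + p2, -p2) = Qf α (p1, p2) := by
  unfold Qf; simp only; rw [add_neg_cancel_right, sg_neg, jb_neg]; ring

noncomputable def kR (α r ε : ℝ) : E3 × E3 → ℝ≥0∞ := R0.indicator (k0 α r ε)
noncomputable def kA (α r ε : ℝ) (z : E3 × E3) : ℝ≥0∞ := kR α r ε z + kR α r ε (z.2, z.1)
noncomputable def kB (α r ε : ℝ) (z : E3 × E3) : ℝ≥0∞ := kA α r ε (z.1 + z.2, -z.2)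
noncomputable def kD (α r ε : ℝ) (z : E3 × E3) : ℝ≥0∞ := kA α r ε z + kB α r ε z + kB α r ε (z.2, z.1)
noncomputable def kE (α r ε : ℝ) (z : E3 × E3) : ℝ≥0∞ := kD α r ε z + kD α r ε (-z.1, -z.2)

@[fun_prop] lemma kR_meas (α r ε : ℝ) : Measurable (kR α r ε) := (k0_meas α r ε).indicator R0_meas
@[fun_prop] lemma kA_meas (α r ε : ℝ) : Measurable (kA α r ε) := by unfold kA; fun_prop
@[fun_prop] lemma kB_meas (α r ε : ℝ) : Measurable (kB α r ε) := by unfold kB; fun_prop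
@[fun_prop] lemma kD_meas (α r ε : ℝ) : Measurable (kD α r ε) := by unfold kD; fun_prop
@[fun_prop] lemma kE_meas (α r ε : ℝ) : Measurable (kE α r ε) := by unfold kE; fun_prop

lemma kE_Bd {α r ε μ : ℝ} (h : Par α r ε μ) : Bd (kE α r ε) := by
  have b0 : Bd (kR α r ε) := B_std h
  have b1 : Bd (kA α r ε) := b0.add (Bd_swap (by fun_prop) b0) (by fun_prop)
  have b2 : Bd (kB α r ε) := Bd_role (by fun_prop) b1
  have b3 : Bd (kD α r ε) := (b1.add b2 (by fun_prop)).add (Bd_swap (by fun_prop) b2) (by fun_prop)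
  refine b3.add ?_ (by fun_prop)
  refine Bd_comp _ (by fun_prop) (fun p => -p) neg_mp (fun p q => neg_add p q) ?_
  simpa using b3

lemma le_kR {α r ε : ℝ} {p1 p2 : E3} {N : ℝ} (h1 : 0 < p2.2.1) (h2 : p2.2.1 ≤ p1.2.1) 
    (hN : N ≤ 2 * Mm r (p1.2.1 + p2.2.1) p2.2.1) :
    ENNReal.ofReal (N * Qf α (p1, p2) ^ (-(1 / 2 - ε))) ≤ 2 * kR α r ε (p1, p2) := by
  have hz : (p1, p2) ∈ R0 := ⟨h1, h2⟩
  rw [kR, indicator_of_mem hz, k0, kr, show (2 : ℝ≥0∞) = ENNReal.ofReal 2 by simp, ← ENNReal.ofReal_mul (by norm_num)]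
  apply ENNReal.ofReal_le_ofReal
  have hQ : 0 ≤ Qf α (p1, p2) ^ (-(1 / 2 - ε)) := Real.rpow_nonneg (zero_le_one.trans (Qf_one _ _)) _
  rw [← mul_assoc]
  gcongr
  exact hN

lemma kf_A {α r ε : ℝ} (hr : 0 ≤ r) (p1 p2 : E3) (h1 : 0 < p1.2.1) (h2 : 0 < p2.2.1) :
    kf α r ε (p1, p2) ≤ 2 * kA α r ε (p1, p2) := by
  unfold kf kA
  rw [mul_add]
  rcases le_total p2.2.1 p1.2.1 with h | h
  · exact (le_kR h2 h (Nm_A hr h1 h2)).trans le_self_add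
  · rw [← Qf_swap, Nm_swap]
    exact (le_kR h1 h (Nm_A hr h2 h1)).trans le_add_self

lemma kf_B {α r ε : ℝ} (hr : 0 ≤ r) (hr1 : r ≤ 1) (p1 p2 : E3) (h1 : 0 < p1.2.1 + p2.2.1) (h2 : p2.2.1 < 0) :
    kf α r ε (p1, p2) ≤ 2 * kB α r ε (p1, p2) := by
  unfold kf kB kA
  rw [mul_add]
  simp only
  have e1 : (p1 + p2).2.1 = p1.2.1 + p2.2.1 := rfl
  have e2 : (-p2).2.1 = -p2.2.1 := rfl
  rcases le_total (-p2.2.1) (p1.2.1 + p2.2.1) with h | h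
  · rw [← Qf_role]
    refine (le_kR (by rw [e2]; linarith) (by rw [e1, e2]; exact h) ?_).trans le_self_add
    rw [e1, e2]
    have := Nm_B1 hr hr1 (by linarith : 0 < -p2.2.1) h
    simpa using this
  · rw [← Qf_role, ← Qf_swap]
    refine (le_kR (by rw [e1]; linarith) (by rw [e1, e2]; exact h) ?_).trans le_add_self
    rw [e1, e2]
    have := Nm_B2 hr h1 h
    simpa [add_comm] using this

lemma kf_swap (α r ε : ℝ) (p1 p2 : E3) : kf α r ε (p2, p1) = kf α r ε (p1, p2) := by
  unfold kf; simp only; rw [Qf_swap, Nm_swap]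

lemma kf_neg (α r ε : ℝ) (p1 p2 : E3) : kf α r ε (-p1, -p2) = kf α r ε (p1, p2) := by
  unfold kf; simp only; rw [Qf_neg]
  congr 2
  exact Nm_neg r p1.2.1 p2.2.1

lemma kf_D {α r ε : ℝ} (hr : 0 ≤ r) (hr1 : r ≤ 1) (p1 p2 : E3) (h : 0 < p1.2.1 + p2.2.1) (h1 : p1.2.1 ≠ 0) (h2 : p2.2.1 ≠ 0) :
    kf α r ε (p1, p2) ≤ 2 * kD α r ε (p1, p2) := by
  unfold kD
  rw [mul_add, mul_add]
  rcases lt_or_gt_of_ne h2 with h3 | h3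
  · exact ((kf_B hr hr1 p1 p2 h h3).trans le_add_self).trans le_self_add
  rcases lt_or_gt_of_ne h1 with h4 | h4
  · rw [← kf_swap]
    exact (kf_B hr hr1 p2 p1 (by linarith) h4).trans le_add_self
  · exact ((kf_A hr p1 p2 h4 h3).trans le_self_add).trans le_self_add

lemma kf_Bd {α r ε μ : ℝ} (h : Par α r ε μ) : Bd (kf α r ε) := by
  refine (kE_Bd h).mono_ae 2 (by simp) (by fun_prop) ?_
  rintro ⟨p1, p2⟩ h1 h2
  unfold kE
  rw [mul_add]
  rcases lt_trichotomy (p1.2.1 + p2.2.1) 0 with h3 | h3 | h3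
  · rw [← kf_neg]
    refine (kf_D h.r0 h.r1 (-p1) (-p2) ?_ ?_ ?_).trans le_add_self
    · show 0 < -p1.2.1 + -p2.2.1
      linarith
    · exact neg_ne_zero.2 h1
    · exact neg_ne_zero.2 h2
  · simp [kf, Nm, h3]
  · exact (kf_D h.r0 h.r1 p1 p2 h3 h1 h2).trans le_self_add

end KP


namespace KP

lemma nrm_mono {F G : E3 → ℝ≥0∞} (h : ∀ p, F p ≤ G p) : nrm F ≤ nrm G := by
  unfold nrm
  gcongr with p
  exact h p

lemma nrm_const_mul (c : ℝ≥0∞) (F : E3 → ℝ≥0∞) (hF : Measurable F) :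
    nrm (fun p => c * F p) = c * nrm F := by
  unfold nrm
  simp only [mul_pow]
  rw [lintegral_const_mul _ (by fun_prop), half_mul]
  congr 1
  rw [← ENNReal.rpow_natCast, ← ENNReal.rpow_mul]; norm_num

/-- duality -/
lemma dual {H : E3 → ℝ≥0∞} (hH : Measurable H) {C : ℝ≥0∞}
    (h : ∀ G : E3 → ℝ≥0∞, Measurable G → ∫⁻ p, G p * H p ≤ C * nrm G) : nrm H ≤ C := by
  set G : ℕ → E3 → ℝ≥0∞ := fun n => (Metric.ball (0:E3) n).indicator (fun p => min (H p) n) with hG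
  have hGm : ∀ n, Measurable (G n) := fun n =>
    (hH.min measurable_const).indicator Metric.isOpen_ball.measurableSet
  have hGH : ∀ n p, G n p ≤ H p := fun n p => by
    simp only [hG]
    refine (indicator_le_self _ _ p).trans (min_le_left _ _)
  have hfin : ∀ n, ∫⁻ p, G n p ^ 2 ≠ ∞ := fun n => by
    have : ∀ p, G n p ^ 2 ≤ (Metric.ball (0:E3) n).indicator (fun _ => (n:ℝ≥0∞)^2) p := fun p => by
      simp only [hG]
      by_cases hp : p ∈ Metric.ball (0:E3) n
      · rw [indicator_of_mem hp, indicator_of_mem hp]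
        gcongr; exact min_le_right _ _
      · rw [indicator_of_notMem hp, indicator_of_notMem hp]; simp
    refine ((lintegral_mono this).trans_lt ?_).ne
    rw [lintegral_indicator Metric.isOpen_ball.measurableSet, setLIntegral_const]
    exact ENNReal.mul_lt_top (by simp [ENNReal.pow_lt_top]) measure_ball_lt_top
  have hn : ∀ n, nrm (G n) ≤ C := fun n => by
    have h1 : ∫⁻ p, G n p ^ 2 ≤ C * nrm (G n) := by
      refine le_trans (lintegral_mono fun p => ?_) (h _ (hGm n))
      rw [sq]; gcongr; exact hGH n p
    have h2 : ∫⁻ p, G n p ^ 2 = nrm (G n) * nrm (G n) := by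
      rw [← sq]; unfold nrm; rw [half_sq]
    rw [h2] at h1
    have h3 : nrm (G n) ≠ ∞ := by
      unfold nrm; exact ENNReal.rpow_ne_top_of_nonneg (by norm_num) (hfin n)
    by_cases h0 : nrm (G n) = 0
    · rw [h0]; simp
    · exact (ENNReal.mul_le_mul_iff_left h0 h3).1 h1
  have hmono : ∀ p, Monotone fun n => G n p := fun p m n hmn => by
    simp only [hG]
    by_cases hp : p ∈ Metric.ball (0:E3) m
    · have hp' : p ∈ Metric.ball (0:E3) n :=
        Metric.ball_subset_ball (by exact_mod_cast hmn) hp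
      rw [indicator_of_mem hp, indicator_of_mem hp']
      gcongr
    · rw [indicator_of_notMem hp]; simp
  have hsup : ∀ p, ⨆ n, G n p ^ 2 = H p ^ 2 := fun p => by
    apply le_antisymm
    · exact iSup_le fun n => by gcongr; exact hGH n p
    · have ht : Filter.Tendsto (fun n : ℕ => G n p) Filter.atTop (nhds (H p)) := by
        have h1 : Filter.Tendsto (fun n : ℕ => min (H p) (n:ℝ≥0∞)) Filter.atTop (nhds (min (H p) ∞)) :=
          tendsto_const_nhds.min ENNReal.tendsto_nat_nhds_top
        rw [min_eq_left le_top] at h1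
        refine h1.congr' ?_
        obtain ⟨N, hN⟩ := exists_nat_gt (dist p 0)
        filter_upwards [Filter.eventually_ge_atTop N] with n hn'
        simp only [hG]
        rw [indicator_of_mem]
        exact Metric.mem_ball.2 (hN.trans_le (by exact_mod_cast hn'))
      have h2 := (ENNReal.continuous_pow 2).tendsto (H p) |>.comp ht
      exact le_of_tendsto' h2 fun n => le_iSup (fun n => G n p ^ 2) n
  have key : ∫⁻ p, H p ^ 2 ≤ C ^ 2 := by
    simp only [← hsup]
    rw [lintegral_iSup (fun n => (hGm n).pow_const 2)
      (fun m n hmn p => by simp only; gcongr; exact hmono p hmn)]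
    refine iSup_le fun n => ?_
    have h2 : ∫⁻ p, G n p ^ 2 = nrm (G n) ^ 2 := by unfold nrm; rw [half_sq]
    rw [h2]; gcongr; exact hn n
  unfold nrm
  calc _ ≤ (C ^ 2) ^ (1/2:ℝ) := by gcongr
    _ = C := by rw [← ENNReal.rpow_natCast, ← ENNReal.rpow_mul]; norm_num

lemma Bd.bilin {k : E3 × E3 → ℝ≥0∞} (h : Bd k) (hk : Measurable k) :
    ∃ C : ℝ≥0∞, C ≠ ∞ ∧ ∀ F1 F2 : E3 → ℝ≥0∞, Measurable F1 → Measurable F2 →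
      nrm (fun p => ∫⁻ p1, F1 p1 * F2 (p - p1) * k (p1, p - p1)) ≤ C * (nrm F1 * nrm F2) := by
  obtain ⟨C, hC, hB⟩ := h
  refine ⟨C, hC, fun F1 F2 h1 h2 => dual ?_ fun G hG => ?_⟩
  · exact Measurable.lintegral_prod_right' (f := fun z : E3 × E3 =>
            F1 z.2 * F2 (z.1 - z.2) * k (z.2, z.1 - z.2)) (by fun_prop)
  · rw [← Tf_eq k G F1 F2 hk hG h1 h2]
    refine (hB G F1 F2 hG h1 h2).trans (le_of_eq ?_)
    ring

lemma br_le (x : ℝ) : 1 + x ^ 2 ≤ jb x ^ 2 := by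
  unfold jb; nlinarith [abs_nonneg x, sq_abs x]

lemma le_br (x : ℝ) : jb x ^ 2 ≤ 2 * (1 + x ^ 2) := by
  unfold jb; nlinarith [sq_nonneg (|x| - 1), sq_abs x]

lemma br_pos (x : ℝ) : 0 < 1 + x ^ 2 := by positivity

lemma br_up (x : ℝ) {e : ℝ} (he : 0 ≤ e) : (1 + x ^ 2) ^ (e / 2) ≤ jb x ^ e := by
  calc (1 + x ^ 2) ^ (e / 2) ≤ (jb x ^ 2) ^ (e / 2) :=
        Real.rpow_le_rpow (br_pos x).le (br_le x) (by linarith)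
    _ = _ := by
        rw [← Real.rpow_natCast, ← Real.rpow_mul (jb_pos x).le]; congr 1; push_cast; ring

lemma br_dn (x : ℝ) {e : ℝ} (he : 0 ≤ e) : jb x ^ e ≤ 2 ^ (e / 2) * (1 + x ^ 2) ^ (e / 2) := by
  calc jb x ^ e = (jb x ^ 2) ^ (e / 2) := by
        rw [← Real.rpow_natCast, ← Real.rpow_mul (jb_pos x).le]; congr 1; push_cast; ring
    _ ≤ (2 * (1 + x ^ 2)) ^ (e / 2) :=
        Real.rpow_le_rpow (by positivity) (le_br x) (by linarith)
    _ = _ := Real.mul_rpow (by norm_num) (br_pos x).le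

lemma br_neg (x : ℝ) {e : ℝ} (he : 0 ≤ e) :
    (1 + x ^ 2) ^ (-e / 2) ≤ 2 ^ (e / 2) * jb x ^ (-e) := by
  have h := br_dn x he
  have h1 := Real.rpow_pos_of_pos (br_pos x) (e / 2)
  have h2 := Real.rpow_pos_of_pos (jb_pos x) e
  rw [neg_div, Real.rpow_neg (br_pos x).le, Real.rpow_neg (jb_pos x).le, ← div_eq_mul_inv,
    le_div_iff₀ h2, inv_mul_le_iff₀ h1]
  linarith

lemma w_x {s r x1 x2 : ℝ} (hr : 0 ≤ r) (hs : 0 ≤ s + r) :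
    (1 + (x1 + x2) ^ 2) ^ (s / 2) ≤ 2 ^ (r / 2) * 2 ^ ((s + r) / 2) * ((1 + |x1 + x2|) ^ (-r) *
      (1 + |x1|) ^ r * (1 + |x2|) ^ r) * ((1 + x1 ^ 2) ^ (s / 2) * (1 + x2 ^ 2) ^ (s / 2)) := by
  have e0 : ∀ x : ℝ, (1 + x ^ 2) ^ ((s + r) / 2) = (1 + x ^ 2) ^ (r / 2) * (1 + x ^ 2) ^ (s / 2) := by
    intro x; rw [← Real.rpow_add (br_pos x)]; congr 1; ring
  have e1 : (1 + (x1 + x2) ^ 2) ^ (s / 2) =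
      (1 + (x1 + x2) ^ 2) ^ (-r / 2) * (1 + (x1 + x2) ^ 2) ^ ((s + r) / 2) := by
    rw [← Real.rpow_add (br_pos _)]; congr 1; ring
  have h2 : (1 + (x1 + x2) ^ 2) ^ ((s + r) / 2) ≤
      2 ^ ((s + r) / 2) * ((1 + x1 ^ 2) ^ ((s + r) / 2) * (1 + x2 ^ 2) ^ ((s + r) / 2)) := by
    rw [← Real.mul_rpow (br_pos _).le (br_pos _).le,
      ← Real.mul_rpow (by norm_num) (by positivity)]
    apply Real.rpow_le_rpow (by positivity) _ (by linarith)
    nlinarith [sq_nonneg (x1 - x2), sq_nonneg (x1 * x2)]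
  have h3 := br_neg (x1 + x2) hr
  have h4 := br_up x1 hr
  have h5 := br_up x2 hr
  have e2 : ∀ x, (1 + |x|) = jb x := fun x => rfl
  rw [e2, e2, e2, e1]
  rw [e0 x1, e0 x2] at h2
  have p0 := Real.rpow_nonneg (jb_pos (x1 + x2)).le (-r)
  have p1 := Real.rpow_nonneg (br_pos x1).le (s / 2)
  have p2 := Real.rpow_nonneg (br_pos x2).le (s / 2)
  have p3 := Real.rpow_nonneg (br_pos x1).le (r / 2)
  have p4 := Real.rpow_nonneg (br_pos x2).le (r / 2)
  have p5 := Real.rpow_nonneg (jb_pos x1).le r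
  have p6 := Real.rpow_nonneg (jb_pos x2).le r
  calc _ ≤ (2 ^ (r / 2) * jb (x1 + x2) ^ (-r)) * (2 ^ ((s + r) / 2) *
        ((jb x1 ^ r * (1 + x1 ^ 2) ^ (s / 2)) * (jb x2 ^ r * (1 + x2 ^ 2) ^ (s / 2)))) := by
        apply mul_le_mul h3 (h2.trans _) (by positivity) (by positivity)
        gcongr
    _ = _ := by ring

lemma w_s (x : ℝ) {ε : ℝ} (he0 : 0 ≤ ε) (he : ε ≤ 1 / 2) :
    1 ≤ 2 ^ ((1 / 2 - ε) / 2) * jb x ^ (-(1 / 2 - ε)) * (1 + x ^ 2) ^ ((1 / 2 + ε) / 2) := by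
  have h := br_dn x (e := 1 / 2 - ε) (by linarith)
  have h1 : (1 + x ^ 2) ^ ((1 / 2 - ε) / 2) ≤ (1 + x ^ 2) ^ ((1 / 2 + ε) / 2) :=
    Real.rpow_le_rpow_of_exponent_le (by nlinarith) (by linarith)
  have h2 := Real.rpow_pos_of_pos (jb_pos x) (1 / 2 - ε)
  rw [Real.rpow_neg (jb_pos x).le]
  have h3 : jb x ^ (1 / 2 - ε) ≤ 2 ^ ((1 / 2 - ε) / 2) * (1 + x ^ 2) ^ ((1 / 2 + ε) / 2) :=
    h.trans (by gcongr)
  rw [mul_right_comm, ← div_eq_mul_inv, le_div_iff₀ h2]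
  linarith

/-- the weight of `X^{s,b}` -/
noncomputable def wt (α s b : ℝ) (p : E3) : ℝ :=
  (1 + p.2.1 ^ 2) ^ (s / 2) * (1 + |sg α p| ^ 2) ^ (b / 2)

lemma wt_nonneg (α s b : ℝ) (p : E3) : 0 ≤ wt α s b p := by unfold wt; positivity

@[fun_prop] lemma wt_meas (α s b : ℝ) : Measurable (wt α s b) := by unfold wt; fun_prop

lemma wt_le {α s r ε : ℝ} (hr : 0 ≤ r) (hs : 0 ≤ s + r) (he0 : 0 ≤ ε) (he : ε ≤ 1 / 2) :
    ∃ c : ℝ, 0 < c ∧ ∀ p1 p2 : E3, |(p1 + p2).2.1| * wt α s (1 / 2 + ε - 1) (p1 + p2) ≤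
      c * (Nm r p1.2.1 p2.2.1 * Qf α (p1, p2) ^ (-(1 / 2 - ε))) *
        (wt α s (1 / 2 + ε) p1 * wt α s (1 / 2 + ε) p2) := by
  refine ⟨2 ^ (r / 2) * 2 ^ ((s + r) / 2) * (2 ^ ((1 / 2 - ε) / 2) * 2 ^ ((1 / 2 - ε) / 2) *
    2 ^ ((1 / 2 - ε) / 2)), by positivity, fun p1 p2 => ?_⟩
  have h1 := w_x (x1 := p1.2.1) (x2 := p2.2.1) hr hs
  have h2 := w_s (sg α p1) he0 he
  have h3 := w_s (sg α p2) he0 he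
  have h4 := br_neg (sg α (p1 + p2)) (e := 1 / 2 - ε) (by linarith)
  rw [Q_pow]
  unfold wt Nm
  simp only [sq_abs, Prod.snd_add, Prod.fst_add]
  rw [show (1 / 2 + ε - 1) / 2 = -(1 / 2 - ε) / 2 by ring]
  set A := (1 + (p1.2.1 + p2.2.1) ^ 2) ^ (s / 2)
  set B := (1 + sg α (p1 + p2) ^ 2) ^ (-(1 / 2 - ε) / 2)
  set B1 := (1 + sg α p1 ^ 2) ^ ((1 / 2 + ε) / 2)
  set B2 := (1 + sg α p2 ^ 2) ^ ((1 / 2 + ε) / 2)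
  have hB : 0 ≤ B := by positivity
  have hB1 : 0 ≤ B1 := by positivity
  have hB2 : 0 ≤ B2 := by positivity
  have q0 := Real.rpow_nonneg (jb_pos (sg α (p1 + p2))).le (-(1 / 2 - ε))
  have q1 := Real.rpow_nonneg (jb_pos (sg α p1)).le (-(1 / 2 - ε))
  have q2 := Real.rpow_nonneg (jb_pos (sg α p2)).le (-(1 / 2 - ε))
  set J := jb (sg α (p1 + p2)) ^ (-(1 / 2 - ε))
  set J1 := jb (sg α p1) ^ (-(1 / 2 - ε))
  set J2 := jb (sg α p2) ^ (-(1 / 2 - ε))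
  set t : ℝ := 2 ^ ((1 / 2 - ε) / 2) with ht
  have htp : 0 ≤ t := by positivity
  set R := 2 ^ (r / 2) * 2 ^ ((s + r) / 2) * ((1 + |p1.2.1 + p2.2.1|) ^ (-r) *
      (1 + |p1.2.1|) ^ r * (1 + |p2.2.1|) ^ r) * ((1 + p1.2.1 ^ 2) ^ (s / 2) * (1 + p2.2.1 ^ 2) ^ (s / 2)) with hR
  have hRp : 0 ≤ R := by positivity
  calc |p1.2.1 + p2.2.1| * (A * B) ≤ |p1.2.1 + p2.2.1| * (R * (t * J)) := by gcongr
    _ ≤ |p1.2.1 + p2.2.1| * (R * (t * J)) * ((t * J1 * B1) * (t * J2 * B2)) := by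
        apply le_mul_of_one_le_right (by positivity)
        exact one_le_mul_of_one_le_of_one_le h2 h3
    _ = _ := by rw [hR]; ring

end KP


namespace KP
open FourierTransform LineDeriv Convolution

abbrev V3 := WithLp 2 (ℝ × WithLp 2 (ℝ × ℝ))

noncomputable instance : MeasurableSpace V3 := borel V3
instance : BorelSpace V3 := ⟨rfl⟩

noncomputable def L3 : V3 ≃L[ℝ] E3 :=
  (WithLp.prodContinuousLinearEquiv 2 ℝ ℝ (WithLp 2 (ℝ × ℝ))).trans
    ((ContinuousLinearEquiv.refl ℝ ℝ).prodCongr (WithLp.prodContinuousLinearEquiv 2 ℝ ℝ ℝ))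

lemma inner_V3 (q w : V3) : inner ℝ q w =
    (L3 q).1 * (L3 w).1 + (L3 q).2.1 * (L3 w).2.1 + (L3 q).2.2 * (L3 w).2.2 := by
  simp [L3, WithLp.prod_inner_apply]
  ring

lemma map_eq (M : V3 ≃L[ℝ] E3) :
    ∃ c : NNReal, c ≠ 0 ∧ Measure.map M (volume : Measure V3) = c • (volume : Measure E3) := by
  have : (Measure.map M (volume : Measure V3)).IsAddHaarMeasure := M.isAddHaarMeasure_map volume
  refine ⟨_, ?_, Measure.isAddLeftInvariant_eq_smul (Measure.map M (volume : Measure V3))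
    (volume : Measure E3)⟩
  exact (Measure.addHaarScalarFactor_pos_of_isAddHaarMeasure _ _).ne'

noncomputable def M3 : V3 ≃L[ℝ] E3 :=
  L3.trans (ContinuousLinearEquiv.smulLeft (Units.mk0 (-(2 * Real.pi)) (by simp [Real.pi_ne_zero])))

lemma M3_apply (w : V3) : M3 w = (-(2 * Real.pi)) • L3 w := rfl

/-- pull back to the inner product space -/
noncomputable def pb (u : SchwartzMap E3 ℂ) : SchwartzMap V3 ℂ :=
  SchwartzMap.compCLMOfContinuousLinearEquiv ℂ L3 u

lemma FT_eq : ∃ c : ℝ, 0 < c ∧ ∀ (u : SchwartzMap E3 ℂ) (w : V3),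
    (𝓕⁻ (pb u)) w = c • FT3 (fun q => u q) (M3 w) := by
  obtain ⟨c, hc, h⟩ := map_eq L3
  refine ⟨c, by positivity, fun u w => ?_⟩
  rw [SchwartzMap.fourierInv_coe, Real.fourierInv_eq']
  have e1 : ∀ q : V3, Complex.exp (↑(2 * Real.pi * inner ℝ q w) * Complex.I) • pb u q =
      (fun q : E3 => Complex.exp (-Complex.I *
        ((q.1 * (M3 w).1 + q.2.1 * (M3 w).2.1 + q.2.2 * (M3 w).2.2 : ℝ) : ℂ)) * u q) (L3 q) := by
    intro q
    rw [inner_V3, M3_apply]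
    simp only [smul_eq_mul, Prod.smul_fst, Prod.smul_snd]
    have e2 : pb u q = u (L3 q) := rfl
    rw [e2]
    congr 2
    push_cast; ring
  simp only [e1]
  have h2 := (L3.toHomeomorph.isClosedEmbedding.measurableEmbedding).integral_map (μ := (volume : Measure V3))
    (fun q : E3 => Complex.exp (-Complex.I *
        ((q.1 * (M3 w).1 + q.2.1 * (M3 w).2.1 + q.2.2 * (M3 w).2.2 : ℝ) : ℂ)) * u q)
  have h3 : Measure.map (L3.toHomeomorph) (volume : Measure V3) = c • (volume : Measure E3) := h
  rw [h3, integral_smul_nnreal_measure] at h2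
  exact h2.symm

lemma FT_cont (u : SchwartzMap E3 ℂ) : Measurable (FT3 (fun q => u q)) := by
  obtain ⟨c, hc, h⟩ := FT_eq
  have e : FT3 (fun q => u q) = fun p => c⁻¹ • (𝓕⁻ (pb u)) (M3.symm p) := by
    funext p
    rw [h, M3.apply_symm_apply, smul_smul, inv_mul_cancel₀ hc.ne', one_smul]
  rw [e]
  exact (((𝓕⁻ (pb u)).continuous.comp M3.symm.continuous).const_smul c⁻¹).measurable

noncomputable def mulS (u v : SchwartzMap E3 ℂ) : SchwartzMap E3 ℂ :=
  SchwartzMap.pairing (ContinuousLinearMap.mul ℂ ℂ) u v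

lemma dx_eq (u v : SchwartzMap E3 ℂ) :
    dxProd (fun q => u q) (fun q => v q) = fun q => (∂_{((0:ℝ),(1:ℝ),(0:ℝ))} (mulS u v)) q := by
  funext p
  rw [SchwartzMap.lineDerivOp_apply_eq_fderiv]
  rfl

lemma pb_dx (w : SchwartzMap E3 ℂ) (m : E3) : pb (∂_{m} w) = ∂_{L3.symm m} (pb w) := by
  unfold pb
  rw [SchwartzMap.lineDerivOp_compCLMOfContinuousLinearEquiv, L3.apply_symm_apply]

lemma pb_mul (u v : SchwartzMap E3 ℂ) :
    𝓕⁻ (pb (mulS u v)) = SchwartzMap.convolution (ContinuousLinearMap.mul ℂ ℂ) (𝓕⁻ (pb u)) (𝓕⁻ (pb v)) := by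
  have h := SchwartzMap.fourier_convolution (ContinuousLinearMap.mul ℂ ℂ) (𝓕⁻ (pb u)) (𝓕⁻ (pb v))
  rw [FourierTransform.fourier_fourierInv_eq, FourierTransform.fourier_fourierInv_eq] at h
  have h2 : pb (mulS u v) = SchwartzMap.pairing (ContinuousLinearMap.mul ℂ ℂ) (pb u) (pb v) := by
    ext x; rfl
  rw [h2, ← h, FourierTransform.fourierInv_fourier_eq]

lemma FT_bound : ∃ c : ℝ≥0∞, c ≠ ∞ ∧ ∀ (u v : SchwartzMap E3 ℂ) (p : E3),
    ‖FT3 (dxProd (fun q => u q) (fun q => v q)) p‖ₑ ≤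
      c * (ENNReal.ofReal |p.2.1| * ∫⁻ p1, ‖FT3 (fun q => u q) p1‖ₑ * ‖FT3 (fun q => v q) (p - p1)‖ₑ) := by
  obtain ⟨c, hc, h⟩ := FT_eq
  obtain ⟨d, hd, hm⟩ := map_eq M3
  refine ⟨ENNReal.ofReal c * d, by finiteness, fun u v p => ?_⟩
  obtain ⟨w, rfl⟩ := M3.surjective p
  have h1 := h (∂_{((0:ℝ),(1:ℝ),(0:ℝ))} (mulS u v)) w
  rw [← dx_eq, pb_dx, SchwartzMap.fourierInv_lineDerivOp_eq] at h1
  have ht : (fun x : V3 => inner ℝ x (L3.symm ((0:ℝ),(1:ℝ),(0:ℝ)))).HasTemperateGrowth := by fun_prop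
  rw [smul_apply, SchwartzMap.smulLeftCLM_apply_apply ht, inner_V3, pb_mul,
    SchwartzMap.convolution_apply, L3.apply_symm_apply] at h1
  have hU := h u
  have hV := h v
  generalize (𝓕⁻ (pb u) : SchwartzMap V3 ℂ) = U at h1 hU
  generalize (𝓕⁻ (pb v) : SchwartzMap V3 ℂ) = V at h1 hV
  have h2 : ‖((U : V3 → ℂ) ⋆[ContinuousLinearMap.mul ℂ ℂ] (V : V3 → ℂ)) w‖ₑ ≤
      ENNReal.ofReal c * (ENNReal.ofReal c * d) * ∫⁻ p1, ‖FT3 (fun q => u q) p1‖ₑ * ‖FT3 (fun q => v q) (M3 w - p1)‖ₑ := by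
    rw [convolution_def]
    refine (enorm_integral_le_lintegral_enorm _).trans ?_
    have e1 : ∀ t : V3, ‖(ContinuousLinearMap.mul ℂ ℂ) (U t) (V (w - t))‖ₑ =
        (fun p1 => ENNReal.ofReal c * ENNReal.ofReal c *
          (‖FT3 (fun q => u q) p1‖ₑ * ‖FT3 (fun q => v q) (M3 w - p1)‖ₑ)) (M3 t) := by
      intro t
      rw [hU, hV, ContinuousLinearMap.mul_apply', map_sub]
      simp only [enorm_mul, enorm_smul]
      rw [Real.enorm_of_nonneg hc.le]; ring
    simp only [e1]
    have h5 := (M3.toHomeomorph.isClosedEmbedding.measurableEmbedding).lintegral_map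
      (μ := (volume : Measure V3)) (fun p1 => ENNReal.ofReal c * ENNReal.ofReal c *
          (‖FT3 (fun q => u q) p1‖ₑ * ‖FT3 (fun q => v q) (M3 w - p1)‖ₑ))
    refine (le_of_eq h5.symm).trans ?_
    have h3 : Measure.map (M3.toHomeomorph) (volume : Measure V3) = d • (volume : Measure E3) := hm
    have m1 := FT_cont u
    have m2 := FT_cont v
    rw [h3, lintegral_smul_measure, lintegral_const_mul _ (by fun_prop)]
    apply le_of_eq
    rw [ENNReal.smul_def, smul_eq_mul]; ring
  have h4 : ENNReal.ofReal c * ‖FT3 (dxProd (fun q => u q) (fun q => v q)) (M3 w)‖ₑ =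
      ENNReal.ofReal |(M3 w).2.1| * ‖((U : V3 → ℂ) ⋆[ContinuousLinearMap.mul ℂ ℂ] (V : V3 → ℂ)) w‖ₑ := by
    have := congrArg (fun z => ‖z‖ₑ) h1
    simp only [enorm_smul] at this
    rw [Real.enorm_of_nonneg hc.le] at this
    rw [← this, ← mul_assoc]
    congr 1
    rw [M3_apply]
    simp only [Prod.smul_snd, Prod.smul_fst, smul_eq_mul, mul_zero, mul_one, zero_add, add_zero]
    rw [Real.enorm_eq_ofReal_abs, ← ofReal_norm, ← ENNReal.ofReal_mul (norm_nonneg _), abs_mul]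
    congr 2
    simp [abs_of_pos Real.pi_pos]
  have hc0 : ENNReal.ofReal c ≠ 0 := by simpa using hc
  rw [← ENNReal.mul_le_mul_iff_right hc0 (by finiteness), h4]
  refine (mul_le_mul_right h2 _).trans (le_of_eq ?_)
  ring

end KP


namespace KP

lemma Xnorm_eq (α s b : ℝ) (u : E3 → ℂ) :
    Xnorm α s b u = nrm (fun p => ENNReal.ofReal (wt α s b p) * ‖FT3 u p‖ₑ) := by
  unfold Xnorm nrm
  rw [eLpNorm_eq_lintegral_rpow_enorm_toReal (by norm_num) (by norm_num)]
  simp only [ENNReal.toReal_ofNat, ENNReal.rpow_ofNat]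
  congr 1
  apply lintegral_congr
  intro p
  rw [enorm_mul]
  congr 2
  rw [← ofReal_norm, Complex.norm_real, Real.norm_of_nonneg]
  · rfl
  · positivity

lemma main_est {α s r ε μ : ℝ} (h : Par α r ε μ) (hs : 0 ≤ s + r) :
    ∃ C : ℝ≥0∞, C ≠ ∞ ∧ ∀ u v : SchwartzMap E3 ℂ,
      Xnorm α s (1 / 2 + ε - 1) (dxProd (fun q => u q) (fun q => v q)) ≤
        C * (Xnorm α s (1 / 2 + ε) (fun q => u q) * Xnorm α s (1 / 2 + ε) (fun q => v q)) := by
  have hk : Measurable (kf α r ε) := by unfold kf Nm; fun_prop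
  obtain ⟨C, hC, hB⟩ := (kf_Bd h).bilin hk
  obtain ⟨d, hd, hF⟩ := FT_bound
  obtain ⟨c, hc, hw⟩ := wt_le (α := α) h.r0 hs h.e0.le (by linarith [h.e1])
  refine ⟨d * ENNReal.ofReal c * C, by finiteness, fun u v => ?_⟩
  have m1 := FT_cont u
  have m2 := FT_cont v
  rw [Xnorm_eq, Xnorm_eq, Xnorm_eq]
  set F1 : E3 → ℝ≥0∞ := fun p => ENNReal.ofReal (wt α s (1 / 2 + ε) p) * ‖FT3 (fun q => u q) p‖ₑ with hF1
  set F2 : E3 → ℝ≥0∞ := fun p => ENNReal.ofReal (wt α s (1 / 2 + ε) p) * ‖FT3 (fun q => v q) p‖ₑ with hF2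
  have n1 : Measurable F1 := by rw [hF1]; fun_prop
  have n2 : Measurable F2 := by rw [hF2]; fun_prop
  set H : E3 → ℝ≥0∞ := fun p => ∫⁻ p1, F1 p1 * F2 (p - p1) * kf α r ε (p1, p - p1) with hH
  have nH : Measurable H :=
    Measurable.lintegral_prod_right' (f := fun z : E3 × E3 =>
            F1 z.2 * F2 (z.1 - z.2) * kf α r ε (z.2, z.1 - z.2)) (by fun_prop)
  have key : ∀ p, ENNReal.ofReal (wt α s (1 / 2 + ε - 1) p) *
      ‖FT3 (dxProd (fun q => u q) (fun q => v q)) p‖ₑ ≤ (d * ENNReal.ofReal c) * H p := by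
    intro p
    calc _ ≤ ENNReal.ofReal (wt α s (1 / 2 + ε - 1) p) * (d * (ENNReal.ofReal |p.2.1| *
          ∫⁻ p1, ‖FT3 (fun q => u q) p1‖ₑ * ‖FT3 (fun q => v q) (p - p1)‖ₑ)) := by
          gcongr; exact hF u v p
      _ = d * ∫⁻ p1, ENNReal.ofReal (|p.2.1| * wt α s (1 / 2 + ε - 1) p) *
            (‖FT3 (fun q => u q) p1‖ₑ * ‖FT3 (fun q => v q) (p - p1)‖ₑ) := by
          rw [lintegral_const_mul _ (by fun_prop), ENNReal.ofReal_mul (abs_nonneg _)]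
          ring
      _ ≤ d * ∫⁻ p1, ENNReal.ofReal c * (F1 p1 * F2 (p - p1) * kf α r ε (p1, p - p1)) := by
          refine mul_le_mul_right (lintegral_mono fun p1 => ?_) _
          have h1 := hw p1 (p - p1)
          rw [add_sub_cancel] at h1
          have h2 := ENNReal.ofReal_le_ofReal h1
          have w1 := wt_nonneg α s (1 / 2 + ε) p1
          have w2 := wt_nonneg α s (1 / 2 + ε) (p - p1)
          rw [ENNReal.ofReal_mul' (mul_nonneg w1 w2), ENNReal.ofReal_mul hc.le,
            ENNReal.ofReal_mul w1] at h2
          refine (mul_le_mul_left h2 _).trans (le_of_eq ?_)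
          simp only [hF1, hF2, kf]
          ring
      _ = _ := by
          rw [lintegral_const_mul _ (by fun_prop), ← mul_assoc]
  calc _ ≤ nrm (fun p => (d * ENNReal.ofReal c) * H p) := nrm_mono key
    _ = (d * ENNReal.ofReal c) * nrm H := nrm_const_mul _ _ nH
    _ ≤ (d * ENNReal.ofReal c) * (C * (nrm F1 * nrm F2)) := by
        gcongr; exact hB F1 F2 n1 n2
    _ = _ := by ring

end KP

theorem statement15 (α s : ℝ) (hα₁ : 5 / 2 < α) (hα₂ : α < 4) (hs : 5 / 4 - α / 2 < s) :
    ∃ b C : ℝ, 1 / 2 < b ∧ 0 < C ∧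
      ∀ u v : SchwartzMap (ℝ × ℝ × ℝ) ℂ,
        Xnorm α s (b - 1) (dxProd (fun q => u q) (fun q => v q)) ≤
          ENNReal.ofReal C *
            (Xnorm α s b (fun q => u q) * Xnorm α s b (fun q => v q)) := by
  set r := max 0 (-s) with hr
  have hr0 : 0 ≤ r := le_max_left _ _
  have hrs : -s ≤ r := le_max_right _ _
  have hr2 : 2 * r < α - 5 / 2 := by
    rcases max_cases 0 (-s) with h | h <;> rw [hr] <;> linarith [h.1]
  have hp : KP.Par α r ((α - 5 / 2 - 2 * r) / 880) ((α - 5 / 2 - 2 * r) / 2) := by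
    constructor <;> linarith
  obtain ⟨C, hC, h⟩ := KP.main_est (s := s) hp (by linarith)
  refine ⟨1 / 2 + (α - 5 / 2 - 2 * r) / 880, C.toReal + 1, by linarith [hp.e0], by positivity,
    fun u v => (h u v).trans ?_⟩
  gcongr
  rw [ENNReal.ofReal_add ENNReal.toReal_nonneg (by norm_num), ENNReal.ofReal_toReal hC]
  exact le_self_add
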